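/- Let r ≥ 2 and d = 2r. Let M ⊆ I^a and N ⊆ I^b be subcomplexes of dimension d whose geometric realizations are compact topological d-manifolds without boundary (in particular ℤ/2-homology d-manifolds, the paper's hypothesis), and suppose H_r(|M|; ℤ/2) = 0 and H_r(|N|; ℤ/2) = 0. If Skel_r M and Skel_r N are isomorphic, then M and N are isomorphic. -/

import Mathlib

/-- A face of the cube `I^n`: `none` marks a free coordinate. -/
def CubeFace (n : ℕ) : Type := Fin n → Option Bool

namespace CubeFace

/-- The order on faces of the cube: `F ≤ G` iff every coordinate of `G` is free
or agrees with the corresponding coordinate of `F`. -/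
instance (n : ℕ) : PartialOrder (CubeFace n) where
  le F G := ∀ i, G i = none ∨ F i = G i
  le_refl F i := Or.inr rfl
  le_trans F G H h1 h2 i := by
    rcases h2 i with h | h
    · exact Or.inl h
    · rcases h1 i with h' | h'
      · exact Or.inl (h ▸ h')
      · exact Or.inr (h' ▸ h)
  le_antisymm F G h1 h2 := by
    funext i
    rcases h1 i with h | h
    · rcases h2 i with h' | h'
      · rw [h, h']
      · rw [← h', h]
    · exact h

/-- The face of `I^n` corresponding to a vertex. -/
def toFace {n : ℕ} (v : Fin n → Bool) : CubeFace n := fun i => some (v i)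

/-- The vertex set of a face. -/
def verts {n : ℕ} (F : CubeFace n) : Set (Fin n → Bool) := {v | toFace v ≤ F}

/-- The dimension of a face: its number of free coordinates. -/
def dim {n : ℕ} (F : CubeFace n) : ℕ :=
  haveI : DecidablePred (fun i => F i = none) := fun i => decEq (α := Option Bool) (F i) none
  (Finset.univ.filter (fun i => F i = none)).card

/-- A subcomplex of `I^n`: a nonempty, downward closed set of faces. -/
def IsSubcomplex {n : ℕ} (K : Set (CubeFace n)) : Prop :=
  K.Nonempty ∧ ∀ F ∈ K, ∀ G : CubeFace n, G ≤ F → G ∈ K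

/-- The vertex set of a subcomplex. -/
def cvert {n : ℕ} (K : Set (CubeFace n)) : Set (Fin n → Bool) := {v | toFace v ∈ K}

/-- A subcomplex `Γ ⊆ K` is face-like if, for every face `F` of `K`, the set of vertices
of `F` belonging to `Γ` is empty or the vertex set of a face of `Γ`. -/
def FaceLike {n : ℕ} (K Γ : Set (CubeFace n)) : Prop :=
  ∀ F ∈ K, verts F ∩ cvert Γ = ∅ ∨ ∃ G ∈ Γ, verts F ∩ cvert Γ = verts G

/-- The deletion `K ∖ Γ`: the faces of `K` with no vertex in `Γ`. -/
def delete {n : ℕ} (K Γ : Set (CubeFace n)) : Set (CubeFace n) :=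
  {F | F ∈ K ∧ verts F ∩ cvert Γ = ∅}

/-- The geometric realization of a subcomplex of `I^n`, as a subset of `ℝ^n`. -/
def real {n : ℕ} (K : Set (CubeFace n)) : Set (Fin n → ℝ) :=
  ⋃ F ∈ K, {x | (∀ i, 0 ≤ x i ∧ x i ≤ 1) ∧
    ∀ i, (F i = some false → x i = 0) ∧ (F i = some true → x i = 1)}

/-- The boundary `∂F̂` of a face `F`: all faces strictly below `F`. -/
def bdryHat {n : ℕ} (F : CubeFace n) : Set (CubeFace n) := {G | G ≤ F ∧ G ≠ F}

/-- The boundary of the cube `I^k`: all faces except the top one. -/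
def boundaryCube (k : ℕ) : Set (CubeFace k) := {F | F ≠ fun _ => none}

/-- The `k`-skeleton of a subcomplex. -/
def skel {n : ℕ} (k : ℕ) (K : Set (CubeFace n)) : Set (CubeFace n) :=
  {F | F ∈ K ∧ dim F ≤ k}

/-- Isomorphism of cubical subcomplexes: a bijection between the vertex sets under which
vertex sets of faces correspond to vertex sets of faces. -/
def Iso {m n : ℕ} (K : Set (CubeFace m)) (L : Set (CubeFace n)) : Prop :=
  ∃ f : (Fin m → Bool) → (Fin n → Bool),
    Set.BijOn f (cvert K) (cvert L) ∧
    ∀ W : Set (Fin m → Bool), W ⊆ cvert K →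
      ((∃ F ∈ K, verts F = W) ↔ (∃ G ∈ L, verts G = f '' W))

/-- `K` has dimension `d`. -/
def HasDim {n : ℕ} (K : Set (CubeFace n)) (d : ℕ) : Prop :=
  (∀ F ∈ K, dim F ≤ d) ∧ ∃ F ∈ K, dim F = d

end CubeFace

open CategoryTheory in
/-- The `j`-th singular homology of a topological space with coefficients in `R`. -/
noncomputable def sHomology (R : Type) [CommRing R] (X : Type) [TopologicalSpace X]
    (j : ℕ) : ModuleCat R :=
  ((AlgebraicTopology.alternatingFaceMapComplex (ModuleCat R)).obj
    (((SimplicialObject.whiskering _ _).obj (ModuleCat.free R)).obj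
      (TopCat.toSSet.obj (TopCat.of X)))).homology j

/-- `X` is a compact topological `d`-manifold without boundary. -/
def IsCompactManifold (X : Type) [TopologicalSpace X] (d : ℕ) : Prop :=
  CompactSpace X ∧ Nonempty (ChartedSpace (EuclideanSpace ℝ (Fin d)) X)

/-! ## Singular chains mod 2 (augmented, indexed by the number of vertices) -/

namespace CubMan

open Finset

/-- The face inclusion of standard simplices. -/
noncomputable def fc {n : ℕ} (i : Fin (n + 1)) :
    C(stdSimplex ℝ (Fin n), stdSimplex ℝ (Fin (n + 1))) :=
  ⟨stdSimplex.map i.succAbove, stdSimplex.continuous_map _⟩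

/-- Singular simplices with `n` vertices. -/
abbrev Sx (n : ℕ) (X : Type) [TopologicalSpace X] : Type := C(stdSimplex ℝ (Fin n), X)

/-- Singular chains mod 2. -/
abbrev Ch (n : ℕ) (X : Type) [TopologicalSpace X] : Type := Sx n X →₀ ZMod 2

section
variable {X Y W : Type} [TopologicalSpace X] [TopologicalSpace Y] [TopologicalSpace W]

/-- The singular boundary. -/
noncomputable def bd {n : ℕ} : Ch (n + 1) X →ₗ[ZMod 2] Ch n X :=
  Finsupp.linearCombination (ZMod 2) (fun σ => ∑ i, Finsupp.single (σ.comp (fc i)) 1)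

/-- Push forward of chains. -/
noncomputable def psh {n : ℕ} (f : C(X, Y)) : Ch n X →ₗ[ZMod 2] Ch n Y :=
  Finsupp.linearCombination (ZMod 2) (fun σ => Finsupp.single (f.comp σ) 1)

/-- The natural operator given by a universal chain. -/
noncomputable def nop {n k : ℕ} (τ : Ch k (stdSimplex ℝ (Fin n))) : Ch n X →ₗ[ZMod 2] Ch k X :=
  Finsupp.linearCombination (ZMod 2) (fun σ => psh σ τ)

/-- The fundamental simplex. -/
noncomputable def idc (n : ℕ) : Ch n (stdSimplex ℝ (Fin n)) :=
  Finsupp.single (ContinuousMap.id _) 1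

@[simp] lemma bd_single {n : ℕ} (σ : Sx (n + 1) X) :
    bd (Finsupp.single σ 1) = ∑ i, Finsupp.single (σ.comp (fc i)) (1 : ZMod 2) := by
  simp [bd]

@[simp] lemma psh_single {n : ℕ} (f : C(X, Y)) (σ : Sx n X) :
    psh f (Finsupp.single σ 1) = Finsupp.single (f.comp σ) (1 : ZMod 2) := by
  simp [psh]

@[simp] lemma nop_single {n k : ℕ} (τ : Ch k (stdSimplex ℝ (Fin n))) (σ : Sx n X) :
    nop τ (Finsupp.single σ 1) = psh σ τ := by
  simp [nop]

lemma lin_ext {n : ℕ} {V : Type} [AddCommMonoid V] [Module (ZMod 2) V]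
    {f g : Ch n X →ₗ[ZMod 2] V}
    (h : ∀ σ, f (Finsupp.single σ 1) = g (Finsupp.single σ 1)) : f = g := by
  apply Finsupp.lhom_ext'
  intro σ
  apply LinearMap.ext_ring
  simpa using h σ

lemma psh_psh {n : ℕ} (f : C(X, Y)) (g : C(Y, W)) (c : Ch n X) :
    psh g (psh f c) = psh (g.comp f) c := by
  have : (psh g).comp (psh f) = (psh (g.comp f) : Ch n X →ₗ[ZMod 2] Ch n W) := by
    apply lin_ext
    intro σ
    simp [ContinuousMap.comp_assoc]
  exact LinearMap.congr_fun this c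

lemma psh_id {n : ℕ} (c : Ch n X) : psh (ContinuousMap.id X) c = c := by
  have : (psh (ContinuousMap.id X)) = (LinearMap.id : Ch n X →ₗ[ZMod 2] Ch n X) := by
    apply lin_ext
    intro σ
    simp
  exact LinearMap.congr_fun this c

lemma bd_psh {n : ℕ} (f : C(X, Y)) (c : Ch (n + 1) X) : bd (psh f c) = psh f (bd c) := by
  have : bd.comp (psh f) = (psh f).comp (bd (n := n)) := by
    apply lin_ext
    intro σ
    simp [ContinuousMap.comp_assoc]
  exact LinearMap.congr_fun this c

lemma nop_psh {n k : ℕ} (τ : Ch k (stdSimplex ℝ (Fin n))) (f : C(X, Y)) (c : Ch n X) :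
    nop τ (psh f c) = psh f (nop τ c) := by
  have : (nop τ).comp (psh f) = (psh f).comp (nop τ) := by
    apply lin_ext
    intro σ
    simp [psh_psh]
  exact LinearMap.congr_fun this c

lemma nop_idc {n k : ℕ} (τ : Ch k (stdSimplex ℝ (Fin n))) : nop τ (idc n) = τ := by
  simp [idc, psh_id]

lemma psh_idc {n : ℕ} (σ : Sx n X) : psh σ (idc n) = Finsupp.single σ 1 := by
  simp [idc]

lemma fc_fc {n : ℕ} (i : Fin (n + 2)) (j : Fin (n + 1)) :
    (fc (i.succAbove j)).comp (fc (j.predAbove i)) = (fc i).comp (fc j) := by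
  ext1 x
  simp only [fc, ContinuousMap.comp_apply, ContinuousMap.coe_mk]
  rw [stdSimplex.map_comp_apply, stdSimplex.map_comp_apply]
  congr 1
  funext k
  exact Fin.succAbove_succAbove_succAbove_predAbove i j k

lemma two_smul_zero {V : Type*} [AddCommMonoid V] [Module (ZMod 2) V] (x : V) : x + x = 0 := by
  have := add_smul (1 : ZMod 2) 1 x
  rw [one_smul] at this
  rw [← this]
  have h : (1 + 1 : ZMod 2) = 0 := by decide
  rw [h, zero_smul]

lemma eq_of_add_zero {V : Type*} [AddCommGroup V] [Module (ZMod 2) V] {x y : V}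
    (h : x + y = 0) : x = y := by
  rw [eq_neg_of_add_eq_zero_left h]
  exact (eq_neg_of_add_eq_zero_left (two_smul_zero y)).symm

lemma bd_bd {n : ℕ} (c : Ch (n + 2) X) : bd (bd c) = 0 := by
  have : bd.comp bd = (0 : Ch (n + 2) X →ₗ[ZMod 2] Ch n X) := by
    apply lin_ext
    intro σ
    simp only [LinearMap.comp_apply, bd_single, map_sum, ContinuousMap.comp_assoc,
      LinearMap.zero_apply]
    rw [← Finset.sum_product']
    refine Finset.sum_involution (fun p _ => (p.1.succAbove p.2, p.2.predAbove p.1)) ?_ ?_ ?_ ?_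
    · rintro ⟨i, j⟩ _
      simp only [fc_fc]
      exact two_smul_zero _
    · rintro ⟨i, j⟩ _ _ h
      simp only [Prod.mk.injEq] at h
      exact Fin.succAbove_ne i j h.1
    · simp
    · rintro ⟨i, j⟩ _
      simp only [Prod.mk.injEq]
      constructor
      · exact Fin.succAbove_succAbove_predAbove i j
      · simp [Fin.predAbove_predAbove_succAbove]
  exact LinearMap.congr_fun this c

/-- Chains supported in a set of simplices with a given range constraint. -/
def inS {n : ℕ} (A : Set X) : Submodule (ZMod 2) (Ch n X) :=
  Finsupp.supported (ZMod 2) (ZMod 2) {σ | ∀ x, σ x ∈ A}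

lemma inS_single {n : ℕ} {A : Set X} {σ : Sx n X} (h : ∀ x, σ x ∈ A) :
    Finsupp.single σ 1 ∈ inS A :=
  Finsupp.single_mem_supported _ _ h

/-- Induction on the support. -/
lemma lin_maps {n : ℕ} {V : Type} [AddCommMonoid V] [Module (ZMod 2) V]
    (f : Ch n X →ₗ[ZMod 2] V) (P : Set (Sx n X)) (N : Submodule (ZMod 2) V)
    (h : ∀ σ ∈ P, f (Finsupp.single σ 1) ∈ N) (c : Ch n X)
    (hc : c ∈ Finsupp.supported (ZMod 2) (ZMod 2) P) : f c ∈ N := by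
  rw [← Finsupp.sum_single c, Finsupp.sum, map_sum]
  refine Submodule.sum_mem _ (fun σ hσ => ?_)
  have : Finsupp.single σ (c σ) = c σ • Finsupp.single σ 1 := by simp
  rw [this, map_smul]
  exact N.smul_mem _ (h σ (hc hσ))

lemma bd_inS {n : ℕ} {A : Set X} {c : Ch (n + 1) X} (hc : c ∈ inS A) : bd c ∈ inS A := by
  refine lin_maps bd _ _ (fun σ hσ => ?_) c hc
  rw [bd_single]
  exact Submodule.sum_mem _ (fun i _ => inS_single (fun x => hσ _))

lemma psh_inS {n : ℕ} {A : Set X} {B : Set Y} {c : Ch n X} (f : C(X, Y))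
    (h : ∀ x ∈ A, f x ∈ B) (hc : c ∈ inS A) : psh f c ∈ inS B := by
  refine lin_maps (psh f) _ _ (fun σ hσ => ?_) c hc
  rw [psh_single]
  exact inS_single (fun x => h _ (hσ x))

lemma inS_univ {n : ℕ} (c : Ch n X) : c ∈ inS (Set.univ : Set X) := by
  intro σ _ x
  trivial

lemma nop_inS {n k : ℕ} {A : Set X} {c : Ch n X} (τ : Ch k (stdSimplex ℝ (Fin n)))
    (hc : c ∈ inS A) : nop τ c ∈ inS A := by
  refine lin_maps (nop τ) _ _ (fun σ hσ => ?_) c hc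
  rw [nop_single]
  exact psh_inS σ (fun x _ => hσ x) (inS_univ τ)

end

end CubMan

/-! ## The cone construction -/

namespace CubMan

open Finset

section
variable {E : Type} [NormedAddCommGroup E] [NormedSpace ℝ E]

lemma rest_mem {n : ℕ} (x : stdSimplex ℝ (Fin (n + 1))) (h : x 0 ≠ 1) :
    (fun i : Fin n => x i.succ / (1 - x 0)) ∈ stdSimplex ℝ (Fin n) := by
  have h1 := stdSimplex.le_one x 0
  have h2 : 0 < 1 - x 0 := by
    rcases lt_or_eq_of_le h1 with h3 | h3
    · linarith
    · exact absurd h3 h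
  refine ⟨fun i => div_nonneg (stdSimplex.zero_le x _) h2.le, ?_⟩
  rw [← Finset.sum_div, div_eq_one_iff_eq h2.ne']
  have h3 := stdSimplex.sum_eq_one x
  rw [Fin.sum_univ_succ] at h3
  linarith

/-- The normalized last coordinates. -/
noncomputable def rest {n : ℕ} (x : stdSimplex ℝ (Fin (n + 1))) (h : x 0 ≠ 1) :
    stdSimplex ℝ (Fin n) := ⟨_, rest_mem x h⟩

/-- The underlying function of the cone. -/
noncomputable def coneFun {n : ℕ} (b : E) (σ : stdSimplex ℝ (Fin n) → E)
    (x : stdSimplex ℝ (Fin (n + 1))) : E :=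
  open Classical in
  if h : x 0 = 1 then b else x 0 • b + (1 - x 0) • σ (rest x h)

lemma coord_cont {n : ℕ} (i : Fin n) : Continuous (fun x : stdSimplex ℝ (Fin n) => x i) :=
  (continuous_apply i).comp continuous_subtype_val

lemma coneFun_cont {n : ℕ} (b : E) (σ : stdSimplex ℝ (Fin n) → E) (hσ : Continuous σ) :
    Continuous (coneFun b σ) := by
  rw [continuous_iff_continuousAt]
  intro x
  by_cases hx : x 0 = 1
  · have hbdd : ∃ R, ∀ y, ‖σ y - b‖ ≤ R := by
      obtain ⟨R, hR⟩ := (isCompact_range (hσ.sub (continuous_const (y := b)))).isBounded.exists_norm_le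
      exact ⟨R, fun y => hR _ ⟨y, rfl⟩⟩
    obtain ⟨R, hR⟩ := hbdd
    have h0 : coneFun b σ x = b := by simp [coneFun, hx]
    rw [ContinuousAt, h0, tendsto_iff_norm_sub_tendsto_zero]
    have hlim : Filter.Tendsto (fun y : stdSimplex ℝ (Fin (n + 1)) => (1 - y 0) * |R|)
        (nhds x) (nhds 0) := by
      have : Continuous (fun y : stdSimplex ℝ (Fin (n + 1)) => (1 - y 0) * |R|) :=
        (continuous_const.sub (coord_cont 0)).mul continuous_const
      have h2 := this.tendsto x
      simpa [hx] using h2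
    refine squeeze_zero (fun _ => norm_nonneg _) (fun y => ?_) hlim
    have hy1 : 0 ≤ 1 - y 0 := by linarith [stdSimplex.le_one y 0]
    by_cases hy : y 0 = 1
    · simp [coneFun, hy]
    · have : coneFun b σ y - b = (1 - y 0) • (σ (rest y hy) - b) := by
        simp only [coneFun, hy, dite_false]
        module
      rw [this, norm_smul, Real.norm_of_nonneg hy1]
      exact mul_le_mul_of_nonneg_left ((hR _).trans (le_abs_self R)) hy1
  · have hopen : IsOpen {y : stdSimplex ℝ (Fin (n + 1)) | y 0 ≠ 1} :=
      isOpen_ne_fun (coord_cont 0) continuous_const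
    refine ContinuousOn.continuousAt (s := {y | y 0 ≠ 1}) ?_ (hopen.mem_nhds hx)
    rw [continuousOn_iff_continuous_domRestrict]
    have heq : Set.domRestrict {y : stdSimplex ℝ (Fin (n + 1)) | y 0 ≠ 1} (coneFun b σ) =
        fun y => (y.1 0) • b + (1 - y.1 0) • σ (rest y.1 y.2) := by
      funext y
      have : ¬ (y.1 0 = 1) := y.2
      change coneFun b σ y.1 = _
      rw [coneFun, dif_neg this]
    rw [heq]
    have hc : ∀ i : Fin (n + 1), Continuous
        (fun y : {y : stdSimplex ℝ (Fin (n + 1)) | y 0 ≠ 1} => y.1 i) :=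
      fun i => (coord_cont i).comp continuous_subtype_val
    refine ((hc 0).smul continuous_const).add ((continuous_const.sub (hc 0)).smul
      (hσ.comp ?_))
    refine Continuous.subtype_mk (continuous_pi (fun i => ?_)) _
    refine (hc _).div (continuous_const.sub (hc 0)) (fun y => ?_)
    have : ¬ (y.1 0 = 1) := y.2
    exact sub_ne_zero.mpr (Ne.symm this)

lemma coneFun_mem {n : ℕ} {b : E} {A : Set E} (hA : StarConvex ℝ b A) (hb : b ∈ A)
    (σ : stdSimplex ℝ (Fin n) → E) (hσ : ∀ x, σ x ∈ A) (x) : coneFun b σ x ∈ A := by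
  by_cases hx : x 0 = 1
  · simpa [coneFun, hx] using hb
  · simp only [coneFun, hx, dite_false]
    exact hA (hσ _) (stdSimplex.zero_le x 0) (by linarith [stdSimplex.le_one x 0]) (by ring)

lemma fc_apply_succAbove {n : ℕ} (i : Fin (n + 1)) (x : stdSimplex ℝ (Fin n)) (k : Fin n) :
    (fc i x) (i.succAbove k) = x k := by
  simp only [fc, ContinuousMap.coe_mk]
  change (stdSimplex.map i.succAbove x : Fin (n + 1) → ℝ) (i.succAbove k) = x k
  rw [stdSimplex.map_coe]
  simp [FunOnFinite.linearMap_apply_apply]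
  rw [Finset.sum_eq_single k] <;> simp

lemma fc_apply_self {n : ℕ} (i : Fin (n + 1)) (x : stdSimplex ℝ (Fin n)) :
    (fc i x) i = 0 := by
  simp only [fc, ContinuousMap.coe_mk]
  change (stdSimplex.map i.succAbove x : Fin (n + 1) → ℝ) i = 0
  rw [stdSimplex.map_coe]
  simp [FunOnFinite.linearMap_apply_apply]

lemma coneFun_zero {n : ℕ} (b : E) (σ : stdSimplex ℝ (Fin n) → E) (x) :
    coneFun b σ (fc 0 x) = σ x := by
  have h0 : (fc 0 x) 0 = 0 := fc_apply_self 0 x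
  have h1 : ¬ ((fc 0 x) 0 = 1) := by rw [h0]; norm_num
  simp only [coneFun, h1, dite_false]
  have : rest (fc 0 x) h1 = x := by
    apply stdSimplex.ext
    funext k
    change (fc 0 x) k.succ / (1 - (fc 0 x) 0) = x k
    rw [h0, ← Fin.succAbove_zero_apply, fc_apply_succAbove]
    simp
  rw [this, h0]
  simp

lemma coneFun_succ {n : ℕ} (b : E) (σ : stdSimplex ℝ (Fin (n + 1)) → E) (i : Fin (n + 1)) (x) :
    coneFun b σ (fc i.succ x) = coneFun b (fun y => σ (fc i y)) x := by
  have h0 : (fc i.succ x) 0 = x 0 := by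
    have := fc_apply_succAbove i.succ x 0
    rwa [Fin.succ_succAbove_zero] at this
  by_cases hx : x 0 = 1
  · simp [coneFun, h0, hx]
  · have h1 : ¬ ((fc i.succ x) 0 = 1) := by rwa [h0]
    simp only [coneFun, hx, h1, dite_false, h0]
    congr 3
    apply stdSimplex.ext
    funext k
    change (fc i.succ x) k.succ / (1 - (fc i.succ x) 0) = (fc i (rest x hx)) k
    rw [h0]
    rcases Fin.eq_self_or_eq_succAbove i k with rfl | ⟨j, rfl⟩
    · rw [fc_apply_self, fc_apply_self, zero_div]
    · rw [fc_apply_succAbove, ← Fin.succ_succAbove_succ, fc_apply_succAbove]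
      rfl

/-- The cone on a singular simplex of `S` with values in the star-convex `A ⊆ S`. -/
noncomputable def coneS {n : ℕ} {S A : Set E} {b : E} (hA : StarConvex ℝ b A) (hb : b ∈ A)
    (hAS : A ⊆ S) (σ : Sx n S) : Sx (n + 1) S :=
  open Classical in
  if h : ∀ x, (σ x : E) ∈ A then
    ⟨fun x => ⟨coneFun b (fun y => (σ y : E)) x, hAS (coneFun_mem hA hb _ h x)⟩,
      (coneFun_cont b _ (continuous_subtype_val.comp σ.continuous)).subtype_mk _⟩
  else ContinuousMap.const _ ⟨b, hAS hb⟩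

/-- The cone operator. -/
noncomputable def coneC {n : ℕ} {S A : Set E} {b : E} (hA : StarConvex ℝ b A) (hb : b ∈ A)
    (hAS : A ⊆ S) : Ch n S →ₗ[ZMod 2] Ch (n + 1) S :=
  Finsupp.linearCombination (ZMod 2) (fun σ => Finsupp.single (coneS hA hb hAS σ) 1)

lemma coneC_single {n : ℕ} {S A : Set E} {b : E} (hA : StarConvex ℝ b A) (hb : b ∈ A)
    (hAS : A ⊆ S) (σ : Sx n S) :
    coneC hA hb hAS (Finsupp.single σ 1) = Finsupp.single (coneS hA hb hAS σ) 1 := by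
  simp [coneC]

/-- The trace of `A` on the subtype. -/
def tr (S A : Set E) : Set S := {x | (x : E) ∈ A}

lemma coneC_inS {n : ℕ} {S A : Set E} {b : E} (hA : StarConvex ℝ b A) (hb : b ∈ A)
    (hAS : A ⊆ S) (c : Ch n S) (hc : c ∈ inS (tr S A)) : coneC hA hb hAS c ∈ inS (tr S A) := by
  refine lin_maps _ _ _ (fun σ hσ => ?_) c hc
  rw [coneC_single]
  refine inS_single (fun x => ?_)
  have hσ' : ∀ x, (σ x : E) ∈ A := hσ
  simp only [coneS, hσ', dite_true, implies_true]
  exact coneFun_mem hA hb _ hσ' x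

lemma bd_coneC {n : ℕ} {S A : Set E} {b : E} (hA : StarConvex ℝ b A) (hb : b ∈ A)
    (hAS : A ⊆ S) (c : Ch (n + 1) S) (hc : c ∈ inS (tr S A)) :
    bd (coneC hA hb hAS c) = c + coneC hA hb hAS (bd c) := by
  have := lin_maps (bd.comp (coneC hA hb hAS) + (LinearMap.id + (coneC hA hb hAS).comp bd)
        : Ch (n + 1) S →ₗ[ZMod 2] _) {σ | ∀ x, σ x ∈ tr S A} ⊥ (fun σ hσ => ?_) c hc
  · rw [Submodule.mem_bot] at this
    exact eq_of_add_zero this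
  have hσ' : ∀ x, (σ x : E) ∈ A := hσ
  rw [Submodule.mem_bot]
  simp only [LinearMap.add_apply, LinearMap.comp_apply, coneC_single, bd_single, map_sum,
    LinearMap.id_apply]
  rw [Fin.sum_univ_succ]
  have e0 : (coneS hA hb hAS σ).comp (fc 0) = σ := by
    ext1 x
    apply Subtype.ext
    simp only [coneS, hσ', dite_true, implies_true]
    exact coneFun_zero b (fun y => (σ y : E)) x
  have e1 : ∀ i : Fin (n + 1), (coneS hA hb hAS σ).comp (fc i.succ) =
      coneS hA hb hAS (σ.comp (fc i)) := by
    intro i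
    ext1 x
    apply Subtype.ext
    have h2 : ∀ x, ((σ.comp (fc i)) x : E) ∈ A := fun x => hσ' _
    simp only [coneS, hσ', h2, dite_true, implies_true]
    exact coneFun_succ b (fun y => (σ y : E)) i x
  rw [e0]
  simp only [e1]
  exact two_smul_zero _

lemma sx_zero_sub {X : Type} [TopologicalSpace X] (σ τ : Sx 0 X) : σ = τ := by
  ext1 x
  exact absurd (stdSimplex.sum_eq_one x) (by simp)

/-- Augmented chains of star-convex sets are acyclic. -/
lemma star_acyclic {n : ℕ} {S A : Set E} {b : E} (hA : StarConvex ℝ b A) (hb : b ∈ A)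
    (hAS : A ⊆ S) (c : Ch (n + 1) S) (hc : c ∈ inS (tr S A)) (h : bd c = 0) :
    ∃ e ∈ inS (tr S A), bd e = c := by
  refine ⟨coneC hA hb hAS c, coneC_inS hA hb hAS c hc, ?_⟩
  rw [bd_coneC hA hb hAS c hc, h]
  simp

lemma star_acyclic_zero {S A : Set E} {b : E} (hb : b ∈ A)
    (hAS : A ⊆ S) (c : Ch 0 S) : ∃ e : Ch 1 S, e ∈ inS (tr S A) ∧ bd e = c := by
  let σ0 : Sx 0 S := ContinuousMap.const _ ⟨b, hAS hb⟩
  let σ1 : Sx 1 S := ContinuousMap.const _ ⟨b, hAS hb⟩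
  refine ⟨c σ0 • Finsupp.single σ1 1, Submodule.smul_mem _ _ (inS_single (fun x => hb)), ?_⟩
  rw [map_smul, bd_single]
  ext τ
  have : τ = σ0 := sx_zero_sub _ _
  subst this
  have h2 : σ1.comp (fc 0) = σ0 := sx_zero_sub _ _
  simp [h2]

end

end CubMan

/-! ## Subdivision and small simplices -/

namespace CubMan

open Finset

lemma bd_coneC_zero {E : Type} [NormedAddCommGroup E] [NormedSpace ℝ E]
    {S A : Set E} {b : E} (hA : StarConvex ℝ b A) (hb : b ∈ A)
    (hAS : A ⊆ S) (c : Ch 0 S) : bd (coneC hA hb hAS c) = c := by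
  have : bd.comp (coneC hA hb hAS) = (LinearMap.id : Ch 0 S →ₗ[ZMod 2] Ch 0 S) := by
    apply lin_ext
    intro σ
    simp [coneC_single]
    congr 1
    exact sx_zero_sub _ _
  exact LinearMap.congr_fun this c

lemma nop_bd {X : Type} [TopologicalSpace X] {n k : ℕ} (τ' : Ch (k + 1) (stdSimplex ℝ (Fin (n + 1))))
    (τ : Ch k (stdSimplex ℝ (Fin n))) (h : bd τ' = nop τ (bd (idc (n + 1))))
    (c : Ch (n + 1) X) : bd (nop τ' c) = nop τ (bd c) := by
  have : bd.comp (nop τ') = ((nop τ).comp bd : Ch (n + 1) X →ₗ[ZMod 2] Ch k X) := by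
    apply lin_ext
    intro σ
    simp only [LinearMap.comp_apply, nop_single]
    rw [bd_psh, h, ← nop_psh, ← bd_psh, psh_idc]
  exact LinearMap.congr_fun this c

/-- The barycenter. -/
noncomputable def bary (n : ℕ) : Fin (n + 1) → ℝ := fun _ => 1 / ((n : ℝ) + 1)

lemma bary_mem (n : ℕ) : bary n ∈ stdSimplex ℝ (Fin (n + 1)) := by
  refine ⟨fun i => by unfold bary; positivity, ?_⟩
  simp [bary]
  field_simp

lemma bary_star (n : ℕ) : StarConvex ℝ (bary n) (stdSimplex ℝ (Fin (n + 1))) :=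
  (convex_stdSimplex ℝ _).starConvex (bary_mem n)

/-- The cone from the barycenter. -/
noncomputable abbrev coneB {k : ℕ} (n : ℕ) :
    Ch k (stdSimplex ℝ (Fin (n + 1))) →ₗ[ZMod 2] Ch (k + 1) (stdSimplex ℝ (Fin (n + 1))) :=
  coneC (bary_star n) (bary_mem n) le_rfl

lemma bd_coneB {k : ℕ} (n : ℕ) (c : Ch (k + 1) (stdSimplex ℝ (Fin (n + 1)))) (h : bd c = 0) :
    bd (coneB n c) = c := by
  rw [bd_coneC _ _ _ _, h]
  · simp
  · have : tr (stdSimplex ℝ (Fin (n + 1))) (stdSimplex ℝ (Fin (n + 1))) = Set.univ := by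
      ext x
      simp [tr]
    rw [this]
    exact inS_univ _

/-- The universal subdivision chains. -/
noncomputable def sdc : (n : ℕ) → Ch n (stdSimplex ℝ (Fin n))
  | 0 => idc 0
  | n + 1 => coneB n (nop (sdc n) (bd (idc (n + 1))))

section
variable {X Y : Type} [TopologicalSpace X] [TopologicalSpace Y]

/-- The subdivision operator. -/
noncomputable def Sd {n : ℕ} : Ch n X →ₗ[ZMod 2] Ch n X := nop (sdc n)

end

lemma bd_sdc (n : ℕ) : bd (sdc (n + 1)) = nop (sdc n) (bd (idc (n + 1))) := by
  induction n with
  | zero => exact bd_coneC_zero _ _ _ _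
  | succ n ih =>
    rw [sdc]
    apply bd_coneB
    rw [nop_bd _ _ ih, bd_bd, map_zero]

section
variable {X Y : Type} [TopologicalSpace X] [TopologicalSpace Y]

lemma bd_Sd {n : ℕ} (c : Ch (n + 1) X) : bd (Sd c) = Sd (bd c) :=
  nop_bd _ _ (bd_sdc n) c

end

/-- The universal homotopy chains. -/
noncomputable def htc : (n : ℕ) → Ch (n + 1) (stdSimplex ℝ (Fin n))
  | 0 => 0
  | n + 1 => coneB n (idc (n + 1) + sdc (n + 1) + nop (htc n) (bd (idc (n + 1))))

section
variable {X Y : Type} [TopologicalSpace X] [TopologicalSpace Y]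

/-- The homotopy operator. -/
noncomputable def Ht {n : ℕ} : Ch n X →ₗ[ZMod 2] Ch (n + 1) X := nop (htc n)

lemma Sd_zero (c : Ch 0 X) : Sd c = c := by
  have : Sd = (LinearMap.id : Ch 0 X →ₗ[ZMod 2] Ch 0 X) := by
    apply lin_ext
    intro σ
    simp [Sd, sdc, psh_idc]
  exact LinearMap.congr_fun this c

lemma Ht_zero (c : Ch 0 X) : Ht c = 0 := by
  have : Ht = (0 : Ch 0 X →ₗ[ZMod 2] Ch 1 X) := by
    apply lin_ext
    intro σ
    simp [Ht, htc]
  exact LinearMap.congr_fun this c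

lemma nop_ht {n : ℕ} (h : bd (htc (n + 1)) = idc (n + 1) + sdc (n + 1) +
    nop (htc n) (bd (idc (n + 1)))) (c : Ch (n + 1) X) :
    bd (Ht c) = c + Sd c + Ht (bd c) := by
  have : bd.comp Ht = (LinearMap.id + Sd + Ht.comp bd : Ch (n + 1) X →ₗ[ZMod 2] Ch _ X) := by
    apply lin_ext
    intro σ
    simp only [LinearMap.comp_apply, LinearMap.add_apply, LinearMap.id_apply, Ht, nop_single, Sd]
    rw [bd_psh, h, map_add, map_add, psh_idc, ← nop_psh, ← bd_psh, psh_idc]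
  exact LinearMap.congr_fun this c

end

lemma bd_htc (n : ℕ) : bd (htc (n + 1)) = idc (n + 1) + sdc (n + 1) +
    nop (htc n) (bd (idc (n + 1))) := by
  induction n with
  | zero =>
    rw [htc]
    apply bd_coneB
    rw [map_add, map_add, bd_sdc]
    have h1 := Ht_zero (bd (idc 1))
    have h2 := Sd_zero (bd (idc 1))
    unfold Ht at h1
    unfold Sd at h2
    rw [h1, h2, map_zero, add_zero]
    exact two_smul_zero _
  | succ n ih =>
    rw [htc]
    apply bd_coneB
    have h1 := nop_ht ih (bd (idc (n + 1 + 1)))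
    unfold Ht Sd at h1
    rw [map_add, map_add, bd_sdc, h1, bd_bd, map_zero, add_zero]
    exact two_smul_zero _

section
variable {X Y : Type} [TopologicalSpace X] [TopologicalSpace Y]

lemma bd_Ht {n : ℕ} (c : Ch (n + 1) X) : bd (Ht c) = c + Sd c + Ht (bd c) := nop_ht (bd_htc n) c

/-- Small chains with respect to a family of sets. -/
def sm {ι : Type} (U : ι → Set X) {n : ℕ} : Submodule (ZMod 2) (Ch n X) :=
  Finsupp.supported (ZMod 2) (ZMod 2) {σ | ∃ i, ∀ x, σ x ∈ U i}

lemma nop_supp {n k : ℕ} (τ : Ch k (stdSimplex ℝ (Fin n))) (P : Set (Sx n X)) (Q : Set (Sx k X))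
    (h : ∀ σ ∈ P, ∀ ρ ∈ τ.support, σ.comp ρ ∈ Q) (c : Ch n X)
    (hc : c ∈ Finsupp.supported (ZMod 2) (ZMod 2) P) :
    nop τ c ∈ Finsupp.supported (ZMod 2) (ZMod 2) Q := by
  refine lin_maps _ P _ (fun σ hσ => ?_) c hc
  rw [nop_single]
  refine lin_maps _ τ.support _ (fun ρ hρ => ?_) τ (by simp [Finsupp.mem_supported])
  rw [psh_single]
  exact Finsupp.single_mem_supported _ _ (h σ hσ ρ hρ)

lemma nop_sm {ι : Type} (U : ι → Set X) {n k : ℕ} (τ : Ch k (stdSimplex ℝ (Fin n))) (c : Ch n X)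
    (hc : c ∈ sm U) : nop τ c ∈ sm U :=
  nop_supp τ {σ | ∃ i, ∀ x, σ x ∈ U i} {σ | ∃ i, ∀ x, σ x ∈ U i}
    (fun _ hσ ρ _ => hσ.imp (fun _ hi x => hi (ρ x))) c hc

lemma bd_sm {ι : Type} (U : ι → Set X) {n : ℕ} (c : Ch (n + 1) X)
    (hc : c ∈ sm U) : bd c ∈ sm U := by
  refine lin_maps _ _ _ (fun σ hσ => ?_) c hc
  rw [bd_single]
  refine Submodule.sum_mem _ (fun i _ => Finsupp.single_mem_supported _ _ ?_)
  obtain ⟨j, hj⟩ := hσ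
  exact ⟨j, fun x => hj _⟩

/-- Affine self maps of the simplex. -/
def IsAff {n k : ℕ} (σ : Sx n (stdSimplex ℝ (Fin k))) : Prop :=
  ∃ v : Fin n → Fin k → ℝ, ∀ x, (σ x : Fin k → ℝ) = ∑ i, x i • v i

/-- The Doeblin condition. -/
def Doeb {n k : ℕ} (σ : Sx n (stdSimplex ℝ (Fin k))) : Prop :=
  ∃ j, ∀ x, 1 / (n : ℝ) ≤ σ x j

end

end CubMan

namespace CubMan

open Finset

section
variable {X Y : Type} [TopologicalSpace X] [TopologicalSpace Y]

lemma aff_convex {n k : ℕ} {σ : Sx n (stdSimplex ℝ (Fin k))} (h : IsAff σ)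
    (x y z : stdSimplex ℝ (Fin n)) (s t : ℝ) (hx : (x : Fin n → ℝ) = s • (y : Fin n → ℝ) + t • (z : Fin n → ℝ)) :
    (σ x : Fin k → ℝ) = s • (σ y : Fin k → ℝ) + t • (σ z : Fin k → ℝ) := by
  obtain ⟨v, hv⟩ := h
  rw [hv, hv, hv, Finset.smul_sum, Finset.smul_sum, ← Finset.sum_add_distrib]
  refine Finset.sum_congr rfl (fun i _ => ?_)
  have : x i = s * y i + t * z i := congrFun hx i
  rw [this]
  module

lemma aff_comp {n k l : ℕ} {σ : Sx n (stdSimplex ℝ (Fin k))} {τ : Sx l (stdSimplex ℝ (Fin n))}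
    (h : IsAff σ) (h' : IsAff τ) : IsAff (σ.comp τ) := by
  obtain ⟨v, hv⟩ := h
  obtain ⟨w, hw⟩ := h'
  refine ⟨fun i => ∑ j, w i j • v j, fun x => ?_⟩
  rw [ContinuousMap.comp_apply, hv]
  simp only [Finset.smul_sum]
  rw [Finset.sum_comm]
  refine Finset.sum_congr rfl (fun j _ => ?_)
  have : (τ x) j = ∑ i, x i * w i j := by
    have := congrFun (hw x) j
    simpa using this
  rw [this, Finset.sum_smul]
  simp only [smul_smul]

lemma aff_id (n : ℕ) : IsAff (ContinuousMap.id (stdSimplex ℝ (Fin n))) := by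
  refine ⟨fun i => Pi.single i 1, fun x => ?_⟩
  funext j
  simp [Finset.sum_apply, Pi.single_apply]

lemma coneS_apply {E : Type} [NormedAddCommGroup E] [NormedSpace ℝ E] {n : ℕ} {S A : Set E}
    {b : E} (hA : StarConvex ℝ b A) (hb : b ∈ A)
    (hAS : A ⊆ S) (σ : Sx n S) (h : ∀ x, (σ x : E) ∈ A) (x) :
    ((coneS hA hb hAS σ) x : E) = coneFun b (fun y => (σ y : E)) x := by
  simp only [coneS, h, dite_true, implies_true]
  rfl

lemma aff_fc {n : ℕ} (i : Fin (n + 1)) : IsAff (fc i) := by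
  refine ⟨fun j => Pi.single (i.succAbove j) 1, fun x => ?_⟩
  funext j
  rcases Fin.eq_self_or_eq_succAbove i j with rfl | ⟨k, rfl⟩
  · have := fc_apply_self j x
    simp [Finset.sum_apply, Pi.single_apply]
    exact this
  · have := fc_apply_succAbove i x k
    simp [Finset.sum_apply, Pi.single_apply]
    exact this

lemma aff_cone {n k : ℕ} {σ : Sx k (stdSimplex ℝ (Fin (n + 1)))} (h : IsAff σ) :
    IsAff (coneS (bary_star n) (bary_mem n) le_rfl σ) := by
  obtain ⟨v, hv⟩ := h
  refine ⟨Fin.cons (bary n) v, fun x => ?_⟩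
  have h2 : ∀ x, (σ x : Fin (n + 1) → ℝ) ∈ stdSimplex ℝ (Fin (n + 1)) := fun x => (σ x).2
  refine (coneS_apply (bary_star n) (bary_mem n) le_rfl σ h2 x).trans ?_
  rw [Fin.sum_univ_succ]
  simp only [Fin.cons_zero, Fin.cons_succ]
  by_cases hx : x 0 = 1
  · have h3 : ∀ i : Fin k, x i.succ = 0 := by
      have h3 := stdSimplex.sum_eq_one x
      rw [Fin.sum_univ_succ, hx] at h3
      have h4 : ∑ i : Fin k, x i.succ = 0 := by linarith
      rw [Finset.sum_eq_zero_iff_of_nonneg (fun i _ => stdSimplex.zero_le x _)] at h4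
      exact fun i => h4 i (Finset.mem_univ _)
    simp [coneFun, hx, h3]
  · rw [coneFun, dif_neg hx]
    change _ + (1 - x 0) • (σ (rest x hx) : Fin (n + 1) → ℝ) = _
    rw [hv, Finset.smul_sum]
    congr 1
    refine Finset.sum_congr rfl (fun i _ => ?_)
    have h4 : 1 - x 0 ≠ 0 := sub_ne_zero.mpr (Ne.symm hx)
    have : (rest x hx) i = x i.succ / (1 - x 0) := rfl
    rw [this, smul_smul]
    congr 1
    field_simp

lemma nop_bd_idc {n k : ℕ} (τ : Ch k (stdSimplex ℝ (Fin n))) :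
    nop τ (bd (idc (n + 1))) = ∑ i, psh (fc i) τ := by
  simp [idc]

lemma sdc_prop (n : ℕ) : ∀ σ ∈ (sdc n).support, IsAff σ ∧ (n ≠ 0 → Doeb σ) := by
  suffices h : sdc n ∈ Finsupp.supported (ZMod 2) (ZMod 2)
      {σ : Sx n (stdSimplex ℝ (Fin n)) | IsAff σ ∧ (n ≠ 0 → Doeb σ)} from fun σ hσ => h hσ
  induction n with
  | zero => exact Finsupp.single_mem_supported _ _ ⟨aff_id 0, fun h => absurd rfl h⟩
  | succ n ih =>
    rw [sdc, nop_bd_idc]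
    refine lin_maps (coneB n) {σ : Sx n (stdSimplex ℝ (Fin (n + 1))) |
      IsAff σ ∧ (n ≠ 0 → Doeb σ)} _ (fun σ hσ => ?_) _ ?_
    · rw [coneC_single]
      refine Finsupp.single_mem_supported _ _ ⟨aff_cone hσ.1, fun _ => ?_⟩
      have hj : ∃ j, ∀ x, 1 / ((n : ℝ) + 1) ≤ (σ x) j := by
        rcases Nat.eq_zero_or_pos n with rfl | hn
        · exact ⟨0, fun x => absurd (stdSimplex.sum_eq_one x) (by simp)⟩
        · obtain ⟨j, hj⟩ := hσ.2 hn.ne'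
          refine ⟨j, fun x => le_trans ?_ (hj x)⟩
          have : (0 : ℝ) < n := by exact_mod_cast hn
          gcongr
          linarith
      obtain ⟨j, hj⟩ := hj
      refine ⟨j, fun x => ?_⟩
      have h2 : ∀ x, (σ x : Fin (n + 1) → ℝ) ∈
          {y : Fin (n + 1) → ℝ | 1 / ((n : ℝ) + 1) ≤ y j} := hj
      have hb : bary n ∈ {y : Fin (n + 1) → ℝ | 1 / ((n : ℝ) + 1) ≤ y j} := (le_rfl : (1 / ((n : ℝ) + 1)) ≤ 1 / ((n : ℝ) + 1))
      have hc : Convex ℝ {y : Fin (n + 1) → ℝ | 1 / ((n : ℝ) + 1) ≤ y j} :=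
        convex_halfSpace_ge (f := fun y : Fin (n + 1) → ℝ => y j)
          ⟨fun _ _ => rfl, fun _ _ => rfl⟩ _
      have := coneFun_mem (hc.starConvex hb) hb (fun y => (σ y : Fin (n + 1) → ℝ)) h2 x
      have h3 : ∀ x, (σ x : Fin (n + 1) → ℝ) ∈ stdSimplex ℝ (Fin (n + 1)) := fun x => (σ x).2
      have h4 := congrFun (coneS_apply (bary_star n) (bary_mem n) le_rfl σ h3 x) j
      push_cast
      exact le_of_le_of_eq this h4.symm
    · refine Submodule.sum_mem _ (fun i _ => ?_)
      refine lin_maps (psh (fc i)) _ _ (fun σ hσ => ?_) _ ih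
      rw [psh_single]
      refine Finsupp.single_mem_supported _ _ ⟨aff_comp (aff_fc i) hσ.1, fun hn => ?_⟩
      obtain ⟨j, hj⟩ := hσ.2 hn
      refine ⟨i.succAbove j, fun x => ?_⟩
      rw [ContinuousMap.comp_apply, fc_apply_succAbove]
      exact hj x

/-- Affine of diameter at most `D`. -/
def DP {n : ℕ} (D : ℝ) (σ : Sx n (stdSimplex ℝ (Fin n))) : Prop :=
  IsAff σ ∧ ∀ x y, dist (σ x) (σ y) ≤ D

lemma DP_comp {n : ℕ} {D : ℝ} {σ τ : Sx (n + 1) (stdSimplex ℝ (Fin (n + 1)))} (h : DP D σ)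
    (h' : IsAff τ) (h'' : Doeb τ) :
    DP ((1 - 1 / ((n : ℝ) + 1)) * D) (σ.comp τ) := by
  refine ⟨aff_comp h.1 h', fun x y => ?_⟩
  obtain ⟨j, hj⟩ := h''
  push_cast at hj
  set κ : ℝ := 1 / ((n : ℝ) + 1) with hκ
  have hκ0 : 0 < κ := by positivity
  have hD : 0 ≤ D := dist_nonneg.trans (h.2 x x)
  have hκ1 : κ ≤ 1 := (hj x).trans (stdSimplex.le_one _ _)
  rcases eq_or_lt_of_le hκ1 with h1 | h1
  · -- the simplex is a point
    have hn : n = 0 := by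
      rw [h1] at hκ
      have : (n : ℝ) + 1 = 1 := by field_simp at hκ; linarith
      have : (n : ℝ) = 0 := by linarith
      exact_mod_cast this
    subst hn
    have : τ x = τ y := by
      apply stdSimplex.ext
      funext k
      have e1 := stdSimplex.sum_eq_one (τ x)
      have e2 := stdSimplex.sum_eq_one (τ y)
      rw [Fin.sum_univ_succ, Fin.sum_univ_zero, add_zero] at e1 e2
      have : k = 0 := Fin.ext (by omega)
      subst this
      exact e1.trans e2.symm
    rw [ContinuousMap.comp_apply, ContinuousMap.comp_apply, this, dist_self, h1]
    simp
  · have h2 : 0 < 1 - κ := by linarith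
    have hw : ∀ z : stdSimplex ℝ (Fin (n + 1)), ∃ z' : stdSimplex ℝ (Fin (n + 1)),
        (τ z : Fin (n + 1) → ℝ) = κ • (Pi.single j 1 : Fin (n + 1) → ℝ) + (1 - κ) • (z' : Fin (n + 1) → ℝ) := by
      intro z
      refine ⟨⟨fun i => ((τ z) i - κ * (Pi.single j 1 : Fin (n + 1) → ℝ) i) / (1 - κ), ?_, ?_⟩, ?_⟩
      · intro i
        refine div_nonneg ?_ h2.le
        by_cases hi : i = j
        · subst hi
          simpa using hj z
        · simpa [hi] using stdSimplex.zero_le (τ z) i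
      · rw [← Finset.sum_div, Finset.sum_sub_distrib, stdSimplex.sum_eq_one, ← Finset.mul_sum]
        simp
        exact h2.ne'
      · funext i
        simp only [Pi.add_apply, Pi.smul_apply, smul_eq_mul]
        have : (1 - κ) * (((τ z) i - κ * (Pi.single j 1 : Fin (n + 1) → ℝ) i) / (1 - κ)) =
          (τ z) i - κ * (Pi.single j 1 : Fin (n + 1) → ℝ) i := by field_simp
        change (τ z) i = _ + (1 - κ) * (((τ z) i - κ * (Pi.single j 1 : Fin (n + 1) → ℝ) i) / (1 - κ))
        rw [this]
        ring
    obtain ⟨x', hx'⟩ := hw x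
    obtain ⟨y', hy'⟩ := hw y
    have ej : (Pi.single j 1 : Fin (n + 1) → ℝ) ∈ stdSimplex ℝ (Fin (n + 1)) :=
      single_mem_stdSimplex ℝ j
    have a1 := aff_convex h.1 (τ x) ⟨_, ej⟩ x' κ (1 - κ) hx'
    have a2 := aff_convex h.1 (τ y) ⟨_, ej⟩ y' κ (1 - κ) hy'
    rw [Subtype.dist_eq, ContinuousMap.comp_apply, ContinuousMap.comp_apply]
    change dist (σ (τ x) : Fin (n + 1) → ℝ) (σ (τ y) : Fin (n + 1) → ℝ) ≤ _
    rw [a1, a2, dist_add_left,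
      dist_smul₀, Real.norm_of_nonneg h2.le]
    exact mul_le_mul_of_nonneg_left (h.2 x' y') h2.le

lemma Sd_iter_psh {n : ℕ} (m : ℕ) (f : C(X, Y)) (c : Ch n X) :
    (Sd^[m]) (psh f c) = psh f ((Sd^[m]) c) := by
  induction m generalizing c with
  | zero => rfl
  | succ m ih =>
    rw [Function.iterate_succ_apply, Function.iterate_succ_apply, ← ih]
    congr 1
    exact nop_psh _ _ _

lemma Sd_iter_DP (n m : ℕ) : (Sd^[m]) (idc (n + 1)) ∈ Finsupp.supported (ZMod 2) (ZMod 2)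
    {σ | DP ((1 - 1 / ((n : ℝ) + 1)) ^ m * 1) σ} := by
  induction m with
  | zero =>
    refine Finsupp.single_mem_supported _ _ ⟨aff_id _, fun x y => ?_⟩
    rw [Subtype.dist_eq, dist_pi_le_iff (by norm_num)]
    intro i
    simp only [pow_zero, one_mul]
    rw [Real.dist_eq, abs_le]
    have := stdSimplex.zero_le x i
    have := stdSimplex.zero_le y i
    have := stdSimplex.le_one x i
    have := stdSimplex.le_one y i
    constructor
    · change -1 ≤ x i - y i
      linarith
    · change x i - y i ≤ 1
      linarith
  | succ m ih =>
    rw [Function.iterate_succ_apply']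
    refine nop_supp _ _ _ (fun σ hσ ρ hρ => ?_) _ ih
    have := sdc_prop (n + 1) ρ hρ
    have h2 := DP_comp hσ this.1 (this.2 (by simp))
    rw [← mul_assoc, ← pow_succ'] at h2
    exact h2

lemma sm_mono_iter {ι : Type} (U : ι → Set X) {n : ℕ} (c : Ch n X) (hc : c ∈ sm U) (m : ℕ) :
    (Sd^[m]) c ∈ sm U := by
  induction m with
  | zero => exact hc
  | succ m ih =>
    rw [Function.iterate_succ_apply']
    exact nop_sm U _ _ ih

/-- Iterated subdivision as a linear map. -/
lemma Sd_iter_linear {n : ℕ} (m : ℕ) : ∃ f : Ch n X →ₗ[ZMod 2] Ch n X, ∀ c, (Sd^[m]) c = f c :=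
  ⟨Sd ^ m, fun c => by rw [Module.End.pow_apply]⟩

lemma Sd_small_single {ι : Type} (U : ι → Set X) (hU : ∀ i, IsOpen (U i)) (hne : Nonempty ι)
    (hcov : ∀ x, ∃ i, x ∈ U i) {n : ℕ} (σ : Sx n X) :
    ∃ m, (Sd^[m]) (Finsupp.single σ 1) ∈ sm U := by
  rcases n with _ | n
  · refine ⟨0, Finsupp.single_mem_supported _ _ ⟨hne.some, fun x => ?_⟩⟩
    exact absurd (stdSimplex.sum_eq_one x) (by simp)
  obtain ⟨δ, hδ, hL⟩ := lebesgue_number_lemma_of_metric (s := (Set.univ : Set (stdSimplex ℝ (Fin (n + 1)))))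
    (c := fun i => σ ⁻¹' (U i)) isCompact_univ (fun i => (hU i).preimage σ.continuous)
    (fun x _ => by
      obtain ⟨i, hi⟩ := hcov (σ x)
      exact Set.mem_iUnion.mpr ⟨i, hi⟩)
  have hk0 : 0 ≤ 1 - 1 / ((n : ℝ) + 1) := by
    rw [sub_nonneg, div_le_one (by positivity)]
    linarith [(Nat.cast_nonneg n : (0 : ℝ) ≤ n)]
  have hk1 : 1 - 1 / ((n : ℝ) + 1) < 1 := by
    have : 0 < 1 / ((n : ℝ) + 1) := by positivity
    linarith
  obtain ⟨m, hm⟩ := exists_pow_lt_of_lt_one hδ hk1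
  refine ⟨m, ?_⟩
  rw [← psh_idc σ, Sd_iter_psh]
  refine lin_maps (psh σ) _ _ (fun ρ hρ => ?_) _ (Sd_iter_DP n m)
  rw [psh_single]
  refine Finsupp.single_mem_supported _ _ ?_
  obtain ⟨i, hi⟩ := hL (ρ ⟨bary n, bary_mem n⟩) trivial
  refine ⟨i, fun x => hi ?_⟩
  rw [Metric.mem_ball]
  refine (hρ.2 _ _).trans_lt ?_
  simpa using hm

lemma Sd_small {ι : Type} (U : ι → Set X) (hU : ∀ i, IsOpen (U i)) (hne : Nonempty ι)
    (hcov : ∀ x, ∃ i, x ∈ U i) {n : ℕ} (c : Ch n X) :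
    ∃ m, (Sd^[m]) c ∈ sm U := by
  induction c using Finsupp.induction_linear with
  | zero => exact ⟨0, Submodule.zero_mem _⟩
  | add f g hf hg =>
    obtain ⟨m1, h1⟩ := hf
    obtain ⟨m2, h2⟩ := hg
    refine ⟨m1 + m2, ?_⟩
    obtain ⟨F, hF⟩ := Sd_iter_linear (X := X) (n := n) (m1 + m2)
    rw [hF, map_add, ← hF, ← hF]
    refine Submodule.add_mem _ ?_ ?_
    · rw [add_comm, Function.iterate_add_apply]
      exact sm_mono_iter U _ h1 m2
    · rw [Function.iterate_add_apply]
      exact sm_mono_iter U _ h2 m1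
  | single σ a =>
    obtain ⟨m, hm⟩ := Sd_small_single U hU hne hcov σ
    refine ⟨m, ?_⟩
    obtain ⟨F, hF⟩ := Sd_iter_linear (X := X) (n := n) m
    have : Finsupp.single σ a = a • Finsupp.single σ 1 := by simp
    rw [this, hF, map_smul, ← hF]
    exact Submodule.smul_mem _ _ hm

lemma Ht_iter {ι : Type} (U : ι → Set X) {n : ℕ} (c : Ch (n + 1) X) (hc : bd c = 0) (m : ℕ) :
    ∃ e : Ch (n + 2) X, bd e = c + (Sd^[m]) c ∧ (c ∈ sm U → e ∈ sm U) := by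
  induction m with
  | zero => exact ⟨0, by simp [two_smul_zero], fun _ => Submodule.zero_mem _⟩
  | succ m ih =>
    obtain ⟨e, he, hs⟩ := ih
    refine ⟨e + Ht ((Sd^[m]) c), ?_, fun h => Submodule.add_mem _ (hs h)
      (nop_sm U _ _ (sm_mono_iter U _ h m))⟩
    have h0 : bd ((Sd^[m]) c) = 0 := by
      have h1 : ∀ m, bd ((Sd^[m]) c) = (Sd^[m]) (bd c) := by
        intro m
        induction m with
        | zero => rfl
        | succ m ih => rw [Function.iterate_succ_apply', Function.iterate_succ_apply', bd_Sd, ih]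
      rw [h1, hc]
      obtain ⟨F, hF⟩ := Sd_iter_linear (X := X) (n := n) m
      rw [hF, map_zero]
    rw [map_add, he, bd_Ht, h0, map_zero, add_zero, Function.iterate_succ_apply']
    linear_combination (norm := module) two_smul_zero ((Sd^[m]) c)

lemma small_cycle {ι : Type} (U : ι → Set X) (hU : ∀ i, IsOpen (U i)) (hne : Nonempty ι)
    (hcov : ∀ x, ∃ i, x ∈ U i) {n : ℕ} (c : Ch (n + 1) X) (hc : bd c = 0) :
    ∃ c' ∈ sm U, bd c' = 0 ∧ ∃ e, bd e = c + c' := by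
  obtain ⟨m, hm⟩ := Sd_small U hU hne hcov c
  obtain ⟨e, he, -⟩ := Ht_iter U c hc m
  refine ⟨_, hm, ?_, e, he⟩
  have := bd_bd e
  rw [he, map_add, hc, zero_add] at this
  exact this

lemma small_bd {ι : Type} (U : ι → Set X) (hU : ∀ i, IsOpen (U i)) (hne : Nonempty ι)
    (hcov : ∀ x, ∃ i, x ∈ U i) {n : ℕ} (c : Ch (n + 1) X) (hs : c ∈ sm U) (e : Ch (n + 2) X)
    (he : bd e = c) : ∃ e' ∈ sm U, bd e' = c := by
  obtain ⟨m, hm⟩ := Sd_small U hU hne hcov e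
  obtain ⟨f, hf, hfs⟩ := Ht_iter U c (by rw [← he, bd_bd]) m
  refine ⟨(Sd^[m]) e + f, Submodule.add_mem _ hm (hfs hs), ?_⟩
  have h1 : ∀ m, bd ((Sd^[m]) e) = (Sd^[m]) (bd e) := by
    intro m
    induction m with
    | zero => rfl
    | succ m ih => rw [Function.iterate_succ_apply', Function.iterate_succ_apply', bd_Sd, ih]
  rw [map_add, h1, hf, he]
  linear_combination (norm := module) two_smul_zero ((Sd^[m]) c)

end

end CubMan

/-! ## Comparison of homology by additive relations, and double complexes -/

namespace CubMan

/-- Two pairs (cycles, boundaries) have the same homology through an additive relation. -/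
def HEquiv {V W : Type} [Add V] [Add W] (Z B : Set V) (Z' B' : Set W) : Prop :=
  ∃ R : V → W → Prop, (∀ a b, R a b → a ∈ Z ∧ b ∈ Z') ∧ (∀ a ∈ Z, ∃ b, R a b) ∧
    (∀ b ∈ Z', ∃ a, R a b) ∧ (∀ a b a' b', R a b → R a' b' → R (a + a') (b + b')) ∧
    (∀ a b, R a b → (a ∈ B ↔ b ∈ B'))

/-- One-dimensional homology. -/
def OneDim {V : Type} [Add V] (Z B : Set V) : Prop :=
  (∃ z ∈ Z, z ∉ B) ∧ ∀ z ∈ Z, ∀ z' ∈ Z, z ∉ B → z' ∉ B → z + z' ∈ B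

section
variable {V W U : Type} [Add V] [Add W] [Add U]

lemma HEquiv.symm {Z B : Set V} {Z' B' : Set W} (h : HEquiv Z B Z' B') : HEquiv Z' B' Z B := by
  obtain ⟨R, h1, h2, h3, h4, h5⟩ := h
  exact ⟨fun b a => R a b, fun b a hR => (h1 a b hR).symm, h3, h2,
    fun b a b' a' hR hR' => h4 _ _ _ _ hR hR', fun b a hR => (h5 a b hR).symm⟩

lemma HEquiv.trans {Z B : Set V} {Z' B' : Set W} {Z'' B'' : Set U} (h : HEquiv Z B Z' B')
    (h' : HEquiv Z' B' Z'' B'') : HEquiv Z B Z'' B'' := by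
  obtain ⟨R, h1, h2, h3, h4, h5⟩ := h
  obtain ⟨S, g1, g2, g3, g4, g5⟩ := h'
  refine ⟨fun a c => ∃ b, R a b ∧ S b c, ?_, ?_, ?_, ?_, ?_⟩
  · rintro a c ⟨b, hR, hS⟩
    exact ⟨(h1 _ _ hR).1, (g1 _ _ hS).2⟩
  · intro a ha
    obtain ⟨b, hb⟩ := h2 a ha
    obtain ⟨c, hc⟩ := g2 b (h1 _ _ hb).2
    exact ⟨c, b, hb, hc⟩
  · intro c hc
    obtain ⟨b, hb⟩ := g3 c hc
    obtain ⟨a, ha⟩ := h3 b (g1 _ _ hb).1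
    exact ⟨a, b, ha, hb⟩
  · rintro a c a' c' ⟨b, hR, hS⟩ ⟨b', hR', hS'⟩
    exact ⟨b + b', h4 _ _ _ _ hR hR', g4 _ _ _ _ hS hS'⟩
  · rintro a c ⟨b, hR, hS⟩
    exact (h5 _ _ hR).trans (g5 _ _ hS)

lemma HEquiv.van {Z B : Set V} {Z' B' : Set W} (h : HEquiv Z B Z' B') (hv : Z ⊆ B) : Z' ⊆ B' := by
  obtain ⟨R, h1, h2, h3, h4, h5⟩ := h
  intro b hb
  obtain ⟨a, ha⟩ := h3 b hb
  exact (h5 a b ha).mp (hv (h1 _ _ ha).1)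

lemma HEquiv.oneDim {Z B : Set V} {Z' B' : Set W} (h : HEquiv Z B Z' B') (hv : OneDim Z B) :
    OneDim Z' B' := by
  obtain ⟨R, h1, h2, h3, h4, h5⟩ := h
  obtain ⟨⟨z, hz, hzB⟩, hh⟩ := hv
  constructor
  · obtain ⟨b, hb⟩ := h2 z hz
    exact ⟨b, (h1 _ _ hb).2, fun hbB => hzB ((h5 _ _ hb).mpr hbB)⟩
  · intro b hb b' hb' hn hn'
    obtain ⟨a, ha⟩ := h3 b hb
    obtain ⟨a', ha'⟩ := h3 b' hb'
    rw [← h5 _ _ (h4 _ _ _ _ ha ha')]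
    exact hh a (h1 _ _ ha).1 a' (h1 _ _ ha').1 (fun h => hn ((h5 _ _ ha).mp h))
      (fun h => hn' ((h5 _ _ ha').mp h))

end

/-- A map inducing an isomorphism. -/
lemma HEquiv.of_map {V W : Type} [AddCommGroup V] [AddCommGroup W] [Module (ZMod 2) V]
    [Module (ZMod 2) W] {Z B : Set V} {Z' : Set W} (B' : Submodule (ZMod 2) W)
    (f : V →ₗ[ZMod 2] W) (hZadd : ∀ a ∈ Z, ∀ a' ∈ Z, a + a' ∈ Z)
    (hZ'add : ∀ a ∈ Z', ∀ a' ∈ Z', a + a' ∈ Z') (hZ : ∀ a ∈ Z, f a ∈ Z')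
    (hB : ∀ a ∈ Z, f a ∈ B' ↔ a ∈ B) (hs : ∀ b ∈ Z', ∃ a ∈ Z, b + f a ∈ B') :
    HEquiv Z B Z' (B' : Set W) := by
  refine ⟨fun a b => a ∈ Z ∧ b ∈ Z' ∧ b + f a ∈ B', fun a b h => ⟨h.1, h.2.1⟩, ?_, ?_, ?_, ?_⟩
  · intro a ha
    exact ⟨f a, ha, hZ a ha, by rw [two_smul_zero]; exact B'.zero_mem⟩
  · intro b hb
    obtain ⟨a, ha, h⟩ := hs b hb
    exact ⟨a, ha, hb, h⟩
  · rintro a b a' b' ⟨h1, h2, h3⟩ ⟨h1', h2', h3'⟩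
    refine ⟨hZadd _ h1 _ h1', hZ'add _ h2 _ h2', ?_⟩
    rw [map_add, add_add_add_comm]
    exact B'.add_mem h3 h3'
  · rintro a b ⟨h1, h2, h3⟩
    rw [← hB a h1]
    constructor
    · intro h
      have := B'.sub_mem h3 h
      simpa using this
    · intro h
      have := B'.sub_mem h3 h
      simpa using this

section DC
variable {A : ℕ → Type} [∀ q, AddCommGroup (A q)] [∀ q, Module (ZMod 2) (A q)]

/-- The data of a double complex with exact interior rows and columns. -/
structure DC (D : ℕ → (q : ℕ) → Submodule (ZMod 2) (A q)) (dh : ∀ q, A q →ₗ[ZMod 2] A q)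
    (dv : ∀ q, A (q + 1) →ₗ[ZMod 2] A q) : Prop where
  hh : ∀ q x, dh q (dh q x) = 0
  vv : ∀ q x, dv q (dv (q + 1) x) = 0
  hv : ∀ q x, dh q (dv q x) = dv q (dh (q + 1) x)
  memh : ∀ p q x, x ∈ D (p + 1) q → dh q x ∈ D p q
  memv : ∀ p q x, x ∈ D p (q + 1) → dv q x ∈ D p q
  rowZ : ∀ p x, x ∈ D (p + 1) 0 → ∃ y ∈ D (p + 1) 1, dv 0 y = x
  row : ∀ p q x, x ∈ D (p + 1) (q + 1) → dv q x = 0 → ∃ y ∈ D (p + 1) (q + 2), dv (q + 1) y = x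
  colZ : ∀ q x, x ∈ D 0 (q + 1) → ∃ y ∈ D 1 (q + 1), dh (q + 1) y = x
  col : ∀ p q x, x ∈ D (p + 1) (q + 1) → dh (q + 1) x = 0 → ∃ y ∈ D (p + 2) (q + 1), dh (q + 1) y = x

variable {D : ℕ → (q : ℕ) → Submodule (ZMod 2) (A q)} {dh : ∀ q, A q →ₗ[ZMod 2] A q}
    {dv : ∀ q, A (q + 1) →ₗ[ZMod 2] A q}

/-- Intermediate cycles. -/
def DZ (D : ℕ → (q : ℕ) → Submodule (ZMod 2) (A q)) (dh : ∀ q, A q →ₗ[ZMod 2] A q)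
    (dv : ∀ q, A (q + 1) →ₗ[ZMod 2] A q) (p q : ℕ) : Set (A (q + 1)) :=
  {x | x ∈ D (p + 1) (q + 1) ∧ dh q (dv q x) = 0}

/-- Intermediate boundaries. -/
def DB (D : ℕ → (q : ℕ) → Submodule (ZMod 2) (A q)) (dh : ∀ q, A q →ₗ[ZMod 2] A q)
    (dv : ∀ q, A (q + 1) →ₗ[ZMod 2] A q) (p q : ℕ) : Set (A (q + 1)) :=
  {x | ∃ u ∈ D (p + 2) (q + 1), ∃ w ∈ D (p + 1) (q + 2), x = dh (q + 1) u + dv (q + 1) w}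

lemma dc_first (h : DC D dh dv) (q : ℕ) :
    HEquiv {x | x ∈ D 0 (q + 1) ∧ dv q x = 0} {x | ∃ y ∈ D 0 (q + 2), dv (q + 1) y = x}
      (DZ D dh dv 0 q) (DB D dh dv 0 q) := by
  refine ⟨fun x y => (x ∈ D 0 (q + 1) ∧ dv q x = 0) ∧ y ∈ D 1 (q + 1) ∧ dh (q + 1) y = x,
    ?_, ?_, ?_, ?_, ?_⟩
  · rintro x y ⟨⟨h1, h2⟩, h3, h4⟩
    refine ⟨⟨h1, h2⟩, h3, ?_⟩
    rw [h.hv, h4, h2]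
  · rintro x ⟨h1, h2⟩
    obtain ⟨y, hy, rfl⟩ := h.colZ q x h1
    exact ⟨y, ⟨h1, h2⟩, hy, rfl⟩
  · rintro y ⟨h1, h2⟩
    refine ⟨dh (q + 1) y, ⟨h.memh _ _ _ h1, ?_⟩, h1, rfl⟩
    rw [← h.hv, h2]
  · rintro x y x' y' ⟨⟨h1, h2⟩, h3, h4⟩ ⟨⟨h1', h2'⟩, h3', h4'⟩
    refine ⟨⟨Submodule.add_mem _ h1 h1', ?_⟩, Submodule.add_mem _ h3 h3', ?_⟩
    · rw [map_add, h2, h2', add_zero]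
    · rw [map_add, h4, h4']
  · rintro x y ⟨⟨h1, h2⟩, h3, h4⟩
    constructor
    · rintro ⟨w, hw, rfl⟩
      obtain ⟨w', hw', rfl⟩ := h.colZ (q + 1) w hw
      have h5 : dh (q + 1) (y + dv (q + 1) w') = 0 := by
        rw [map_add, h4, h.hv, two_smul_zero]
      obtain ⟨u, hu, hu'⟩ := h.col 0 q _ (Submodule.add_mem _ h3 (h.memv _ _ _ hw')) h5
      refine ⟨u, hu, w', hw', ?_⟩
      rw [hu']
      linear_combination (norm := module) - two_smul_zero (dv (q + 1) w')
    · rintro ⟨u, hu, w, hw, rfl⟩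
      refine ⟨dh (q + 2) w, h.memh _ _ _ hw, ?_⟩
      rw [← h4, map_add, h.hh, zero_add, h.hv]

lemma dc_last (h : DC D dh dv) (p : ℕ) :
    HEquiv (DZ D dh dv p 0) (DB D dh dv p 0)
      {x | x ∈ D (p + 1) 0 ∧ dh 0 x = 0} {x | ∃ y ∈ D (p + 2) 0, dh 0 y = x} := by
  refine ⟨fun y x => (x ∈ D (p + 1) 0 ∧ dh 0 x = 0) ∧ y ∈ D (p + 1) 1 ∧ dv 0 y = x,
    ?_, ?_, ?_, ?_, ?_⟩
  · rintro y x ⟨⟨h1, h2⟩, h3, h4⟩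
    refine ⟨⟨h3, ?_⟩, h1, h2⟩
    rw [h4, h2]
  · rintro y ⟨h1, h2⟩
    exact ⟨dv 0 y, ⟨h.memv _ _ _ h1, h2⟩, h1, rfl⟩
  · rintro x ⟨h1, h2⟩
    obtain ⟨y, hy, rfl⟩ := h.rowZ p x h1
    exact ⟨y, ⟨h1, h2⟩, hy, rfl⟩
  · rintro y x y' x' ⟨⟨h1, h2⟩, h3, h4⟩ ⟨⟨h1', h2'⟩, h3', h4'⟩
    refine ⟨⟨Submodule.add_mem _ h1 h1', ?_⟩, Submodule.add_mem _ h3 h3', ?_⟩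
    · rw [map_add, h2, h2', add_zero]
    · rw [map_add, h4, h4']
  · rintro y x ⟨⟨h1, h2⟩, h3, h4⟩
    constructor
    · rintro ⟨u, hu, w, hw, rfl⟩
      refine ⟨dv 0 u, h.memv _ _ _ hu, ?_⟩
      rw [← h4, map_add, h.vv, add_zero, h.hv]
    · rintro ⟨w, hw, rfl⟩
      obtain ⟨w', hw', rfl⟩ := h.rowZ (p + 1) w hw
      have h5 : dv 0 (y + dh 1 w') = 0 := by
        rw [map_add, h4, h.hv, two_smul_zero]
      obtain ⟨u, hu, hu'⟩ := h.row p 0 _ (Submodule.add_mem _ h3 (h.memh _ _ _ hw')) h5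
      refine ⟨w', hw', u, hu, ?_⟩
      rw [hu']
      linear_combination (norm := module) - two_smul_zero (dh 1 w')

lemma dc_mid (h : DC D dh dv) (p q : ℕ) :
    HEquiv (DZ D dh dv p (q + 1)) (DB D dh dv p (q + 1))
      (DZ D dh dv (p + 1) q) (DB D dh dv (p + 1) q) := by
  refine ⟨fun y y' => y ∈ D (p + 1) (q + 2) ∧ y' ∈ D (p + 2) (q + 1) ∧
    dv (q + 1) y = dh (q + 1) y', ?_, ?_, ?_, ?_, ?_⟩
  · rintro y y' ⟨h1, h2, h3⟩
    refine ⟨⟨h1, ?_⟩, h2, ?_⟩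
    · rw [h3, h.hh]
    · rw [h.hv, ← h3, h.vv]
  · rintro y ⟨h1, h2⟩
    obtain ⟨y', hy', h3⟩ := h.col p q _ (h.memv _ _ _ h1) h2
    exact ⟨y', h1, hy', h3.symm⟩
  · rintro y' ⟨h1, h2⟩
    rw [h.hv] at h2
    obtain ⟨y, hy, h3⟩ := h.row p q _ (h.memh _ _ _ h1) h2
    exact ⟨y, hy, h1, h3⟩
  · rintro x y x' y' ⟨h1, h2, h3⟩ ⟨h1', h2', h3'⟩
    refine ⟨Submodule.add_mem _ h1 h1', Submodule.add_mem _ h2 h2', ?_⟩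
    rw [map_add, map_add, h3, h3']
  · rintro y y' ⟨h1, h2, h3⟩
    constructor
    · rintro ⟨u, hu, w, hw, rfl⟩
      have h5 : dh (q + 1) (y' + dv (q + 1) u) = 0 := by
        rw [map_add, ← h3, map_add, h.vv, add_zero, h.hv, two_smul_zero]
      obtain ⟨t, ht, ht'⟩ := h.col (p + 1) q _ (Submodule.add_mem _ h2 (h.memv _ _ _ hu)) h5
      refine ⟨t, ht, u, hu, ?_⟩
      rw [ht']
      linear_combination (norm := module) - two_smul_zero (dv (q + 1) u)
    · rintro ⟨u, hu, w, hw, rfl⟩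
      have h5 : dv (q + 1) (y + dh (q + 2) w) = 0 := by
        rw [map_add, h3, map_add, h.hh, zero_add, h.hv, two_smul_zero]
      obtain ⟨t, ht, ht'⟩ := h.row p (q + 1) _ (Submodule.add_mem _ h1 (h.memh _ _ _ hw)) h5
      refine ⟨w, hw, t, ht, ?_⟩
      rw [ht']
      linear_combination (norm := module) - two_smul_zero (dh (q + 2) w)

lemma dc_chain (h : DC D dh dv) (q : ℕ) : ∀ p m, m = p + q →
    HEquiv (DZ D dh dv p q) (DB D dh dv p q) (DZ D dh dv m 0) (DB D dh dv m 0) := by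
  induction q with
  | zero =>
    intro p m hm
    obtain rfl : p = m := by omega
    refine ⟨fun a b => a = b ∧ a ∈ DZ D dh dv p 0, ?_, ?_, ?_, ?_, ?_⟩
    · rintro a b ⟨rfl, ha⟩
      exact ⟨ha, ha⟩
    · exact fun a ha => ⟨a, rfl, ha⟩
    · exact fun a ha => ⟨a, rfl, ha⟩
    · rintro a b a' b' ⟨rfl, ha⟩ ⟨rfl, ha'⟩
      refine ⟨rfl, Submodule.add_mem _ ha.1 ha'.1, ?_⟩
      rw [map_add, map_add, ha.2, ha'.2, add_zero]
    · rintro a b ⟨rfl, -⟩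
      rfl
  | succ q ih =>
    intro p m hm
    exact (dc_mid h p q).trans (ih (p + 1) m (by omega))

/-- The double complex lemma. -/
lemma dc_main (h : DC D dh dv) (n : ℕ) :
    HEquiv {x | x ∈ D 0 (n + 1) ∧ dv n x = 0} {x | ∃ y ∈ D 0 (n + 2), dv (n + 1) y = x}
      {x | x ∈ D (n + 1) 0 ∧ dh 0 x = 0} {x | ∃ y ∈ D (n + 2) 0, dh 0 y = x} :=
  ((dc_first h n).trans (dc_chain h n 0 n (by omega))).trans (dc_last h n)

end DC

end CubMan

/-! ## Cubical chains -/

namespace CubMan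

open CubeFace

section
variable {a : ℕ}

instance : DecidableEq (CubeFace a) := inferInstanceAs (DecidableEq (Fin a → Option Bool))
instance : Fintype (CubeFace a) := inferInstanceAs (Fintype (Fin a → Option Bool))

/-- Modify one coordinate of a face. -/
def upd (F : CubeFace a) (i : Fin a) (x : Option Bool) : CubeFace a :=
  fun j => if j = i then x else F j

@[simp] lemma upd_same (F : CubeFace a) (i : Fin a) (x : Option Bool) : upd F i x i = x := by
  simp [upd]

lemma upd_ne (F : CubeFace a) {i j : Fin a} (x : Option Bool) (h : j ≠ i) : upd F i x j = F j := by
  simp [upd, h]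

@[simp] lemma upd_upd (F : CubeFace a) (i : Fin a) (x y : Option Bool) :
    upd (upd F i x) i y = upd F i y := by
  funext j
  by_cases h : j = i <;> simp [upd, h]

lemma upd_comm (F : CubeFace a) {i j : Fin a} (h : i ≠ j) (x y : Option Bool) :
    upd (upd F i x) j y = upd (upd F j y) i x := by
  funext k
  by_cases h1 : k = i
  · subst h1
    simp [upd, h]
  · simp [upd, h1]

lemma upd_eq_self (F : CubeFace a) (i : Fin a) {x : Option Bool} (h : F i = x) : upd F i x = F := by
  funext k
  by_cases h1 : k = i
  · subst h1
    simp [upd, h]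
  · simp [upd, h1]

lemma le_def {F G : CubeFace a} : F ≤ G ↔ ∀ i, G i = none ∨ F i = G i := Iff.rfl

lemma le_upd_none (F : CubeFace a) (i : Fin a) : F ≤ upd F i none := by
  intro j
  by_cases h : j = i
  · left
    simp [upd, h]
  · right
    simp [upd, h]

lemma upd_le {F : CubeFace a} {i : Fin a} (h : F i = none) (x : Option Bool) : upd F i x ≤ F := by
  intro j
  by_cases hj : j = i
  · left
    rw [hj, h]
  · right
    simp [upd, hj]

open Classical in
lemma dim_eq (F : CubeFace a) : dim F = (Finset.univ.filter (fun i => F i = none)).card := by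
  unfold dim
  congr

open Classical in
lemma dim_upd_none {F : CubeFace a} {i : Fin a} (h : F i ≠ none) :
    dim (upd F i none) = dim F + 1 := by
  rw [dim_eq, dim_eq]
  have : (Finset.univ.filter (fun j => upd F i none j = none)) =
      insert i (Finset.univ.filter (fun j => F j = none)) := by
    ext j
    by_cases hj : j = i
    · subst hj
      simp
    · simp [upd, hj]
  rw [this, Finset.card_insert_of_notMem (by simp [h])]

lemma dim_upd_some {F : CubeFace a} {i : Fin a} (h : F i = none) (b : Bool) :
    dim (upd F i (some b)) + 1 = dim F := by
  have := dim_upd_none (F := upd F i (some b)) (i := i) (by simp)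
  rw [upd_upd, upd_eq_self F i h] at this
  exact this.symm

open Classical in
lemma dim_toFace (v : Fin a → Bool) : dim (toFace v) = 0 := by
  rw [dim_eq]
  simp [toFace]

open Classical in
lemma dim_mono {F G : CubeFace a} (h : F ≤ G) : dim F ≤ dim G := by
  rw [dim_eq, dim_eq]
  apply Finset.card_le_card
  intro i
  simp only [Finset.mem_filter, Finset.mem_univ, true_and]
  intro hi
  rcases h i with h1 | h1
  · exact h1
  · rw [← h1, hi]

open Classical in
lemma eq_of_le_dim {F G : CubeFace a} (h : F ≤ G) (hd : dim G ≤ dim F) : F = G := by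
  rw [dim_eq, dim_eq] at hd
  have : (Finset.univ.filter (fun i => F i = none)) = (Finset.univ.filter (fun i => G i = none)) := by
    apply Finset.eq_of_subset_of_card_le _ hd
    intro i
    simp only [Finset.mem_filter, Finset.mem_univ, true_and]
    intro hi
    rcases h i with h1 | h1
    · exact h1
    · rw [← h1, hi]
  funext i
  rcases h i with h1 | h1
  · have h2 : i ∈ (Finset.univ.filter (fun i => G i = none)) := by simp [h1]
    rw [← this] at h2
    simp only [Finset.mem_filter, Finset.mem_univ, true_and] at h2
    rw [h1, h2]
  · exact h1

open Classical in
lemma exists_free {F : CubeFace a} (h : dim F ≠ 0) : ∃ i, F i = none := by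
  rw [dim_eq] at h
  obtain ⟨i, hi⟩ := Finset.card_pos.mp (Nat.pos_of_ne_zero h)
  exact ⟨i, by simpa using hi⟩

open Classical in
lemma dim_zero {F : CubeFace a} (h : dim F = 0) : ∃ v, F = toFace v := by
  rw [dim_eq, Finset.card_eq_zero] at h
  have : ∀ i, ∃ b, F i = some b := by
    intro i
    have : i ∉ (Finset.univ.filter (fun i => F i = none)) := by rw [h]; simp
    simp only [Finset.mem_filter, Finset.mem_univ, true_and] at this
    exact Option.ne_none_iff_exists'.mp this
  choose v hv using this
  exact ⟨v, funext hv⟩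

/-- Augmented faces. -/
abbrev AF (a : ℕ) : Type := Option (CubeFace a)

/-- The rank of an augmented face. -/
def rk : AF a → ℕ
  | none => 0
  | some F => dim F + 1

/-- An augmented face lies below a face. -/
def leA : AF a → CubeFace a → Prop
  | none, _ => True
  | some F, m => F ≤ m

section
variable {V : Type} [AddCommGroup V] [Module (ZMod 2) V]

/-- The cubical boundary in function form. -/
noncomputable def cb : (AF a → V) →ₗ[ZMod 2] (AF a → V) where
  toFun c := fun G => match G with
    | none => ∑ v : Fin a → Bool, c (some (toFace v))
    | some F => ∑ i, if F i = none then 0 else c (some (upd F i none))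
  map_add' c c' := by
    funext G
    rcases G with _ | F
    · simp [Finset.sum_add_distrib]
    · simp only [Pi.add_apply]
      rw [← Finset.sum_add_distrib]
      refine Finset.sum_congr rfl (fun i _ => ?_)
      split_ifs <;> simp
  map_smul' r c := by
    funext G
    rcases G with _ | F
    · simp [Finset.smul_sum]
    · simp only [Pi.smul_apply, RingHom.id_apply]
      rw [Finset.smul_sum]
      refine Finset.sum_congr rfl (fun i _ => ?_)
      split_ifs <;> simp

lemma cb_none (c : AF a → V) : cb c none = ∑ v : Fin a → Bool, c (some (toFace v)) := rfl

lemma cb_some (c : AF a → V) (F : CubeFace a) :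
    cb c (some F) = ∑ i, if F i = none then 0 else c (some (upd F i none)) := rfl

lemma toFace_flip (v : Fin a → Bool) (i : Fin a) :
    upd (toFace (Function.update v i (!v i))) i none = upd (toFace v) i none := by
  funext j
  by_cases h : j = i
  · simp [upd, h]
  · simp [upd, toFace, h]

lemma cb_cb (c : AF a → V) : cb (cb c) = 0 := by
  funext G
  rcases G with _ | F
  · rw [cb_none]
    simp only [cb_some, Pi.zero_apply]
    rw [← Finset.sum_product']
    refine Finset.sum_involution (fun p _ => (Function.update p.1 p.2 (!p.1 p.2), p.2)) ?_ ?_ ?_ ?_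
    · rintro ⟨v, i⟩ _
      have e1 : ∀ v : Fin a → Bool, toFace v i ≠ none := by simp [toFace]
      simp only [e1, if_false, toFace_flip]
      exact two_smul_zero _
    · rintro ⟨v, i⟩ _ _ h
      simp only [Prod.mk.injEq, and_true] at h
      have := congrFun h i
      simp at this
    · simp
    · rintro ⟨v, i⟩ _
      simp
  · rw [cb_some, Pi.zero_apply]
    have e : ∀ i, (if F i = none then 0 else cb c (some (upd F i none))) =
        ∑ j, if F i = none ∨ F j = none ∨ i = j then 0 else c (some (upd (upd F i none) j none)) := by
      intro i
      split_ifs with h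
      · simp [h]
      · rw [cb_some]
        refine Finset.sum_congr rfl (fun j _ => ?_)
        by_cases hij : i = j
        · subst hij
          simp
        · rw [upd_ne _ _ (Ne.symm hij)]
          simp [h, hij]
    simp only [e]
    rw [← Finset.sum_product']
    refine Finset.sum_involution (fun p _ => (p.2, p.1)) ?_ ?_ ?_ ?_
    · rintro ⟨i, j⟩ _
      by_cases h : F i = none ∨ F j = none ∨ i = j
      · have h2 : F j = none ∨ F i = none ∨ j = i := by tauto
        simp only [h, h2, if_true, add_zero]
      · have h2 : ¬ (F j = none ∨ F i = none ∨ j = i) := by tauto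
        simp only [h, h2, if_false]
        rw [upd_comm F (i := i) (j := j) (by tauto)]
        exact two_smul_zero _
    · rintro ⟨i, j⟩ _ h1 h
      simp only [Prod.mk.injEq] at h
      apply h1
      simp [h.1]
    · simp
    · rintro ⟨i, j⟩ _
      rfl

/-- The contracting homotopy in direction `i`. -/
def hop (i : Fin a) (c : AF a → V) : AF a → V
  | none => 0
  | some F => if F i = none then c (some (upd F i (some false))) else 0

/-- The projection in direction `i`. -/
def pip (i : Fin a) (c : AF a → V) : AF a → V
  | none => c none
  | some F => if F i = some true then c (some F) + c (some (upd F i (some false))) else 0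

lemma hop_eq (i : Fin a) (c : AF a → V) : cb (hop i c) + hop i (cb c) = c + pip i c := by
  funext G
  rcases G with _ | F
  · simp only [Pi.add_apply, cb_none, hop, pip, toFace]
    simp [two_smul_zero]
  · simp only [Pi.add_apply, pip]
    rcases hF : F i with _ | b
    · have e1 : cb (hop i c) (some F) = ∑ j ∈ Finset.univ.erase i,
          if F j = none then 0 else c (some (upd (upd F i (some false)) j none)) := by
        rw [cb_some, ← Finset.add_sum_erase _ _ (Finset.mem_univ i)]
        simp only [hF, if_true, zero_add]
        refine Finset.sum_congr rfl (fun j hj => ?_)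
        have hj' : i ≠ j := (Finset.ne_of_mem_erase hj).symm
        split_ifs with h
        · rfl
        · simp only [hop]
          rw [upd_ne _ _ hj', if_pos hF, upd_comm F hj']
      have e2 : hop i (cb c) (some F) = c (some F) + ∑ j ∈ Finset.univ.erase i,
          if F j = none then 0 else c (some (upd (upd F i (some false)) j none)) := by
        simp only [hop]
        rw [if_pos hF, cb_some, ← Finset.add_sum_erase _ _ (Finset.mem_univ i)]
        simp only [upd_same, upd_upd]
        congr 1
        · simp [upd_eq_self F i hF]
        · refine Finset.sum_congr rfl (fun j hj => ?_)
          rw [upd_ne _ _ (Finset.ne_of_mem_erase hj)]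
      rw [e1, e2]
      simp only [reduceCtorEq, if_false, add_zero]
      linear_combination (norm := module) two_smul_zero (∑ j ∈ Finset.univ.erase i,
          if F j = none then 0 else c (some (upd (upd F i (some false)) j none)))
    · have e1 : cb (hop i c) (some F) = c (some (upd F i (some false))) := by
        rw [cb_some, ← Finset.add_sum_erase _ _ (Finset.mem_univ i), Finset.sum_eq_zero]
        · simp [hF, hop]
        · intro j hj
          have hj' : i ≠ j := (Finset.ne_of_mem_erase hj).symm
          simp only [hop]
          rw [upd_ne _ _ hj', hF]
          simp
      have e2 : hop i (cb c) (some F) = 0 := by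
        simp [hop, hF]
      rw [e1, e2]
      cases b
      · simp only [Option.some.injEq, Bool.false_eq_true, if_false, add_zero]
        rw [upd_eq_self F i hF]
      · simp only [if_true]
        linear_combination (norm := module) - two_smul_zero (c (some F))

lemma hop_zero (i : Fin a) : hop i (0 : AF a → V) = 0 := by
  funext G
  rcases G with _ | F <;> simp [hop]

lemma face_acyclic (m : CubeFace a) (c : AF a → V) (hs : ∀ G, c G ≠ 0 → leA G m)
    (hc : cb c = 0) : ∃ e : AF a → V, (∀ G, e G ≠ 0 → leA G m) ∧ cb e = c := by
  induction hd : dim m generalizing m c with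
  | zero =>
    obtain ⟨v, rfl⟩ := dim_zero hd
    have hs' : ∀ F, F ≠ toFace v → c (some F) = 0 := by
      intro F hF
      by_contra h
      have h1 : F ≤ toFace v := hs _ h
      exact hF (eq_of_le_dim h1 (by rw [dim_toFace]; omega))
    have hv : c (some (toFace v)) = 0 := by
      have := congrFun hc none
      rw [cb_none, Finset.sum_eq_single v] at this
      · exact this
      · intro w _ hw
        apply hs'
        intro h
        apply hw
        funext i
        have := congrFun h i
        simpa [toFace] using this
      · simp
    refine ⟨Pi.single (some (toFace v)) (c none), ?_, ?_⟩
    · intro G hG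
      have : G = some (toFace v) := by
        by_contra h
        exact hG (by simp [Pi.single_apply, h])
      subst this
      exact le_refl (toFace v)
    · funext G
      rcases G with _ | F
      · rw [cb_none, Finset.sum_eq_single v]
        · simp
        · intro w _ hw
          rw [Pi.single_eq_of_ne]
          intro h
          apply hw
          funext i
          have := congrFun (Option.some.inj h) i
          simpa [toFace] using this
        · simp
      · have : c (some F) = 0 := by
          by_cases h : F = toFace v
          · rw [h, hv]
          · exact hs' F h
        rw [this, cb_some]
        refine Finset.sum_eq_zero (fun i _ => ?_)
        split_ifs with h
        · rfl
        · rw [Pi.single_eq_of_ne]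
          intro h2
          have := congrFun (Option.some.inj h2) i
          simp [toFace] at this
  | succ k ih =>
    obtain ⟨i, hi⟩ := exists_free (F := m) (by omega)
    have hle : upd m i (some true) ≤ m := upd_le hi _
    have key := hop_eq i c
    rw [hc, hop_zero, add_zero] at key
    have hcp : cb (pip i c) = 0 := by
      have := congrArg cb key
      rw [cb_cb, map_add, hc, zero_add] at this
      exact this.symm
    have hsp : ∀ G, pip i c G ≠ 0 → leA G (upd m i (some true)) := by
      intro G hG
      rcases G with _ | F
      · trivial
      · simp only [pip] at hG
        split_ifs at hG with h1
        · have h2 : ∀ j, j ≠ i → m j = none ∨ F j = m j := by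
            intro j hj
            by_cases h : c (some F) = 0
            · have h3 : c (some (upd F i (some false))) ≠ 0 := by
                intro h4
                exact hG (by simp [h, h4])
              have h5 : upd F i (some false) ≤ m := hs _ h3
              have := h5 j
              rwa [upd_ne _ _ hj] at this
            · exact (hs _ h : F ≤ m) j
          intro j
          by_cases hj : j = i
          · subst hj
            right
            simp [h1]
          · rw [upd_ne _ _ hj]
            exact h2 j hj
        · exact absurd rfl hG
    have hdd : dim (upd m i (some true)) = k := by
      have := dim_upd_some hi true
      omega
    obtain ⟨e, he, he'⟩ := ih (upd m i (some true)) (pip i c) hsp hcp hdd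
    refine ⟨hop i c + e, ?_, ?_⟩
    · intro G hG
      rcases G with _ | F
      · trivial
      · by_cases h : e (some F) = 0
        · have h2 : hop i c (some F) ≠ 0 := by
            intro h3
            exact hG (by simp [h, h3])
          simp only [hop] at h2
          split_ifs at h2 with h4
          · have h5 : upd F i (some false) ≤ m := hs _ h2
            intro j
            by_cases hj : j = i
            · left
              rw [hj, hi]
            · have := h5 j
              rwa [upd_ne _ _ hj] at this
          · exact absurd rfl h2
        · exact le_trans (he _ h : F ≤ _) hle
    · rw [map_add, key, he']
      linear_combination (norm := module) two_smul_zero (pip i c)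

end

end

end CubMan

/-! ## The comparison theorem -/

namespace CubMan

open CubeFace

lemma HEquiv.of_bij {V W : Type} [Add V] [Add W] {Z B : Set V} {Z' B' : Set W} (f : V → W)
    (hf : ∀ a a', f (a + a') = f a + f a') (hadd : ∀ a ∈ Z, ∀ a' ∈ Z, a + a' ∈ Z)
    (hZ : ∀ a ∈ Z, f a ∈ Z') (hs : ∀ b ∈ Z', ∃ a ∈ Z, f a = b)
    (hB : ∀ a ∈ Z, a ∈ B ↔ f a ∈ B') : HEquiv Z B Z' B' := by
  refine ⟨fun a b => a ∈ Z ∧ f a = b, ?_, ?_, ?_, ?_, ?_⟩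
  · rintro a b ⟨ha, rfl⟩
    exact ⟨ha, hZ a ha⟩
  · exact fun a ha => ⟨f a, ha, rfl⟩
  · exact fun b hb => hs b hb
  · rintro a b a' b' ⟨ha, rfl⟩ ⟨ha', rfl⟩
    exact ⟨hadd a ha a' ha', hf a a'⟩
  · rintro a b ⟨ha, rfl⟩
    exact hB a ha

section
variable {a : ℕ}

lemma cb_map {V W : Type} [AddCommGroup V] [Module (ZMod 2) V] [AddCommGroup W] [Module (ZMod 2) W]
    (f : V →ₗ[ZMod 2] W) (c : AF a → V) : cb (fun G => f (c G)) = fun G => f (cb c G) := by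
  funext G
  rcases G with _ | F
  · simp only [cb_none, map_sum]
  · simp only [cb_some, map_sum]
    refine Finset.sum_congr rfl (fun i _ => ?_)
    split_ifs <;> simp

/-- Restriction to a rank. -/
def rkr {V : Type} [Zero V] (p : ℕ) (e : AF a → V) : AF a → V :=
  fun G => if rk G = p then e G else 0

lemma cb_rkr {V : Type} [AddCommGroup V] [Module (ZMod 2) V] (p : ℕ) (e : AF a → V) :
    cb (rkr (p + 1) e) = rkr p (cb e) := by
  funext G
  rcases G with _ | F
  · simp only [cb_none, rkr, rk, dim_toFace]
    by_cases h : p = 0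
    · subst h
      simp
    · have h1 : ¬ (0 + 1 = p + 1) := by omega
      have h2 : ¬ (0 = p) := by omega
      simp [h, h1, h2]
  · simp only [cb_some, rkr]
    by_cases h : dim F + 1 = p
    · have : rk (some F) = p := h
      rw [if_pos this]
      refine Finset.sum_congr rfl (fun i _ => ?_)
      split_ifs with h1 h2
      · rfl
      · rfl
      · exact absurd (by simp only [rk]; rw [dim_upd_none h1, h]) h2
    · have : ¬ rk (some F) = p := h
      rw [if_neg this]
      refine Finset.sum_eq_zero (fun i _ => ?_)
      split_ifs with h1 h2
      · rfl
      · simp only [rk] at h2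
        rw [dim_upd_none h1] at h2
        omega
      · rfl

/-- Membership of augmented faces. -/
def inK (K : Set (CubeFace a)) : AF a → Prop
  | none => True
  | some F => F ∈ K

/-- Reduced cellular cycles of rank `n`. -/
def CZ (K : Set (CubeFace a)) (n : ℕ) : Set (AF a → ZMod 2) :=
  {c | (∀ G, c G ≠ 0 → rk G = n ∧ inK K G) ∧ cb c = 0}

/-- Reduced cellular boundaries of rank `n`. -/
def CB (K : Set (CubeFace a)) (n : ℕ) : Set (AF a → ZMod 2) :=
  {c | ∃ e : AF a → ZMod 2, (∀ G, e G ≠ 0 → rk G = n + 1 ∧ inK K G) ∧ cb e = c}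

/-- Finitely supported chains satisfying a predicate. -/
abbrev spp {β : Type} (P : β → Prop) : Submodule (ZMod 2) (β →₀ ZMod 2) :=
  Finsupp.supported (ZMod 2) (ZMod 2) {b | P b}

/-- Hypotheses of the comparison theorem. -/
structure XH (B : ℕ → Type) (dB : ∀ q, (B (q + 1) →₀ ZMod 2) →ₗ[ZMod 2] (B q →₀ ZMod 2))
    (L : ∀ q, AF a → B q → Prop) : Prop where
  bb : ∀ q x, dB q (dB (q + 1) x) = 0
  mono : ∀ q F G β, L q (some F) β → G ≤ F → L q (some G) β
  mono0 : ∀ q F β, L q (some F) β → L q none β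
  memB : ∀ q G x, x ∈ spp (L (q + 1) G) → dB q x ∈ spp (L q G)
  rowZ : ∀ F x, x ∈ spp (L 0 (some F)) → ∃ y ∈ spp (L 1 (some F)), dB 0 y = x
  row : ∀ q F x, x ∈ spp (L (q + 1) (some F)) → dB q x = 0 →
    ∃ y ∈ spp (L (q + 2) (some F)), dB (q + 1) y = x
  col : ∀ q β, L (q + 1) none β → ∃ m, ∀ G, L (q + 1) G β ↔ leA G m

variable {B : ℕ → Type} {dB : ∀ q, (B (q + 1) →₀ ZMod 2) →ₗ[ZMod 2] (B q →₀ ZMod 2)}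
    {L : ∀ q, AF a → B q → Prop}

/-- The double complex. -/
def XD (L : ∀ q, AF a → B q → Prop) (p q : ℕ) : Submodule (ZMod 2) (AF a → (B q →₀ ZMod 2)) where
  carrier := {x | (∀ G, x G ≠ 0 → rk G = p) ∧ ∀ G, x G ∈ spp (L q G)}
  add_mem' := by
    rintro x y ⟨h1, h2⟩ ⟨h1', h2'⟩
    refine ⟨fun G hG => ?_, fun G => Submodule.add_mem _ (h2 G) (h2' G)⟩
    by_cases h : x G = 0
    · exact h1' G (fun h' => hG (by simp [h, h']))
    · exact h1 G h
  zero_mem' := ⟨fun G hG => absurd rfl hG, fun G => Submodule.zero_mem _⟩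
  smul_mem' := by
    rintro r x ⟨h1, h2⟩
    refine ⟨fun G hG => h1 G (fun h => hG (by simp [h])), fun G => Submodule.smul_mem _ _ (h2 G)⟩

lemma XD_mem {p q : ℕ} {x : AF a → (B q →₀ ZMod 2)} :
    x ∈ XD L p q ↔ (∀ G, x G ≠ 0 → rk G = p) ∧ ∀ G, x G ∈ spp (L q G) := Iff.rfl

lemma cb_rank {V : Type} [AddCommGroup V] [Module (ZMod 2) V] {p : ℕ} {x : AF a → V}
    (h : ∀ G, x G ≠ 0 → rk G = p + 1) : ∀ G, cb x G ≠ 0 → rk G = p := by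
  have e : rkr (p + 1) x = x := by
    funext G
    simp only [rkr]
    split_ifs with h1
    · rfl
    · by_contra h2
      exact h1 (h G (Ne.symm h2))
  intro G hG
  rw [← e, cb_rkr] at hG
  by_contra h1
  exact hG (by simp [rkr, h1])

lemma XD_memh (h : XH B dB L) (p q : ℕ) (x : AF a → (B q →₀ ZMod 2)) (hx : x ∈ XD L (p + 1) q) :
    cb x ∈ XD L p q := by
  refine ⟨cb_rank hx.1, ?_⟩
  intro G
  rcases G with _ | F
  · rw [cb_none]
    refine Submodule.sum_mem _ (fun v _ => ?_)
    intro β hβ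
    exact h.mono0 q _ β (hx.2 _ hβ)
  · rw [cb_some]
    refine Submodule.sum_mem _ (fun i _ => ?_)
    split_ifs
    · exact Submodule.zero_mem _
    · intro β hβ
      exact h.mono q _ _ β (hx.2 _ hβ) (le_upd_none F i)

lemma XD_col (h : XH B dB L) (p q : ℕ) (x : AF a → (B (q + 1) →₀ ZMod 2))
    (hx : x ∈ XD L p (q + 1)) (hc : cb x = 0) : ∃ y ∈ XD L (p + 1) (q + 1), cb y = x := by
  classical
  have hβ : ∀ β : B (q + 1), ∃ e : AF a → ZMod 2, (∀ G, e G ≠ 0 → rk G = p + 1 ∧ L (q + 1) G β) ∧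
      cb e = fun G => x G β := by
    intro β
    by_cases hL : L (q + 1) none β
    · obtain ⟨m, hm⟩ := h.col q β hL
      obtain ⟨e, he, he'⟩ := face_acyclic m (fun G => x G β) (fun G hG => by
        rw [← hm]
        exact hx.2 G (Finsupp.mem_support_iff.mpr hG)) (by
        have := cb_map (Finsupp.lapply (R := ZMod 2) β) x
        simp only [Finsupp.lapply_apply] at this
        rw [this, hc]
        rfl)
      refine ⟨rkr (p + 1) e, ?_, ?_⟩
      · intro G hG
        simp only [rkr] at hG
        split_ifs at hG with h1
        · exact ⟨h1, (hm G).mpr (he G hG)⟩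
        · exact absurd rfl hG
      · rw [cb_rkr, he']
        funext G
        simp only [rkr]
        split_ifs with h1
        · rfl
        · by_contra h2
          apply h1
          apply hx.1 G
          intro h3
          exact h2 (by simp [h3])
    · refine ⟨0, fun G hG => absurd rfl hG, ?_⟩
      rw [map_zero]
      funext G
      by_contra h2
      have h3 : L (q + 1) G β := hx.2 G (Finsupp.mem_support_iff.mpr (Ne.symm h2))
      rcases G with _ | F
      · exact hL h3
      · exact hL (h.mono0 _ _ _ h3)
  choose e he he' using hβ
  let S : Finset (B (q + 1)) := Finset.univ.biUnion (fun G => (x G).support)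
  let y : AF a → (B (q + 1) →₀ ZMod 2) := fun G =>
    Finsupp.onFinset S (fun β => if β ∈ S then e β G else 0) (fun β hβ => by
      by_contra h1
      simp [h1] at hβ)
  have hy : ∀ G β, y G β = if β ∈ S then e β G else 0 := fun G β => rfl
  refine ⟨y, ⟨?_, ?_⟩, ?_⟩
  · intro G hG
    obtain ⟨β, hβ⟩ := Finsupp.ne_iff.mp hG
    rw [hy] at hβ
    split_ifs at hβ with h1
    · exact (he β G hβ).1
    · exact absurd rfl hβ
  · intro G β hβ
    have hβ' : y G β ≠ 0 := Finsupp.mem_support_iff.mp hβ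
    rw [hy] at hβ'
    split_ifs at hβ' with h1
    · exact (he β G hβ').2
    · exact absurd rfl hβ'
  · funext G
    ext β
    have h1 := congrFun (cb_map (Finsupp.lapply (R := ZMod 2) β) y) G
    simp only [Finsupp.lapply_apply] at h1
    rw [← h1]
    by_cases hS : β ∈ S
    · have : (fun G => y G β) = e β := by
        funext G
        rw [hy, if_pos hS]
      rw [this, he']
    · have : (fun G => y G β) = 0 := by
        funext G
        rw [hy, if_neg hS]
        rfl
      rw [this, map_zero]
      by_contra h2
      apply hS
      exact Finset.mem_biUnion.mpr ⟨G, Finset.mem_univ _, Finsupp.mem_support_iff.mpr (Ne.symm h2)⟩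

lemma XD_dc (h : XH B dB L) :
    DC (A := fun q => AF a → (B q →₀ ZMod 2)) (XD L) (fun q => cb)
      (fun q => (dB q).compLeft (AF a)) where
  hh q x := cb_cb x
  vv q x := by
    funext G
    exact h.bb q (x G)
  hv q x := cb_map (dB q) x
  memh p q x hx := XD_memh h p q x hx
  memv p q x hx := by
    refine ⟨fun G hG => hx.1 G (fun h0 => hG ?_), fun G => h.memB q G _ (hx.2 G)⟩
    change dB q (x G) = 0
    rw [h0, map_zero]
  rowZ p x hx := by
    classical
    have : ∀ G, ∃ z, z ∈ spp (L 1 G) ∧ dB 0 z = x G ∧ (x G = 0 → z = 0) := by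
      intro G
      by_cases h0 : x G = 0
      · exact ⟨0, Submodule.zero_mem _, by rw [h0, map_zero], fun _ => rfl⟩
      · rcases G with _ | F
        · exact absurd (hx.1 _ h0) (by simp [rk])
        · obtain ⟨z, hz, hz'⟩ := h.rowZ F _ (hx.2 (some F))
          exact ⟨z, hz, hz', fun h1 => absurd h1 h0⟩
    choose y hy hy' hy0 using this
    exact ⟨y, ⟨fun G hG => hx.1 G (fun h0 => hG (hy0 G h0)), hy⟩, funext hy'⟩
  row p q x hx hc := by
    classical
    have : ∀ G, ∃ z, z ∈ spp (L (q + 2) G) ∧ dB (q + 1) z = x G ∧ (x G = 0 → z = 0) := by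
      intro G
      by_cases h0 : x G = 0
      · exact ⟨0, Submodule.zero_mem _, by rw [h0, map_zero], fun _ => rfl⟩
      · rcases G with _ | F
        · exact absurd (hx.1 _ h0) (by simp [rk])
        · obtain ⟨z, hz, hz'⟩ := h.row q F _ (hx.2 (some F)) (congrFun hc (some F))
          exact ⟨z, hz, hz', fun h1 => absurd h1 h0⟩
    choose y hy hy' hy0 using this
    exact ⟨y, ⟨fun G hG => hx.1 G (fun h0 => hG (hy0 G h0)), hy⟩, funext hy'⟩
  colZ q x hx := by
    refine XD_col h 0 q x hx ?_
    have hs : ∀ F, x (some F) = 0 := by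
      intro F
      by_contra h0
      exact absurd (hx.1 _ h0) (by simp [rk])
    funext G
    rcases G with _ | F
    · rw [cb_none]
      simp [hs]
    · rw [cb_some]
      simp [hs]
  col p q x hx hc := XD_col h (p + 1) q x hx hc

/-- The comparison theorem. -/
lemma theoremX (h : XH B dB L) (K : Set (CubeFace a)) (b0 : B 0) (hb0 : ∀ b, b = b0)
    (hK : ∀ G, L 0 G b0 ↔ inK K G) (n : ℕ) :
    HEquiv {x | x ∈ spp (L (n + 1) none) ∧ dB n x = 0}
      {x | ∃ y ∈ spp (L (n + 2) none), dB (n + 1) y = x} (CZ K (n + 1)) (CB K (n + 1)) := by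
  classical
  have main := dc_main (XD_dc h) n
  have hnone : ∀ q (y : AF a → (B q →₀ ZMod 2)), y ∈ XD L 0 q → ∀ F, y (some F) = 0 := by
    intro q y hy F
    by_contra h0
    exact absurd (hy.1 _ h0) (by simp [rk])
  have hlift : ∀ q (z : B q →₀ ZMod 2), z ∈ spp (L q none) →
      (Pi.single none z : AF a → (B q →₀ ZMod 2)) ∈ XD L 0 q := by
    intro q z hz
    refine ⟨fun G hG => ?_, fun G => ?_⟩
    · rcases G with _ | F
      · rfl
      · simp at hG
    · rcases G with _ | F
      · simpa using hz
      · simp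
  have left : HEquiv {x : AF a → (B (n + 1) →₀ ZMod 2) | x ∈ XD L 0 (n + 1) ∧ (dB n).compLeft (AF a) x = 0}
      {x | ∃ y ∈ XD L 0 (n + 2), (dB (n + 1)).compLeft (AF a) y = x}
      {x | x ∈ spp (L (n + 1) none) ∧ dB n x = 0}
      {x | ∃ y ∈ spp (L (n + 2) none), dB (n + 1) y = x} := by
    refine HEquiv.of_bij (fun x => x none) (fun _ _ => rfl) ?_ ?_ ?_ ?_
    · rintro x ⟨h1, h2⟩ x' ⟨h1', h2'⟩
      exact ⟨Submodule.add_mem _ h1 h1', by rw [map_add, h2, h2', add_zero]⟩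
    · rintro x ⟨h1, h2⟩
      exact ⟨h1.2 none, congrFun h2 none⟩
    · rintro z ⟨h1, h2⟩
      refine ⟨Pi.single none z, ⟨hlift _ z h1, ?_⟩, by simp⟩
      funext G
      change dB n _ = 0
      rcases G with _ | F
      · simpa using h2
      · simp
    · rintro x ⟨h1, h2⟩
      constructor
      · rintro ⟨y, hy, rfl⟩
        exact ⟨y none, hy.2 none, rfl⟩
      · rintro ⟨z, hz, hz'⟩
        refine ⟨Pi.single none z, hlift _ z hz, ?_⟩
        funext G
        change dB (n + 1) _ = _
        rcases G with _ | F
        · simpa using hz'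
        · rw [hnone _ x h1]
          simp
  have conv : ∀ p (y : AF a → (B 0 →₀ ZMod 2)), y ∈ XD L p 0 ↔
      ∀ G, y G b0 ≠ 0 → rk G = p ∧ inK K G := by
    intro p y
    constructor
    · intro hy G hG
      refine ⟨hy.1 G (fun h0 => hG (by simp [h0])), ?_⟩
      rw [← hK]
      exact hy.2 G (Finsupp.mem_support_iff.mpr hG)
    · intro hy
      refine ⟨fun G hG => ?_, fun G β hβ => ?_⟩
      · obtain ⟨β, hβ⟩ := Finsupp.ne_iff.mp hG
        rw [hb0 β] at hβ
        exact (hy G hβ).1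
      · have h1 := Finsupp.mem_support_iff.mp hβ
        have h2 := hb0 β
        subst h2
        exact (hK G).mpr (hy G h1).2
  have cbev : ∀ (y : AF a → (B 0 →₀ ZMod 2)), cb (fun G => y G b0) = fun G => cb y G b0 := by
    intro y
    have := cb_map (Finsupp.lapply (R := ZMod 2) b0) y
    simpa only [Finsupp.lapply_apply] using this
  have hinj : ∀ (y z : AF a → (B 0 →₀ ZMod 2)), (fun G => y G b0) = (fun G => z G b0) → y = z := by
    intro y z hyz
    funext G
    ext β
    rw [hb0 β]
    exact congrFun hyz G
  have right : HEquiv {x : AF a → (B 0 →₀ ZMod 2) | x ∈ XD L (n + 1) 0 ∧ cb x = 0}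
      {x | ∃ y ∈ XD L (n + 2) 0, cb y = x} (CZ K (n + 1)) (CB K (n + 1)) := by
    refine HEquiv.of_bij (fun x G => x G b0) (fun _ _ => rfl) ?_ ?_ ?_ ?_
    · rintro x ⟨h1, h2⟩ x' ⟨h1', h2'⟩
      exact ⟨Submodule.add_mem _ h1 h1', by rw [map_add, h2, h2', add_zero]⟩
    · rintro x ⟨h1, h2⟩
      refine ⟨(conv _ _).mp h1, ?_⟩
      rw [cbev, h2]
      rfl
    · rintro c ⟨h1, h2⟩
      refine ⟨fun G => Finsupp.single b0 (c G), ⟨(conv _ _).mpr (by simpa using h1), ?_⟩, by simp⟩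
      apply hinj
      rw [← cbev]
      simp only [Finsupp.single_eq_same]
      exact h2
    · rintro x ⟨h1, h2⟩
      constructor
      · rintro ⟨y, hy, rfl⟩
        exact ⟨fun G => y G b0, (conv _ _).mp hy, cbev y⟩
      · rintro ⟨c, hc, hc'⟩
        refine ⟨fun G => Finsupp.single b0 (c G), (conv _ _).mpr (by simpa using hc), ?_⟩
        apply hinj
        rw [← cbev, ← hc']
        simp
  exact (left.symm.trans main).trans right

end

end CubMan

/-! ## Comparison of singular and cellular homology in carrier form -/

namespace CubMan

open CubeFace

section
variable {a : ℕ}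

lemma inf_lemma (T : Set (CubeFace a)) (G0 : CubeFace a) (h0 : ∀ H ∈ T, G0 ≤ H) :
    ∃ m : CubeFace a, ∀ G, G ≤ m ↔ ∀ H ∈ T, G ≤ H := by
  classical
  refine ⟨fun i => if ∀ H ∈ T, H i = none then none else G0 i, fun G => ⟨fun h H hH i => ?_, fun h i => ?_⟩⟩
  · have h1 := h i
    dsimp only at h1
    split_ifs at h1 with h2
    · exact Or.inl (h2 H hH)
    · push Not at h2
      obtain ⟨H', hH', hn⟩ := h2
      have h4 : G0 i = H' i := (h0 H' hH' i).resolve_left hn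
      have h5 : G i = G0 i := h1.resolve_left (by rw [h4]; exact hn)
      rcases h0 H hH i with h3 | h3
      · exact Or.inl h3
      · exact Or.inr (h5.trans h3)
  · dsimp only
    split_ifs with h2
    · exact Or.inl rfl
    · push Not at h2
      obtain ⟨H', hH', hn⟩ := h2
      have h4 : G0 i = H' i := (h0 H' hH' i).resolve_left hn
      exact Or.inr (((h H' hH' i).resolve_left hn).trans h4.symm)

variable {E : Type} [NormedAddCommGroup E] [NormedSpace ℝ E]

/-- The open sets of a carrier. -/
def Ucar {S : Set E} (K : Set (CubeFace a)) (C : S → CubeFace a) : Option K → Set S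
  | none => ∅
  | some G => {y | (G : CubeFace a) ≤ C y}

/-- The relation used in the comparison theorem. -/
def CL {S : Set E} (K : Set (CubeFace a)) (C : S → CubeFace a) (q : ℕ) : AF a → Sx q S → Prop
  | none, σ => ∃ o, ∀ x, σ x ∈ Ucar K C o
  | some G, σ => G ∈ K ∧ ∀ x, G ≤ C (σ x)

/-- The carrier hypotheses. -/
structure Carrier (S : Set E) (K : Set (CubeFace a)) (C : S → CubeFace a) : Prop where
  mem : ∀ y, C y ∈ K
  down : ∀ F ∈ K, ∀ G, G ≤ F → G ∈ K
  star : ∀ L ∈ K, ∃ (A : Set E) (b : E), StarConvex ℝ b A ∧ b ∈ A ∧ A ⊆ S ∧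
    ∀ y : S, (y : E) ∈ A ↔ L ≤ C y
  opn : ∀ L ∈ K, IsOpen {y : S | L ≤ C y}

lemma sx_pt (q : ℕ) : Nonempty (stdSimplex ℝ (Fin (q + 1))) :=
  ⟨⟨Pi.single 0 1, single_mem_stdSimplex ℝ _⟩⟩

lemma carrier_XH {S : Set E} {K : Set (CubeFace a)} {C : S → CubeFace a} (h : Carrier S K C) :
    XH (fun q => Sx q S) (fun _ => bd) (CL K C) where
  bb := fun q x => bd_bd x
  mono := fun q F G β hF hG => ⟨h.down _ hF.1 _ hG, fun x => hG.trans (hF.2 x)⟩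
  mono0 := fun q F β hF => ⟨some ⟨F, hF.1⟩, hF.2⟩
  memB := fun q G x hx => by
    refine lin_maps bd _ _ (fun σ hσ => ?_) x hx
    rw [bd_single]
    refine Submodule.sum_mem _ (fun i _ => Finsupp.single_mem_supported _ _ ?_)
    rcases G with _ | F
    · obtain ⟨o, ho⟩ := hσ
      exact ⟨o, fun x => ho _⟩
    · exact ⟨hσ.1, fun x => hσ.2 _⟩
  rowZ := fun F x hx => by
    by_cases hF : F ∈ K
    · obtain ⟨A, b, -, hb, hAS, hA⟩ := h.star F hF
      obtain ⟨e, he, hbe⟩ := star_acyclic_zero hb hAS x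
      exact ⟨e, fun σ hσ => ⟨hF, fun x => (hA _).mp (he hσ x)⟩, hbe⟩
    · refine ⟨0, Submodule.zero_mem _, ?_⟩
      rw [map_zero]
      ext σ
      by_contra h0
      exact hF (hx (Finsupp.mem_support_iff.mpr (Ne.symm h0))).1
  row := fun q F x hx hd => by
    by_cases hF : F ∈ K
    · obtain ⟨A, b, hst, hb, hAS, hA⟩ := h.star F hF
      obtain ⟨e, he, hbe⟩ := star_acyclic hst hb hAS x (fun σ hσ x => (hA _).mpr ((hx hσ).2 x)) hd
      exact ⟨e, fun σ hσ => ⟨hF, fun x => (hA _).mp (he hσ x)⟩, hbe⟩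
    · refine ⟨0, Submodule.zero_mem _, ?_⟩
      rw [map_zero]
      ext σ
      by_contra h0
      exact hF (hx (Finsupp.mem_support_iff.mpr (Ne.symm h0))).1
  col := fun q σ hσ => by
    obtain ⟨x0⟩ := sx_pt q
    obtain ⟨o, ho⟩ := hσ
    rcases o with _ | G0
    · exact absurd (ho x0) (by simp [Ucar])
    · obtain ⟨m, hm⟩ := inf_lemma {H | ∃ x, H = C (σ x)} G0 (by rintro _ ⟨x, rfl⟩; exact ho x)
      refine ⟨m, fun G => ?_⟩
      rcases G with _ | G
      · exact ⟨fun _ => trivial, fun _ => ⟨some G0, ho⟩⟩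
      · refine ⟨fun hG => (hm G).mpr (by rintro _ ⟨x, rfl⟩; exact hG.2 x), fun hG => ?_⟩
        have h1 := (hm G).mp hG
        exact ⟨h.down _ (h.mem (σ x0)) _ (h1 _ ⟨x0, rfl⟩), fun x => h1 _ ⟨x, rfl⟩⟩

/-- Comparison theorem in carrier form. -/
lemma carrier_thm {S : Set E} {K : Set (CubeFace a)} {C : S → CubeFace a} (h : Carrier S K C)
    (n : ℕ) : HEquiv {c : Ch (n + 1) S | bd c = 0} {c | ∃ e : Ch (n + 2) S, bd e = c}
      (CZ K (n + 1)) (CB K (n + 1)) := by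
  let b0 : Sx 0 S := ⟨fun x => absurd (stdSimplex.sum_eq_one x) (by simp),
    ⟨fun s _ => by
      have : IsEmpty (stdSimplex ℝ (Fin 0)) := ⟨fun x => absurd (stdSimplex.sum_eq_one x) (by simp)⟩
      convert isOpen_empty
      exact Set.eq_empty_of_isEmpty _⟩⟩
  have hemp : ∀ x : stdSimplex ℝ (Fin 0), False := fun x =>
    absurd (stdSimplex.sum_eq_one x) (by simp)
  have main := theoremX (carrier_XH h) K b0 (fun b => sx_zero_sub _ _) (fun G => by
    rcases G with _ | G
    · exact ⟨fun _ => trivial, fun _ => ⟨none, fun x => (hemp x).elim⟩⟩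
    · exact ⟨fun h => h.1, fun h => ⟨h, fun x => (hemp x).elim⟩⟩) n
  have hU : ∀ o, IsOpen (Ucar K C o) := by
    rintro (_ | G)
    · exact isOpen_empty
    · exact h.opn G G.2
  have hcov : ∀ x, ∃ o, x ∈ Ucar K C o := fun x => ⟨some ⟨C x, h.mem x⟩, by change C x ≤ C x; exact le_refl _⟩
  refine HEquiv.trans (HEquiv.symm ?_) main
  let B' : Submodule (ZMod 2) (Ch (n + 1) S) := LinearMap.range bd
  have hB' : {c : Ch (n + 1) S | ∃ e : Ch (n + 2) S, bd e = c} = (B' : Set _) := by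
    ext c; simp [B']
  rw [hB']
  refine HEquiv.of_map B' LinearMap.id ?_ ?_ ?_ ?_ ?_
  · rintro x ⟨h1, h2⟩ x' ⟨h1', h2'⟩
    exact ⟨Submodule.add_mem _ h1 h1', by rw [map_add, h2, h2', add_zero]⟩
  · rintro x h2 x' h2'
    rw [Set.mem_ofPred_eq] at *
    rw [map_add, h2, h2', add_zero]
  · rintro x ⟨h1, h2⟩
    exact h2
  · rintro x ⟨h1, h2⟩
    constructor
    · rintro ⟨e, he⟩
      exact small_bd (Ucar K C) hU ⟨none⟩ hcov x h1 e he
    · rintro ⟨e, -, he⟩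
      exact ⟨e, he⟩
  · rintro x hx
    obtain ⟨c', h1, h2, e, he⟩ := small_cycle (Ucar K C) hU ⟨none⟩ hcov x hx
    exact ⟨c', ⟨h1, h2⟩, e, he⟩

end

end CubMan

/-! ## Carriers on realizations and on punctured stars -/

namespace CubMan

open CubeFace

section
variable {a : ℕ}

/-- The centre of a face. -/
noncomputable def cen (G : CubeFace a) : Fin a → ℝ := fun i =>
  match G i with
  | none => 1 / 2
  | some false => 0
  | some true => 1

lemma cen_none {G : CubeFace a} {i : Fin a} (h : G i = none) : cen G i = 1 / 2 := by
  simp [cen, h]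
lemma cen_false {G : CubeFace a} {i : Fin a} (h : G i = some false) : cen G i = 0 := by
  simp [cen, h]
lemma cen_true {G : CubeFace a} {i : Fin a} (h : G i = some true) : cen G i = 1 := by
  simp [cen, h]

lemma opt_cases (x : Option Bool) : x = none ∨ x = some false ∨ x = some true := by
  rcases x with _ | _ | _ <;> simp

lemma cen_bd (G : CubeFace a) (i : Fin a) : 0 ≤ cen G i ∧ cen G i ≤ 1 := by
  rcases opt_cases (G i) with h | h | h
  · rw [cen_none h]; norm_num
  · rw [cen_false h]; norm_num
  · rw [cen_true h]; norm_num

lemma cen_eq_zero {G : CubeFace a} {i : Fin a} (h : cen G i = 0) : G i = some false := by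
  rcases opt_cases (G i) with h' | h' | h'
  · rw [cen_none h'] at h; norm_num at h
  · exact h'
  · rw [cen_true h'] at h; norm_num at h

lemma cen_eq_one {G : CubeFace a} {i : Fin a} (h : cen G i = 1) : G i = some true := by
  rcases opt_cases (G i) with h' | h' | h'
  · rw [cen_none h'] at h; norm_num at h
  · rw [cen_false h'] at h; norm_num at h
  · exact h'

/-- The carrier of a point. -/
noncomputable def carr (y : Fin a → ℝ) : CubeFace a := fun i =>
  if y i = 0 then some false else if y i = 1 then some true else none

lemma le_carr {L : CubeFace a} {y : Fin a → ℝ} :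
    L ≤ carr y ↔ ∀ i, (y i = 0 → L i = some false) ∧ (y i = 1 → L i = some true) := by
  rw [le_def]
  refine forall_congr' (fun i => ?_)
  simp only [carr]
  split_ifs with h1 h2
  · simp [h1]
  · simp [h2]
  · simp [h1, h2]

lemma carr_le {H : CubeFace a} {y : Fin a → ℝ} :
    carr y ≤ H ↔ ∀ i, (H i = some false → y i = 0) ∧ (H i = some true → y i = 1) := by
  rw [le_def]
  refine forall_congr' (fun i => ?_)
  simp only [carr]
  split_ifs with h1 h2
  · rcases opt_cases (H i) with h | h | h <;> simp [h, h1]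
  · rcases opt_cases (H i) with h | h | h <;> simp [h, h2]
  · rcases opt_cases (H i) with h | h | h <;> simp [h, h1, h2]

/-- The cube. -/
def inC (y : Fin a → ℝ) : Prop := ∀ i, 0 ≤ y i ∧ y i ≤ 1

lemma mem_real {K : Set (CubeFace a)} {y : Fin a → ℝ} :
    y ∈ CubeFace.real K ↔ inC y ∧ ∃ F ∈ K, carr y ≤ F := by
  simp only [CubeFace.real, Set.mem_iUnion, Set.mem_ofPred_eq, carr_le, inC]
  constructor
  · rintro ⟨F, hF, h1, h2⟩
    exact ⟨h1, F, hF, h2⟩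
  · rintro ⟨h1, F, hF, h2⟩
    exact ⟨F, hF, h1, h2⟩

lemma carr_cen (G : CubeFace a) : carr (cen G) = G := by
  funext i
  simp only [carr]
  rcases opt_cases (G i) with h | h | h
  · rw [cen_none h, h]; norm_num
  · rw [cen_false h, h]; norm_num
  · rw [cen_true h, h]; norm_num

lemma cen_mem {K : Set (CubeFace a)} {G : CubeFace a} (h : G ∈ K) : cen G ∈ CubeFace.real K :=
  mem_real.mpr ⟨cen_bd G, G, h, by rw [carr_cen]⟩

lemma isOpen_le_carr (L : CubeFace a) : IsOpen {y : Fin a → ℝ | L ≤ carr y} := by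
  have : {y : Fin a → ℝ | L ≤ carr y} =
      ⋂ i, ({y | y i = 0 → L i = some false} ∩ {y | y i = 1 → L i = some true}) := by
    ext y
    simp [le_carr]
  rw [this]
  refine isOpen_iInter_of_finite (fun i => IsOpen.inter ?_ ?_)
  · by_cases h : L i = some false
    · simp [h]
    · simp only [h, imp_false]
      exact isOpen_ne_fun (continuous_apply i) continuous_const
  · by_cases h : L i = some true
    · simp [h]
    · simp only [h, imp_false]
      exact isOpen_ne_fun (continuous_apply i) continuous_const

/-- A carrier from a retraction onto a realization. -/
lemma carrier_of_retr {S : Set (Fin a → ℝ)} {K : Set (CubeFace a)}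
    (hK : ∀ F ∈ K, ∀ G, G ≤ F → G ∈ K) (ρ : (Fin a → ℝ) → (Fin a → ℝ)) (hc : ContinuousOn ρ S)
    (hm : ∀ y ∈ S, ρ y ∈ CubeFace.real K)
    (h0 : ∀ L ∈ K, cen L ∈ S ∧ L ≤ carr (ρ (cen L)))
    (h1 : ∀ L ∈ K, ∀ y ∈ S, L ≤ carr (ρ y) → ∀ s t : ℝ, 0 ≤ s → 0 ≤ t → s + t = 1 →
      s • cen L + t • y ∈ S ∧ L ≤ carr (ρ (s • cen L + t • y))) :
    Carrier S K (fun y => carr (ρ y)) where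
  mem := fun y => by
    obtain ⟨-, F, hF, h⟩ := mem_real.mp (hm y y.2)
    exact hK F hF _ h
  down := hK
  star := fun L hL => by
    refine ⟨{y | y ∈ S ∧ L ≤ carr (ρ y)}, cen L, ?_, h0 L hL, fun y hy => hy.1, fun y => ?_⟩
    · rintro y ⟨hy, hy'⟩ s t hs ht hst
      exact h1 L hL y hy hy' s t hs ht hst
    · exact ⟨fun h => h.2, fun h => ⟨y.2, h⟩⟩
  opn := fun L hL => (isOpen_le_carr L).preimage (continuousOn_iff_continuous_restrict.mp hc)

lemma comb_carr {L : CubeFace a} {y : Fin a → ℝ} (hy : inC y) (hL : L ≤ carr y) {s t : ℝ}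
    (hs : 0 ≤ s) (ht : 0 ≤ t) (hst : s + t = 1) :
    inC (s • cen L + t • y) ∧ L ≤ carr (s • cen L + t • y) ∧ carr (s • cen L + t • y) ≤ carr y := by
  have hL' := le_carr.mp hL
  refine ⟨fun i => ?_, le_carr.mpr fun i => ?_, carr_le.mpr fun i => ?_⟩
  · have h1 := cen_bd L i
    have h2 := hy i
    simp only [Pi.add_apply, Pi.smul_apply, smul_eq_mul]
    constructor
    · nlinarith
    · nlinarith
  · have h1 := cen_bd L i
    have h2 := hy i
    simp only [Pi.add_apply, Pi.smul_apply, smul_eq_mul]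
    constructor
    · intro h
      rcases hs.eq_or_lt with h0 | h0
      · subst h0
        have : t = 1 := by linarith
        subst this
        exact (hL' i).1 (by linarith)
      · apply cen_eq_zero
        have h3 : 0 ≤ t * y i := mul_nonneg ht h2.1
        have h4 : 0 ≤ s * cen L i := mul_nonneg hs h1.1
        have : s * cen L i = 0 := by linarith
        exact (mul_eq_zero.mp this).resolve_left h0.ne'
    · intro h
      rcases hs.eq_or_lt with h0 | h0
      · subst h0
        have : t = 1 := by linarith
        subst this
        exact (hL' i).2 (by linarith)
      · apply cen_eq_one
        have h3 : 0 ≤ t * (1 - y i) := mul_nonneg ht (by linarith)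
        have h4 : 0 ≤ s * (1 - cen L i) := mul_nonneg hs (by linarith)
        have : s * (1 - cen L i) = 0 := by nlinarith
        have := (mul_eq_zero.mp this).resolve_left h0.ne'
        linarith
  · simp only [Pi.add_apply, Pi.smul_apply, smul_eq_mul, carr]
    constructor
    · intro h
      split_ifs at h with h0 h1
      · have := cen_false ((hL' i).1 h0)
        rw [this, h0]; ring
      · exact absurd h (by simp)
    · intro h
      split_ifs at h with h0 h1
      · exact absurd h (by simp)
      · have := cen_true ((hL' i).2 h1)
        rw [this, h1]; linarith

/-- The carrier on a realization. -/
lemma real_carrier {K : Set (CubeFace a)} (hK : ∀ F ∈ K, ∀ G, G ≤ F → G ∈ K) :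
    Carrier (CubeFace.real K) K (fun y => carr (y : Fin a → ℝ)) := by
  refine carrier_of_retr hK id continuousOn_id (fun y hy => hy) (fun L hL => ⟨cen_mem hL, ?_⟩) ?_
  · simp only [id]; rw [carr_cen]
  · intro L hL y hy hLy s t hs ht hst
    obtain ⟨h1, F, hF, h2⟩ := mem_real.mp hy
    obtain ⟨h3, h4, h5⟩ := comb_carr h1 hLy hs ht hst
    exact ⟨mem_real.mpr ⟨h3, F, hF, h5.trans h2⟩, h4⟩

/-- The closed star. -/
def St (M : Set (CubeFace a)) (G : CubeFace a) : Set (CubeFace a) := {F | ∃ H ∈ M, G ≤ H ∧ F ≤ H}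

/-- The link, inside the closed star. -/
def Lk (M : Set (CubeFace a)) (G : CubeFace a) : Set (CubeFace a) :=
  {F | (∃ H ∈ M, G ≤ H ∧ F ≤ H) ∧ ¬ G ≤ F}

lemma St_down (M : Set (CubeFace a)) (G : CubeFace a) : ∀ F ∈ St M G, ∀ G', G' ≤ F → G' ∈ St M G :=
  fun _ ⟨H, h1, h2, h3⟩ _ h => ⟨H, h1, h2, h.trans h3⟩

lemma Lk_down (M : Set (CubeFace a)) (G : CubeFace a) : ∀ F ∈ Lk M G, ∀ G', G' ≤ F → G' ∈ Lk M G :=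
  fun _ ⟨⟨H, h1, h2, h3⟩, h4⟩ _ h => ⟨⟨H, h1, h2, h.trans h3⟩, fun h5 => h4 (h5.trans h)⟩

/-- Gauge weights. -/
noncomputable def wt (G : CubeFace a) (i : Fin a) : ℝ := if G i = none then 2 else 1

/-- The gauge of the star of `G`. -/
noncomputable def gau (G : CubeFace a) (y : Fin a → ℝ) : ℝ := ‖fun i => wt G i * (y i - cen G i)‖

lemma gau_cont (G : CubeFace a) : Continuous (gau G) := by
  unfold gau
  fun_prop

lemma gau_scale (G : CubeFace a) (w : Fin a → ℝ) {t : ℝ} (ht : 0 ≤ t) :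
    gau G (cen G + t • (w - cen G)) = t * gau G w := by
  unfold gau
  rw [← abs_of_nonneg ht, ← Real.norm_eq_abs, ← norm_smul, Real.norm_eq_abs, abs_of_nonneg ht]
  congr 1
  funext i
  simp only [Pi.add_apply, Pi.smul_apply, Pi.sub_apply, smul_eq_mul]
  ring

lemma gau_pos {G : CubeFace a} {y : Fin a → ℝ} (h : y ≠ cen G) : 0 < gau G y := by
  unfold gau
  rw [norm_pos_iff]
  intro h0
  apply h
  funext i
  have := congrFun h0 i
  simp only [wt, Pi.zero_apply, mul_eq_zero] at this
  rcases this with h1 | h1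
  · split_ifs at h1 <;> norm_num at h1
  · linarith

lemma gau_link {M : Set (CubeFace a)} {G : CubeFace a} {w : Fin a → ℝ}
    (hw : w ∈ CubeFace.real (Lk M G)) : gau G w = 1 := by
  obtain ⟨h1, F, ⟨⟨H, -, hGH, hFH⟩, hG⟩, h2⟩ := mem_real.mp hw
  unfold gau
  have h2' := carr_le.mp h2
  apply le_antisymm
  · rw [pi_norm_le_iff_of_nonneg (by norm_num)]
    intro i
    have := h1 i
    rw [Real.norm_eq_abs, abs_le]
    simp only [wt]
    rcases opt_cases (G i) with h | h | h
    · rw [cen_none h, if_pos h]; constructor <;> linarith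
    · rw [cen_false h, if_neg (by simp [h])]; constructor <;> linarith
    · rw [cen_true h, if_neg (by simp [h])]; constructor <;> linarith
  · rw [le_def] at hG
    push Not at hG
    obtain ⟨i, hi1, hi2⟩ := hG
    refine le_trans ?_ (norm_le_pi_norm _ i)
    rw [Real.norm_eq_abs]
    simp only [wt]
    have := h2' i
    rcases opt_cases (G i) with h | h | h <;> rcases opt_cases (F i) with h' | h' | h'
    · exact absurd h' hi1
    · rw [cen_none h, if_pos h, this.1 h']; norm_num
    · rw [cen_none h, if_pos h, this.2 h']; norm_num
    · exact absurd h' hi1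
    · exact absurd (h.trans h'.symm) hi2
    · rw [cen_false h, this.2 h', if_neg (by simp [h])]; norm_num
    · exact absurd h' hi1
    · rw [cen_true h, this.1 h', if_neg (by simp [h])]; norm_num
    · exact absurd (h.trans h'.symm) hi2

/-- Radial retraction. -/
noncomputable def radr (G : CubeFace a) (y : Fin a → ℝ) : Fin a → ℝ :=
  cen G + (gau G y)⁻¹ • (y - cen G)

lemma radr_mem {M : Set (CubeFace a)} {G : CubeFace a} {y : Fin a → ℝ}
    (hy : y ∈ CubeFace.real (St M G)) (hne : y ≠ cen G) : radr G y ∈ CubeFace.real (Lk M G) := by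
  obtain ⟨h1, F, ⟨H, hH, hGH, hFH⟩, h2⟩ := mem_real.mp hy
  have h3 := carr_le.mp (h2.trans hFH)
  have hp := gau_pos hne
  have hpi := inv_pos.mpr hp
  have hg : gau G (radr G y) = 1 := by
    rw [radr, gau_scale _ _ hpi.le, inv_mul_cancel₀ hp.ne']
  have hle : ∀ i, |wt G i * (radr G y i - cen G i)| ≤ 1 := by
    intro i
    rw [← hg]
    exact norm_le_pi_norm (fun i => wt G i * (radr G y i - cen G i)) i
  have hex : ∃ i, 1 ≤ |wt G i * (radr G y i - cen G i)| := by
    by_contra! hcon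
    have : gau G (radr G y) < 1 := (pi_norm_lt_iff (by norm_num)).mpr hcon
    linarith
  have hform : ∀ i, radr G y i = cen G i + (gau G y)⁻¹ * (y i - cen G i) := fun i => rfl
  have hin : inC (radr G y) := by
    intro i
    have h5 := abs_le.mp (hle i)
    have h6 := h1 i
    simp only [wt] at h5
    rcases opt_cases (G i) with h | h | h
    · rw [cen_none h, if_pos h] at h5
      constructor <;> linarith
    · rw [cen_false h, if_neg (by simp [h])] at h5
      have := hform i
      rw [cen_false h] at this
      have h7 : 0 ≤ (gau G y)⁻¹ * y i := mul_nonneg hpi.le h6.1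
      constructor
      · rw [this]; linarith
      · linarith
    · rw [cen_true h, if_neg (by simp [h])] at h5
      have := hform i
      rw [cen_true h] at this
      have h7 : 0 ≤ (gau G y)⁻¹ * (1 - y i) := mul_nonneg hpi.le (by linarith)
      constructor
      · linarith
      · rw [this]; linarith
  refine mem_real.mpr ⟨hin, carr (radr G y), ⟨⟨H, hH, hGH, ?_⟩, ?_⟩, le_refl _⟩
  · refine carr_le.mpr fun i => ⟨fun h => ?_, fun h => ?_⟩
    · have h5 : G i = some false := by
        rcases hGH i with h' | h'
        · rw [h] at h'; simp at h'
        · rw [h', h]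
      rw [hform, cen_false h5, (h3 i).1 h]; ring
    · have h5 : G i = some true := by
        rcases hGH i with h' | h'
        · rw [h] at h'; simp at h'
        · rw [h', h]
      rw [hform, cen_true h5, (h3 i).2 h]; ring
  · intro hcon
    obtain ⟨i, hi⟩ := hex
    have h5 := le_carr.mp hcon i
    have h6 := hin i
    simp only [wt] at hi
    rcases opt_cases (G i) with h | h | h
    · rw [cen_none h, if_pos h, le_abs] at hi
      rcases hi with hi | hi
      · have := h5.2 (by linarith)
        rw [h] at this; simp at this
      · have := h5.1 (by linarith)
        rw [h] at this; simp at this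
    · rw [cen_false h, if_neg (by simp [h]), le_abs] at hi
      rcases hi with hi | hi
      · have := h5.2 (by linarith)
        rw [h] at this; simp at this
      · linarith
    · rw [cen_true h, if_neg (by simp [h]), le_abs] at hi
      rcases hi with hi | hi
      · linarith
      · have := h5.1 (by linarith)
        rw [h] at this; simp at this

lemma radr_scale {G : CubeFace a} {w : Fin a → ℝ} (hw : gau G w = 1) {t : ℝ} (ht : 0 < t) :
    radr G (cen G + t • (w - cen G)) = w := by
  rw [radr, gau_scale _ _ ht.le, hw, mul_one, add_sub_cancel_left, smul_smul,
    inv_mul_cancel₀ ht.ne', one_smul, add_sub_cancel]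

lemma cen_ne_link {G : CubeFace a} {w : Fin a → ℝ}
    (hw : gau G w = 1) : w ≠ cen G := by
  rintro rfl
  simp [gau] at hw
  have : (fun i : Fin a => (0 : ℝ)) = 0 := rfl
  rw [this, norm_zero] at hw
  exact zero_ne_one hw

lemma gau_le_one {G : CubeFace a} {y : Fin a → ℝ}
    (h1 : inC y) : gau G y ≤ 1 := by
  unfold gau
  rw [pi_norm_le_iff_of_nonneg (by norm_num)]
  intro i
  have := h1 i
  rw [Real.norm_eq_abs, abs_le]
  simp only [wt]
  rcases opt_cases (G i) with h | h | h
  · rw [cen_none h, if_pos h]; constructor <;> linarith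
  · rw [cen_false h, if_neg (by simp [h])]; constructor <;> linarith
  · rw [cen_true h, if_neg (by simp [h])]; constructor <;> linarith

lemma St_starConvex (M : Set (CubeFace a)) (G : CubeFace a) :
    StarConvex ℝ (cen G) (CubeFace.real (St M G)) := by
  intro y hy s t hs ht hst
  obtain ⟨h1, F, ⟨H, hH, hGH, hFH⟩, h2⟩ := mem_real.mp hy
  have h3 := carr_le.mp (h2.trans hFH)
  refine mem_real.mpr ⟨fun i => ?_, H, ⟨H, hH, hGH, le_refl _⟩, carr_le.mpr fun i => ?_⟩
  · have h1 := cen_bd G i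
    have h2 := h1
    have h4 := (mem_real.mp hy).1 i
    simp only [Pi.add_apply, Pi.smul_apply, smul_eq_mul]
    constructor
    · nlinarith
    · nlinarith
  · simp only [Pi.add_apply, Pi.smul_apply, smul_eq_mul]
    refine ⟨fun h => ?_, fun h => ?_⟩
    · have h5 : G i = some false := by
        rcases hGH i with h' | h'
        · rw [h] at h'; simp at h'
        · rw [h', h]
      rw [cen_false h5, (h3 i).1 h]; ring
    · have h5 : G i = some true := by
        rcases hGH i with h' | h'
        · rw [h] at h'; simp at h'
        · rw [h', h]
      rw [cen_true h5, (h3 i).2 h]; linarith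

lemma real_Lk_St {M : Set (CubeFace a)} {G : CubeFace a} {w : Fin a → ℝ}
    (hw : w ∈ CubeFace.real (Lk M G)) : w ∈ CubeFace.real (St M G) := by
  obtain ⟨h1, F, hF, h2⟩ := mem_real.mp hw
  exact mem_real.mpr ⟨h1, F, hF.1, h2⟩

/-- The carrier on a punctured star. -/
lemma link_carrier (M : Set (CubeFace a)) (G : CubeFace a) :
    Carrier (CubeFace.real (St M G) \ {cen G}) (Lk M G)
      (fun y => carr (radr G (y : Fin a → ℝ))) := by
  have hcenr : ∀ w, gau G w = 1 → radr G w = w := by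
    intro w hw
    have := radr_scale hw one_pos
    rwa [one_smul, add_sub_cancel] at this
  refine carrier_of_retr (Lk_down M G) (radr G) ?_ (fun y hy => radr_mem hy.1 hy.2) ?_ ?_
  · unfold radr
    have h1 : ContinuousOn (fun y => (gau G y)⁻¹) (CubeFace.real (St M G) \ {cen G}) :=
      ContinuousOn.inv₀ (gau_cont G).continuousOn (fun y hy => (gau_pos hy.2).ne')
    have h2 : ContinuousOn (fun y : Fin a → ℝ => y - cen G) (CubeFace.real (St M G) \ {cen G}) :=
      (continuous_id.sub continuous_const).continuousOn
    exact continuousOn_const.add (h1.smul h2)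
  · intro L hL
    have h1 := cen_mem hL
    have h2 := gau_link h1
    refine ⟨⟨real_Lk_St h1, cen_ne_link h2⟩, ?_⟩
    rw [hcenr _ h2, carr_cen]
  · intro L hL y hy hLy s t hs ht hst
    have hz := radr_mem hy.1 hy.2
    set z := radr G y with hzdef
    have hp := gau_pos hy.2
    have hyz : y = cen G + gau G y • (z - cen G) := by
      rw [hzdef, radr, add_sub_cancel_left, smul_smul, mul_inv_cancel₀ hp.ne', one_smul,
        add_sub_cancel]
    have hg1 : gau G y ≤ 1 := gau_le_one (mem_real.mp hy.1).1
    set g := gau G y with hgdef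
    have hτ : 0 < s + t * g := by
      rcases hs.eq_or_lt with h | h
      · have : t = 1 := by linarith
        rw [this, ← h]; linarith
      · have := mul_nonneg ht hp.le
        linarith
    have hτ1 : s + t * g ≤ 1 := by nlinarith
    obtain ⟨hzc, F, hF, hzF⟩ := mem_real.mp hz
    obtain ⟨h3, h4, h5⟩ := comb_carr (s := s / (s + t * g)) (t := t * g / (s + t * g)) hzc hLy
      (div_nonneg hs hτ.le) (div_nonneg (mul_nonneg ht hp.le) hτ.le) (by field_simp)
    set w := (s / (s + t * g)) • cen L + (t * g / (s + t * g)) • z with hw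
    have hwm : w ∈ CubeFace.real (Lk M G) := mem_real.mpr ⟨h3, F, hF, h5.trans hzF⟩
    have hgw := gau_link hwm
    have hy' : s • cen L + t • y = cen G + (s + t * g) • (w - cen G) := by
      rw [hyz, hw]
      funext i
      simp only [Pi.add_apply, Pi.smul_apply, Pi.sub_apply, smul_eq_mul]
      have : t = 1 - s := by linarith
      subst this
      field_simp
      ring
    rw [hy', radr_scale hgw hτ]
    refine ⟨⟨?_, ?_⟩, h4⟩
    · have := St_starConvex M G (real_Lk_St hwm) (sub_nonneg.mpr hτ1) hτ.le (by ring)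
      convert this using 1
      module
    · intro h
      have h6 := gau_scale G w hτ.le
      rw [Set.mem_singleton_iff.mp h, hgw] at h6
      have h7 : gau G (cen G) = 0 := by
        simp [gau]
        rfl
      linarith

end

end CubMan

/-! ## Local homology -/

namespace CubMan

open CubeFace

section
variable {X Y : Type} [TopologicalSpace X] [TopologicalSpace Y]

lemma psh_apply {n : ℕ} {f : C(X, Y)} (hf : Function.Injective f) (c : Ch n X) (σ : Sx n X) :
    psh f c (f.comp σ) = c σ := by
  classical
  have hinj : Function.Injective (fun σ : Sx n X => f.comp σ) := by
    intro σ τ h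
    ext1 x
    exact hf (DFunLike.congr_fun h x)
  have : psh f c = Finsupp.mapDomain (fun σ : Sx n X => f.comp σ) c := by
    rw [psh, Finsupp.linearCombination_apply, Finsupp.mapDomain]
    refine Finsupp.sum_congr (fun σ _ => ?_)
    simp
  rw [this]
  exact Finsupp.mapDomain_apply hinj c σ

lemma psh_inj {n : ℕ} {f : C(X, Y)} (hf : Function.Injective f) {c : Ch n X} (h : psh f c = 0) :
    c = 0 := by
  ext σ
  rw [← psh_apply hf, h]
  rfl

lemma inS_of_psh {n : ℕ} {f : C(X, Y)} (hf : Function.Injective f) {c : Ch n X} {A : Set X}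
    {B : Set Y} (hAB : ∀ x, f x ∈ B → x ∈ A) (h : psh f c ∈ inS B) : c ∈ inS A := by
  intro σ hσ x
  apply hAB
  have : f.comp σ ∈ (psh f c).support := by
    rw [Finsupp.mem_support_iff, psh_apply hf]
    exact Finsupp.mem_support_iff.mp hσ
  exact h this x

lemma lift_inS {n : ℕ} {f : C(X, Y)} (hf : Topology.IsEmbedding f) {c : Ch n Y}
    (hc : c ∈ inS (Set.range f)) : ∃ c', psh f c' = c := by
  have : c ∈ LinearMap.range (psh (n := n) f) := by
    refine lin_maps LinearMap.id _ _ (fun σ hσ => ?_) c hc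
    choose g hg using hσ
    refine ⟨Finsupp.single ⟨g, ?_⟩ 1, ?_⟩
    · rw [hf.continuous_iff]
      have : f ∘ g = σ := funext hg
      rw [this]
      exact σ.continuous
    · rw [psh_single]
      congr 1
      ext1 x
      exact hg x
  exact this

lemma inS_mono {n : ℕ} {A B : Set X} (h : A ⊆ B) {c : Ch n X} (hc : c ∈ inS A) : c ∈ inS B :=
  fun _ hσ x => h (hc hσ x)

lemma Sd_iter_inS {n : ℕ} {A : Set X} (m : ℕ) {c : Ch n X} (hc : c ∈ inS A) :
    (Sd^[m]) c ∈ inS A := by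
  induction m with
  | zero => exact hc
  | succ m ih =>
    rw [Function.iterate_succ_apply']
    exact nop_inS _ ih

lemma bd_Sd_iter {n : ℕ} (m : ℕ) (c : Ch (n + 1) X) : bd ((Sd^[m]) c) = (Sd^[m]) (bd c) := by
  induction m with
  | zero => rfl
  | succ m ih => rw [Function.iterate_succ_apply', Function.iterate_succ_apply', bd_Sd, ih]

lemma Sd_htpy {n : ℕ} {A : Set X} (m : ℕ) (c : Ch (n + 1) X) (hc : bd c ∈ inS A) :
    ∃ e, c + (Sd^[m]) c + bd e ∈ inS A := by
  induction m with
  | zero =>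
    refine ⟨0, ?_⟩
    have : c + (Sd^[0]) c + bd (0 : Ch (n + 2) X) = 0 := by
      rw [map_zero, add_zero]; exact two_smul_zero c
    rw [this]
    exact Submodule.zero_mem _
  | succ m ih =>
    obtain ⟨e, he⟩ := ih
    refine ⟨e + Ht ((Sd^[m]) c), ?_⟩
    have h1 : Ht (bd ((Sd^[m]) c)) ∈ inS A := by
      rw [bd_Sd_iter]
      exact nop_inS _ (Sd_iter_inS m hc)
    have := Submodule.add_mem _ he h1
    convert this using 1
    rw [map_add, bd_Ht, Function.iterate_succ_apply']
    linear_combination (norm := module) two_smul_zero (Sd ((Sd^[m]) c))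

/-- Splitting small chains. -/
lemma sm_split {n : ℕ} (A B : Set X) {c : Ch n X}
    (hc : c ∈ sm (fun b : Bool => if b then A else B)) :
    ∃ c1 ∈ inS A, ∃ c2 ∈ inS B, c = c1 + c2 := by
  have : c ∈ (inS A ⊔ inS B : Submodule (ZMod 2) (Ch n X)) := by
    refine lin_maps LinearMap.id _ _ (fun σ hσ => ?_) c hc
    obtain ⟨b, hb⟩ := hσ
    rcases b with _ | _
    · exact Submodule.mem_sup_right (inS_single (by simpa using hb))
    · exact Submodule.mem_sup_left (inS_single (by simpa using hb))
  obtain ⟨c1, h1, c2, h2, h⟩ := Submodule.mem_sup.mp this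
  exact ⟨c1, h1, c2, h2, h.symm⟩

/-- Local cycles. -/
def Zl (n : ℕ) (x : X) : Set (Ch (n + 1) X) := {c | bd c ∈ inS {x}ᶜ}

/-- Local boundaries. -/
def Bl (n : ℕ) (x : X) : Set (Ch (n + 1) X) := {c | ∃ e, c + bd e ∈ inS {x}ᶜ}

/-- Local boundaries as a submodule. -/
def BlS (n : ℕ) (x : X) : Submodule (ZMod 2) (Ch (n + 1) X) where
  carrier := Bl n x
  zero_mem' := ⟨0, by rw [map_zero, add_zero]; exact Submodule.zero_mem _⟩
  add_mem' := by
    rintro c c' ⟨e, he⟩ ⟨e', he'⟩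
    refine ⟨e + e', ?_⟩
    convert Submodule.add_mem _ he he' using 1
    rw [map_add]; abel
  smul_mem' := by
    rintro r c ⟨e, he⟩
    refine ⟨r • e, ?_⟩
    convert Submodule.smul_mem _ r he using 1
    rw [map_smul, smul_add]

/-- Excision for local homology. -/
lemma local_excision [T1Space Y] (f : C(X, Y)) (hf : Topology.IsOpenEmbedding f) (x : X) (n : ℕ) :
    HEquiv (Zl n x) (Bl n x) (Zl n (f x)) (Bl n (f x)) := by
  have hinj := hf.injective
  let U : Bool → Set Y := fun b => if b then Set.range f else {f x}ᶜ
  have hU : ∀ b, IsOpen (U b) := by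
    rintro (_ | _)
    · simpa [U] using isOpen_compl_singleton
    · simpa [U] using hf.isOpen_range
  have hcov : ∀ y, ∃ b, y ∈ U b := by
    intro y
    by_cases h : y = f x
    · exact ⟨true, by simp [U, h]⟩
    · exact ⟨false, by simp [U, h]⟩
  have hcompl : ∀ {n} {c : Ch n X}, c ∈ inS {x}ᶜ → psh f c ∈ inS {f x}ᶜ := by
    intro n c hc
    exact psh_inS f (A := {x}ᶜ) (B := {f x}ᶜ) (fun y hy h => hy (hinj h)) hc
  have hcompl' : ∀ {n} {c : Ch n X}, psh f c ∈ inS {f x}ᶜ → c ∈ inS {x}ᶜ := by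
    intro n c hc
    refine inS_of_psh (A := {x}ᶜ) (B := {f x}ᶜ) hinj (fun y hy h => hy ?_) hc
    rw [Set.mem_singleton_iff.mp h]
    rfl
  have hcarr : Bl n (f x) = (BlS n (f x) : Set (Ch (n + 1) Y)) := rfl
  rw [hcarr]
  refine HEquiv.of_map (BlS n (f x)) (psh f) ?_ ?_ ?_ ?_ ?_
  · intro c hc c' hc'
    simp only [Zl, Set.mem_ofPred_eq] at *
    rw [map_add]; exact Submodule.add_mem _ hc hc'
  · intro c hc c' hc'
    simp only [Zl, Set.mem_ofPred_eq] at *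
    rw [map_add]; exact Submodule.add_mem _ hc hc'
  · intro c hc
    simp only [Zl, Set.mem_ofPred_eq] at *
    rw [bd_psh]
    exact hcompl hc
  · intro c hc
    constructor
    · rintro ⟨e, he⟩
      obtain ⟨m, hm⟩ := Sd_small U hU ⟨true⟩ hcov e
      obtain ⟨e1, he1, e2, he2, hee⟩ := sm_split _ _ hm
      obtain ⟨e1', rfl⟩ := lift_inS hf.isEmbedding he1
      obtain ⟨e3, he3⟩ := Sd_htpy m c hc
      refine ⟨e1' + e3, ?_⟩
      have h1 : (Sd^[m]) c + bd e1' ∈ inS {x}ᶜ := by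
        apply hcompl'
        have h2 := Sd_iter_inS m he
        obtain ⟨F, hF⟩ := Sd_iter_linear (X := Y) (n := n + 1) m
        rw [hF, map_add, ← hF, ← hF, ← bd_Sd_iter, hee, Sd_iter_psh, map_add] at h2
        rw [map_add, ← bd_psh]
        convert Submodule.add_mem _ h2 (bd_inS he2) using 1
        linear_combination (norm := module) - two_smul_zero (bd e2)
      convert Submodule.add_mem _ h1 he3 using 1
      rw [map_add]
      linear_combination (norm := module) - two_smul_zero ((Sd^[m]) c)
    · rintro ⟨e, he⟩
      refine ⟨psh f e, ?_⟩
      rw [bd_psh, ← map_add]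
      exact hcompl he
  · intro b hb
    obtain ⟨m, hm⟩ := Sd_small U hU ⟨true⟩ hcov b
    obtain ⟨b1, hb1, b2, hb2, hbb⟩ := sm_split _ _ hm
    obtain ⟨b1', rfl⟩ := lift_inS hf.isEmbedding hb1
    obtain ⟨e3, he3⟩ := Sd_htpy m b hb
    refine ⟨b1', ?_, e3, ?_⟩
    · apply hcompl'
      have h2 : (Sd^[m]) (bd b) ∈ inS {f x}ᶜ := Sd_iter_inS m hb
      rw [← bd_Sd_iter, hbb, map_add] at h2
      rw [← bd_psh]
      convert Submodule.add_mem _ h2 (bd_inS hb2) using 1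
      linear_combination (norm := module) - two_smul_zero (bd b2)
    · rw [hbb] at he3
      convert Submodule.add_mem _ he3 hb2 using 1
      linear_combination (norm := module) - two_smul_zero b2

end

section
variable {E : Type} [NormedAddCommGroup E] [NormedSpace ℝ E]

/-- The connecting isomorphism for a star-convex set. -/
lemma local_conn {T : Set E} {x : E} (hT : StarConvex ℝ x T) (hx : x ∈ T) (n : ℕ) :
    HEquiv (Zl (n + 1) (⟨x, hx⟩ : T)) (Bl (n + 1) (⟨x, hx⟩ : T))
      {c : Ch (n + 1) ↥(T \ {x}) | bd c = 0} {c | ∃ e : Ch (n + 2) ↥(T \ {x}), bd e = c} := by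
  let j : C(↥(T \ {x}), T) := ⟨Set.inclusion Set.sdiff_subset, continuous_inclusion Set.sdiff_subset⟩
  have hj : Topology.IsEmbedding j := Topology.IsEmbedding.inclusion Set.sdiff_subset
  have hinj := hj.injective
  have hr : Set.range j = {(⟨x, hx⟩ : T)}ᶜ := by
    ext y
    constructor
    · rintro ⟨z, rfl⟩ h
      exact z.2.2 (congrArg Subtype.val h)
    · intro h
      exact ⟨⟨y, y.2, fun h' => h (Subtype.ext h')⟩, rfl⟩
  have hj0 : ∀ {n} (c : Ch n ↥(T \ {x})), psh j c ∈ inS {(⟨x, hx⟩ : T)}ᶜ := by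
    intro n c
    rw [← hr]
    exact psh_inS j (fun y _ => ⟨y, rfl⟩) (inS_univ c)
  have htr : ∀ {n} (c : Ch n T), c ∈ inS (tr T T) := fun c σ _ y => (σ y).2
  refine ⟨fun c c' => bd c = psh j c' ∧ bd c' = 0, ?_, ?_, ?_, ?_, ?_⟩
  · rintro c c' ⟨h1, h2⟩
    refine ⟨?_, h2⟩
    simp only [Zl, Set.mem_ofPred_eq]
    rw [h1]
    exact hj0 c'
  · intro c hc
    simp only [Zl, Set.mem_ofPred_eq] at hc
    rw [← hr] at hc
    obtain ⟨c', hc'⟩ := lift_inS hj hc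
    refine ⟨c', hc'.symm, psh_inj hinj ?_⟩
    rw [← bd_psh, hc', bd_bd]
  · intro c' hc'
    obtain ⟨e, -, he⟩ := star_acyclic hT hx (le_refl _) (psh j c') (htr _)
      (by rw [bd_psh, hc', map_zero])
    exact ⟨e, he, hc'⟩
  · rintro c c' d d' ⟨h1, h2⟩ ⟨h3, h4⟩
    exact ⟨by rw [map_add, map_add, h1, h3], by rw [map_add, h2, h4, add_zero]⟩
  · rintro c c' ⟨h1, h2⟩
    constructor
    · rintro ⟨e, he⟩
      rw [← hr] at he
      obtain ⟨e', he'⟩ := lift_inS hj he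
      refine ⟨e', eq_of_add_zero (psh_inj hinj ?_)⟩
      rw [map_add, ← h1, ← bd_psh, he', map_add, bd_bd, add_zero]
      exact two_smul_zero _
    · rintro ⟨e', rfl⟩
      obtain ⟨e, -, he⟩ := star_acyclic hT hx (le_refl _) (c + psh j e') (htr _)
        (by rw [map_add, h1, bd_psh]; exact two_smul_zero _)
      refine ⟨e, ?_⟩
      convert hj0 e' using 1
      rw [he]
      linear_combination (norm := module) two_smul_zero c

end

end CubMan

/-! ## Local homology of cubical manifolds -/

namespace CubMan

open CubeFace

section
variable {a : ℕ}

/-- Relative cellular cycles of the star. -/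
def ZR (M : Set (CubeFace a)) (G : CubeFace a) (n : ℕ) : Set (AF a → ZMod 2) :=
  {c | (∀ F, c F ≠ 0 → rk F = n ∧ inK (St M G) F) ∧ ∀ F, cb c F ≠ 0 → inK (Lk M G) F}

/-- Relative cellular boundaries of the star. -/
def BR (M : Set (CubeFace a)) (G : CubeFace a) (n : ℕ) : Set (AF a → ZMod 2) :=
  {c | ∃ e : AF a → ZMod 2, (∀ F, e F ≠ 0 → rk F = n + 1 ∧ inK (St M G) F) ∧
    ∀ F, (c + cb e) F ≠ 0 → inK (Lk M G) F}

lemma add_ne {V W : Type} [AddCommGroup W] {c c' : V → W} {F : V} (h : (c + c') F ≠ 0) :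
    c F ≠ 0 ∨ c' F ≠ 0 := by
  by_contra! h0
  exact h (by rw [Pi.add_apply, h0.1, h0.2, add_zero])

lemma Lk_St {M : Set (CubeFace a)} {G : CubeFace a} {F : AF a} (h : inK (Lk M G) F) :
    inK (St M G) F := by
  rcases F with _ | F
  · trivial
  · exact h.1

lemma St_acyclic {M : Set (CubeFace a)} {G : CubeFace a} (hG : G ∈ M) (n : ℕ) :
    CZ (St M G) (n + 1) ⊆ CB (St M G) (n + 1) := by
  refine (carrier_thm (real_carrier (St_down M G)) n).van ?_
  intro c hc
  obtain ⟨e, -, he⟩ := star_acyclic (St_starConvex M G)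
    (cen_mem (K := St M G) ⟨G, hG, le_refl _, le_refl _⟩) (le_refl _) c (fun σ _ y => (σ y).2) hc
  exact ⟨e, he⟩

lemma cb_add {V : Type} [AddCommGroup V] [Module (ZMod 2) V] (c c' : AF a → V) :
    cb (c + c') = cb c + cb c' := map_add _ _ _

lemma rel_conn {M : Set (CubeFace a)} {G : CubeFace a} (hG : G ∈ M) (n : ℕ) :
    HEquiv (ZR M G (n + 2)) (BR M G (n + 2)) (CZ (Lk M G) (n + 1)) (CB (Lk M G) (n + 1)) := by
  refine ⟨fun c c' => c ∈ ZR M G (n + 2) ∧ c' = cb c, ?_, ?_, ?_, ?_, ?_⟩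
  · rintro c _ ⟨h, rfl⟩
    exact ⟨h, fun F hF => ⟨cb_rank (fun F hF => (h.1 F hF).1) F hF, h.2 F hF⟩, cb_cb c⟩
  · intro c hc
    exact ⟨_, hc, rfl⟩
  · rintro c' ⟨h1, h2⟩
    obtain ⟨e, he, rfl⟩ := St_acyclic hG n ⟨fun F hF => ⟨(h1 F hF).1, Lk_St (h1 F hF).2⟩, h2⟩
    exact ⟨e, ⟨he, fun F hF => (h1 F hF).2⟩, rfl⟩
  · rintro c _ d _ ⟨h, rfl⟩ ⟨h', rfl⟩
    refine ⟨⟨fun F hF => ?_, fun F hF => ?_⟩, (cb_add c d).symm⟩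
    · rcases add_ne hF with h1 | h1
      · exact h.1 F h1
      · exact h'.1 F h1
    · rw [cb_add] at hF
      rcases add_ne hF with h1 | h1
      · exact h.2 F h1
      · exact h'.2 F h1
  · rintro c _ ⟨h, rfl⟩
    constructor
    · rintro ⟨e, he, hl⟩
      refine ⟨c + cb e, fun F hF => ⟨?_, hl F hF⟩, ?_⟩
      · rcases add_ne hF with h1 | h1
        · exact (h.1 F h1).1
        · exact cb_rank (p := n + 2) (fun F hF => (he F hF).1) F h1
      · rw [cb_add, cb_cb, add_zero]
    · rintro ⟨w, hw, hwc⟩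
      have : c + w ∈ CZ (St M G) (n + 1 + 1) := by
        refine ⟨fun F hF => ?_, ?_⟩
        · rcases add_ne hF with h1 | h1
          · exact h.1 F h1
          · exact ⟨(hw F h1).1, Lk_St (hw F h1).2⟩
        · rw [cb_add, hwc]; exact two_smul_zero _
      obtain ⟨e, he, hec⟩ := St_acyclic hG (n + 1) this
      refine ⟨e, he, fun F hF => ?_⟩
      have h3 : c + cb e = w := by
        rw [hec]
        linear_combination (norm := module) two_smul_zero c
      rw [h3] at hF
      exact (hw F hF).2

lemma cenSt {M : Set (CubeFace a)} {G : CubeFace a} (hG : G ∈ M) : cen G ∈ CubeFace.real (St M G) :=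
  cen_mem (K := St M G) ⟨G, hG, le_refl _, le_refl _⟩

lemma local_cell {M : Set (CubeFace a)} {G : CubeFace a} (hG : G ∈ M) (n : ℕ) :
    HEquiv (Zl (n + 1) (⟨cen G, cenSt hG⟩ : CubeFace.real (St M G)))
      (Bl (n + 1) (⟨cen G, cenSt hG⟩ : CubeFace.real (St M G)))
      (ZR M G (n + 2)) (BR M G (n + 2)) :=
  ((local_conn (St_starConvex M G) (cenSt hG) n).trans (carrier_thm (link_carrier M G) n)).trans
    (rel_conn hG n).symm

lemma openEmb_of_comp {X Y Z : Type} [TopologicalSpace X] [TopologicalSpace Y] [TopologicalSpace Z]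
    {f : X → Y} {i : Y → Z} (hi : Function.Injective i) (hic : Continuous i) (hf : Continuous f)
    (h : Topology.IsOpenEmbedding (i ∘ f)) : Topology.IsOpenEmbedding f := by
  refine Topology.IsOpenEmbedding.of_continuous_injective_isOpenMap hf h.injective.of_comp ?_
  intro V hV
  have : f '' V = i ⁻¹' ((i ∘ f) '' V) := by
    rw [Set.image_comp, Set.preimage_image_eq _ hi]
  rw [this]
  exact (h.isOpenMap V hV).preimage hic

/-- The top face. -/
def topF (d : ℕ) : CubeFace d := fun _ => none

lemma le_topF {d : ℕ} (F : CubeFace d) : F ≤ topF d := fun _ => Or.inl rfl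

lemma manifold_local {M : Set (CubeFace a)} (hM : IsSubcomplex M) {d : ℕ}
    (hman : IsCompactManifold (CubeFace.real M) d) {G : CubeFace a} (hG : G ∈ M) (n : ℕ) :
    HEquiv (ZR M G (n + 2)) (BR M G (n + 2))
      (ZR Set.univ (topF d) (n + 2)) (BR Set.univ (topF d) (n + 2)) := by
  obtain ⟨-, ⟨hch⟩⟩ := hman
  let x : CubeFace.real M := ⟨cen G, cen_mem hG⟩
  let φ := chartAt (EuclideanSpace ℝ (Fin d)) x
  let U : Set (CubeFace.real M) := φ.source ∩ φ ⁻¹' (Metric.ball (φ x) (1 / 2)) ∩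
    {y | G ≤ carr (y : Fin a → ℝ)}
  have hU : IsOpen U := by
    refine IsOpen.inter (φ.isOpen_inter_preimage Metric.isOpen_ball) ?_
    exact (isOpen_le_carr G).preimage continuous_subtype_val
  have hxU : x ∈ U := by
    refine ⟨⟨mem_chart_source _ x, ?_⟩, ?_⟩
    · simp
    · simp only [Set.mem_ofPred_eq, x]
      rw [carr_cen]
  let f1 : C(U, CubeFace.real (St M G)) :=
    ⟨fun y => ⟨(y : CubeFace.real M), by
      obtain ⟨h1, F, hF, h2⟩ := mem_real.mp y.1.2
      exact mem_real.mpr ⟨h1, carr _, ⟨carr _, hM.2 F hF _ h2, y.2.2, le_refl _⟩, le_refl _⟩⟩,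
      by fun_prop⟩
  have hSM : ∀ y : CubeFace.real (St M G), (y : Fin a → ℝ) ∈ CubeFace.real M := by
    intro y
    obtain ⟨h1, F, ⟨H, hH, -, hFH⟩, h2⟩ := mem_real.mp y.2
    exact mem_real.mpr ⟨h1, H, hH, h2.trans hFH⟩
  have hf1 : Topology.IsOpenEmbedding f1 := by
    refine openEmb_of_comp (i := fun y => (⟨y, hSM y⟩ : CubeFace.real M)) ?_ ?_ f1.continuous ?_
    · intro y z h
      exact Subtype.ext (congrArg (fun w : CubeFace.real M => (w : Fin a → ℝ)) h)
    · fun_prop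
    · exact hU.isOpenEmbedding_subtypeVal
  let g2 : U → (Fin d → ℝ) := fun y j => φ y j - φ x j + 1 / 2
  have hφU : Topology.IsOpenEmbedding (fun y : U => φ y) := by
    have h1 : Topology.IsOpenEmbedding
        (Set.inclusion (fun y hy => hy.1.1 : U ⊆ φ.source)) := by
      refine openEmb_of_comp (i := Subtype.val) Subtype.val_injective continuous_subtype_val
        (continuous_inclusion _) ?_
      exact hU.isOpenEmbedding_subtypeVal
    exact φ.isOpenEmbedding_restrict.comp h1
  have hg2 : Topology.IsOpenEmbedding g2 := by
    have h2 : Topology.IsOpenEmbedding (fun v : EuclideanSpace ℝ (Fin d) => fun j => v j - φ x j + 1 / 2) := by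
      have h3 := ((EuclideanSpace.equiv (Fin d) ℝ).toHomeomorph.trans
        (Homeomorph.addRight (fun j => - φ x j + 1 / 2))).isOpenEmbedding
      convert h3 using 1
      funext v j
      simp [sub_eq_add_neg, add_assoc]
    exact h2.comp hφU
  have hg2in : ∀ y, g2 y ∈ CubeFace.real (St Set.univ (topF d)) := by
    intro y
    refine mem_real.mpr ⟨fun j => ?_, topF d, ⟨topF d, trivial, le_refl _, le_refl _⟩, le_topF _⟩
    have h1 : ‖φ y - φ x‖ < 1 / 2 := by
      have := y.2.1.2
      rwa [Set.mem_preimage, Metric.mem_ball, dist_eq_norm] at this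
    have h2 := (PiLp.norm_apply_le (φ y - φ x) j).trans_lt h1
    rw [Real.norm_eq_abs, abs_lt] at h2
    simp only [PiLp.sub_apply] at h2
    simp only [g2]
    constructor <;> linarith
  let f2 : C(U, CubeFace.real (St Set.univ (topF d))) :=
    ⟨fun y => ⟨g2 y, hg2in y⟩, hg2.continuous.subtype_mk _⟩
  have hf2 : Topology.IsOpenEmbedding f2 :=
    openEmb_of_comp (i := Subtype.val) Subtype.val_injective continuous_subtype_val f2.continuous hg2
  have e1 := local_excision f1 hf1 ⟨x, hxU⟩ (n + 1)
  have e2 := local_excision f2 hf2 ⟨x, hxU⟩ (n + 1)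
  have e3 := local_cell hG n
  have e4 := local_cell (M := Set.univ) (G := topF d) trivial n
  have x1 : f1 ⟨x, hxU⟩ = ⟨cen G, cenSt hG⟩ := rfl
  have x2 : f2 ⟨x, hxU⟩ = ⟨cen (topF d), cenSt trivial⟩ := by
    apply Subtype.ext
    funext j
    simp [f2, g2, cen, topF]
  rw [x1] at e1
  rw [x2] at e2
  exact ((e3.symm.trans e1.symm).trans e2).trans e4

lemma dim_topF (d : ℕ) : dim (topF d) = d := by
  rw [dim_eq]
  simp [topF]

lemma dim_le (F : CubeFace a) : dim F ≤ a := by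
  rw [dim_eq]
  exact (Finset.card_le_univ _).trans (by simp)

lemma top_mem_Lk {d : ℕ} {F : CubeFace d} (h : dim F ≠ d) : F ∈ Lk Set.univ (topF d) := by
  refine ⟨⟨topF d, trivial, le_refl _, le_topF F⟩, fun h1 => h ?_⟩
  rw [le_antisymm (le_topF F) h1, dim_topF]

lemma dim_eq_top {d : ℕ} {F : CubeFace d} (h : dim F = d) : F = topF d :=
  eq_of_le_dim (le_topF F) (by rw [dim_topF, h])

lemma local_van {M : Set (CubeFace a)} (hM : IsSubcomplex M) {d : ℕ}
    (hman : IsCompactManifold (CubeFace.real M) d) {G : CubeFace a} (hG : G ∈ M) (n : ℕ)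
    (hn : n + 1 ≠ d) : ZR M G (n + 2) ⊆ BR M G (n + 2) := by
  refine (manifold_local hM hman hG n).symm.van ?_
  intro c hc
  refine ⟨0, fun F hF => absurd rfl hF, fun F hF => ?_⟩
  rw [show cb (0 : AF d → ZMod 2) = 0 from map_zero _, add_zero] at hF
  rcases F with _ | F
  · trivial
  · have h1 := (hc.1 _ hF).1
    simp only [rk] at h1
    exact top_mem_Lk (by omega)

lemma local_one {M : Set (CubeFace a)} (hM : IsSubcomplex M) {d : ℕ}
    (hman : IsCompactManifold (CubeFace.real M) d) {G : CubeFace a} (hG : G ∈ M) (n : ℕ)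
    (hn : n + 1 = d) : OneDim (ZR M G (n + 2)) (BR M G (n + 2)) := by
  refine (manifold_local hM hman hG n).symm.oneDim ?_
  have hB : ∀ c : AF d → ZMod 2, c ∈ BR Set.univ (topF d) (n + 2) ↔
      ∀ F, c F ≠ 0 → inK (Lk Set.univ (topF d)) F := by
    intro c
    constructor
    · rintro ⟨e, he, h⟩
      have : e = 0 := by
        funext F
        by_contra h0
        have h1 := (he F h0).1
        rcases F with _ | F
        · simp [rk] at h1
        · simp only [rk] at h1
          have := dim_le F
          omega
      subst this
      rw [show cb (0 : AF d → ZMod 2) = 0 from map_zero _, add_zero] at h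
      exact h
    · intro h
      refine ⟨0, fun F hF => absurd rfl hF, ?_⟩
      rw [show cb (0 : AF d → ZMod 2) = 0 from map_zero _, add_zero]
      exact h
  have hnot : topF d ∉ Lk Set.univ (topF d) := fun h => h.2 (le_refl _)
  have hSt : ∀ F : AF d, inK (St Set.univ (topF d)) F := by
    rintro (_ | F)
    · trivial
    · exact ⟨topF d, trivial, le_refl _, le_topF F⟩
  have hval : ∀ c ∈ ZR Set.univ (topF d) (n + 2), c ∉ BR Set.univ (topF d) (n + 2) →
      c (some (topF d)) ≠ 0 := by
    intro c hc hcB h0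
    apply hcB
    rw [hB]
    intro F hF
    rcases F with _ | F
    · trivial
    · apply top_mem_Lk
      intro h1
      rw [dim_eq_top h1] at hF
      exact hF h0
  have hz2 : ∀ x y : ZMod 2, x ≠ 0 → y ≠ 0 → x + y = 0 := by decide
  refine ⟨⟨Pi.single (some (topF d)) 1, ⟨fun F hF => ⟨?_, hSt F⟩, fun F hF => ?_⟩, ?_⟩, ?_⟩
  · have : F = some (topF d) := by
      by_contra h; exact hF (Pi.single_eq_of_ne h _)
    subst this
    simp only [rk, dim_topF]; omega
  · rcases F with _ | F
    · trivial
    · apply top_mem_Lk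
      intro h1
      have h2 := cb_rank (p := n + 1) (x := Pi.single (some (topF d)) (1 : ZMod 2)) ?_ _ hF
      · simp only [rk] at h2; omega
      · intro F hF
        have : F = some (topF d) := by
          by_contra h; exact hF (Pi.single_eq_of_ne h _)
        subst this
        simp only [rk, dim_topF]; omega
  · rw [hB]
    intro h
    exact hnot (h (some (topF d)) (by simp))
  · intro z hz z' hz' h h'
    rw [hB]
    intro F hF
    rcases F with _ | F
    · trivial
    · apply top_mem_Lk
      intro h1
      rw [dim_eq_top h1] at hF
      exact hF (hz2 _ _ (hval z hz h) (hval z' hz' h'))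

end

end CubMan

/-! ## Cochains and dual local exactness -/

namespace CubMan

open CubeFace

section
variable {a : ℕ}

/-- Cellular boundary without augmentation. -/
def bdc (c : CubeFace a → ZMod 2) (F : CubeFace a) : ZMod 2 :=
  ∑ i, if F i = none then 0 else c (upd F i none)

/-- Cellular coboundary. -/
def dl (φ : CubeFace a → ZMod 2) (F : CubeFace a) : ZMod 2 :=
  ∑ i, if F i = none then ∑ b : Bool, φ (upd F i (some b)) else 0

/-- Extension by zero to the empty face. -/
def exA (c : CubeFace a → ZMod 2) : AF a → ZMod 2
  | none => 0
  | some F => c F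

lemma cb_exA (c : CubeFace a → ZMod 2) (F : CubeFace a) : cb (exA c) (some F) = bdc c F := by
  rw [cb_some]; rfl

lemma cb_bdc (c : AF a → ZMod 2) (F : CubeFace a) : cb c (some F) = bdc (fun F => c (some F)) F := by
  rw [cb_some]; rfl

lemma bdc_bdc (c : CubeFace a → ZMod 2) (F : CubeFace a) : bdc (bdc c) F = 0 := by
  have h := congrFun (cb_cb (exA c)) (some F)
  rw [cb_bdc] at h
  simp only [cb_exA] at h
  exact h

lemma adj (c φ : CubeFace a → ZMod 2) : ∑ F, bdc c F * φ F = ∑ F, c F * dl φ F := by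
  classical
  simp only [bdc, dl, Finset.sum_mul, Finset.mul_sum]
  rw [Finset.sum_comm, Finset.sum_comm (s := Finset.univ (α := CubeFace a))]
  refine Finset.sum_congr rfl (fun i _ => ?_)
  have h1 : ∀ F : CubeFace a, ((if F i = none then 0 else c (upd F i none)) * φ F) =
      ∑ b : Bool, if F i = some b then c (upd F i none) * φ F else 0 := by
    intro F
    rcases opt_cases (F i) with h | h | h <;> simp [h]
  have h2 : ∀ F : CubeFace a, (c F * if F i = none then ∑ b : Bool, φ (upd F i (some b)) else 0) =
      ∑ b : Bool, if F i = none then c F * φ (upd F i (some b)) else 0 := by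
    intro F
    split_ifs
    · rw [Finset.mul_sum]
    · simp
  simp only [h1, h2]
  rw [Finset.sum_comm, Finset.sum_comm (s := Finset.univ (α := CubeFace a))]
  refine Finset.sum_congr rfl (fun b _ => ?_)
  rw [← Finset.sum_filter, ← Finset.sum_filter]
  refine Finset.sum_nbij' (fun F => upd F i none) (fun F => upd F i (some b)) ?_ ?_ ?_ ?_ ?_
  · intro F hF
    simp
  · intro F hF
    simp
  · intro F hF
    simp only [Finset.mem_filter] at hF
    rw [upd_upd, upd_eq_self _ _ hF.2]
  · intro F hF
    simp only [Finset.mem_filter] at hF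
    rw [upd_upd, upd_eq_self _ _ hF.2]
  · intro F hF
    simp only [Finset.mem_filter] at hF
    rw [upd_upd, upd_eq_self _ _ hF.2]

lemma dl_add (φ ψ : CubeFace a → ZMod 2) : dl (φ + ψ) = dl φ + dl ψ := by
  funext F
  simp only [dl, Pi.add_apply, ← Finset.sum_add_distrib]
  refine Finset.sum_congr rfl (fun i _ => ?_)
  split_ifs <;> simp [Finset.sum_add_distrib]

lemma dl_smul (r : ZMod 2) (φ : CubeFace a → ZMod 2) : dl (r • φ) = r • dl φ := by
  funext F
  simp only [dl, Pi.smul_apply, smul_eq_mul, Finset.mul_sum, mul_ite, mul_zero]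

/-- Coboundary as a linear map. -/
def dlL : (CubeFace a → ZMod 2) →ₗ[ZMod 2] (CubeFace a → ZMod 2) where
  toFun := dl
  map_add' := dl_add
  map_smul' := dl_smul

lemma bdc_add (φ ψ : CubeFace a → ZMod 2) : bdc (φ + ψ) = bdc φ + bdc ψ := by
  funext F
  simp only [bdc, Pi.add_apply, ← Finset.sum_add_distrib]
  refine Finset.sum_congr rfl (fun i _ => ?_)
  split_ifs <;> simp

lemma dl_dl (φ : CubeFace a → ZMod 2) (F : CubeFace a) : dl (dl φ) F = 0 := by
  classical
  have h := adj (Pi.single F 1) (dl φ)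
  rw [adj] at h
  have h2 : ∑ K, bdc (Pi.single F 1) K * dl φ K = ∑ K, bdc (bdc (Pi.single F 1)) K * φ K := (adj _ _).symm
  have h3 : ∑ K, (Pi.single F (1 : ZMod 2) : CubeFace a → ZMod 2) K * dl (dl φ) K = dl (dl φ) F := by
    rw [Finset.sum_eq_single F]
    · simp
    · intro K _ hK
      simp [hK]
    · simp
  rw [← h3, ← adj, h2]
  simp [bdc_bdc]

/-- Core duality lemma. -/
lemma core_dual (P Q : CubeFace a → Prop) (φ : CubeFace a → ZMod 2) (hφ : ∀ F, φ F ≠ 0 → P F)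
    (h : ∀ c : CubeFace a → ZMod 2, (∀ F, c F ≠ 0 → P F) → (∀ F, Q F → bdc c F = 0) →
      ∑ F, c F * φ F = 0) :
    ∃ ψ : CubeFace a → ZMod 2, (∀ F, ψ F ≠ 0 → Q F) ∧ ∀ F, P F → dl ψ F = φ F := by
  classical
  let res : (CubeFace a → ZMod 2) →ₗ[ZMod 2] (CubeFace a → ZMod 2) :=
    { toFun := fun f F => if P F then f F else 0
      map_add' := by intro f g; funext F; simp only [Pi.add_apply]; split_ifs <;> simp
      map_smul' := by intro r f; funext F; simp }
  let VQ : Submodule (ZMod 2) (CubeFace a → ZMod 2) :=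
    { carrier := {ψ | ∀ F, ψ F ≠ 0 → Q F}
      zero_mem' := fun F hF => absurd rfl hF
      add_mem' := fun hx hy F hF => (add_ne hF).elim (hx F) (hy F)
      smul_mem' := fun r x hx F hF => hx F (fun h0 => hF (by simp [h0])) }
  by_cases hmem : φ ∈ VQ.map (res.comp dlL)
  · obtain ⟨ψ, hψ, hψ'⟩ := hmem
    refine ⟨ψ, hψ, fun F hF => ?_⟩
    rw [← hψ']
    simp [res, dlL, hF]
  · exfalso
    obtain ⟨f, hf, hW⟩ := Submodule.exists_le_ker_of_notMem hmem
    have hfs : ∀ g : CubeFace a → ZMod 2, f g = ∑ F, f (Pi.single F 1) * g F := by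
      intro g
      conv_lhs => rw [← Finset.univ_sum_single g]
      rw [map_sum]
      refine Finset.sum_congr rfl (fun F _ => ?_)
      have : (Pi.single F (g F) : CubeFace a → ZMod 2) = g F • (Pi.single F 1 : CubeFace a → ZMod 2) := by
        rw [← Pi.single_smul, smul_eq_mul, mul_one]
      rw [this, map_smul, smul_eq_mul, mul_comm]
    let c : CubeFace a → ZMod 2 := fun F => if P F then f (Pi.single F 1) else 0
    have hc1 : ∀ g : CubeFace a → ZMod 2, f (res g) = ∑ F, c F * g F := by
      intro g
      rw [hfs]
      refine Finset.sum_congr rfl (fun F _ => ?_)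
      simp only [res, c, LinearMap.coe_mk, AddHom.coe_mk]
      split_ifs <;> simp
    have hφr : res φ = φ := by
      funext F
      simp only [res, LinearMap.coe_mk, AddHom.coe_mk]
      split_ifs with h1
      · rfl
      · by_contra h2
        exact h1 (hφ F (Ne.symm h2))
    apply hf
    rw [← hφr, hc1]
    refine h c (fun F hF => ?_) (fun K hK => ?_)
    · by_contra h1
      exact hF (by simp [c, h1])
    · have h1 : (Pi.single K 1 : CubeFace a → ZMod 2) ∈ VQ := by
        intro F hF
        have : F = K := by
          by_contra h; exact hF (Pi.single_eq_of_ne h _)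
        rw [this]; exact hK
      have h2 : f (res (dl (Pi.single K 1))) = 0 := hW ⟨_, h1, rfl⟩
      rw [hc1, ← adj, Finset.sum_eq_single K] at h2
      · simpa using h2
      · intro F _ hF
        simp [hF]
      · simp

/-- Local exactness of a cubical manifold, in dual form. -/
structure LocM (M : Set (CubeFace a)) (d : ℕ) : Prop where
  down : ∀ F ∈ M, ∀ G, G ≤ F → G ∈ M
  dimle : ∀ F ∈ M, dim F ≤ d
  dpos : 0 < d
  ex : ∀ F ∈ M, ∃ H ∈ M, F ≤ H ∧ dim H = d
  row0 : ∀ F ∈ M, ∀ φ : CubeFace a → ZMod 2, (∀ H, φ H ≠ 0 → H ∈ M ∧ F ≤ H ∧ dim H = d) →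
    ∑ H, φ H = 0 → ∃ ψ : CubeFace a → ZMod 2, (∀ H, ψ H ≠ 0 → H ∈ M ∧ F ≤ H ∧ dim H + 1 = d) ∧
      ∀ H ∈ M, dl ψ H = φ H
  row : ∀ F ∈ M, ∀ j < d, ∀ φ : CubeFace a → ZMod 2,
    (∀ H, φ H ≠ 0 → H ∈ M ∧ F ≤ H ∧ dim H = j) → (∀ H ∈ M, dl φ H = 0) →
    ∃ ψ : CubeFace a → ZMod 2, (∀ H, ψ H ≠ 0 → H ∈ M ∧ F ≤ H ∧ dim H + 1 = j) ∧
      ∀ H ∈ M, dl ψ H = φ H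
  even : ∀ φ : CubeFace a → ZMod 2, ∀ c : CubeFace a → ZMod 2,
    (∀ H, c H = 1 ↔ H ∈ M ∧ dim H = d) → ∑ H, c H * dl φ H = 0

end

end CubMan

/-! ## Local structure of cubical manifolds -/

namespace CubMan

open CubeFace

section
variable {a : ℕ}

lemma bdc_supp {c : CubeFace a → ZMod 2} {K : CubeFace a} (h : bdc c K ≠ 0) :
    ∃ H, c H ≠ 0 ∧ K ≤ H ∧ dim H = dim K + 1 := by
  obtain ⟨i, -, hi⟩ := Finset.exists_ne_zero_of_sum_ne_zero h
  split_ifs at hi with h1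
  · exact absurd rfl hi
  · exact ⟨_, hi, le_upd_none _ _, dim_upd_none h1⟩

lemma dl_supp {c : CubeFace a → ZMod 2} {K : CubeFace a} (h : dl c K ≠ 0) :
    ∃ H, c H ≠ 0 ∧ H ≤ K ∧ dim K = dim H + 1 := by
  obtain ⟨i, -, hi⟩ := Finset.exists_ne_zero_of_sum_ne_zero h
  split_ifs at hi with h1
  · obtain ⟨b, -, hb⟩ := Finset.exists_ne_zero_of_sum_ne_zero hi
    exact ⟨_, hb, upd_le h1 _, (dim_upd_some h1 b).symm⟩
  · exact absurd rfl hi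

lemma bdc_congr {c c' : CubeFace a → ZMod 2} {K : CubeFace a} (h : ∀ H, K ≤ H → c H = c' H) :
    bdc c K = bdc c' K := by
  refine Finset.sum_congr rfl (fun i _ => ?_)
  rw [h _ (le_upd_none _ _)]

lemma covers {K H : CubeFace a} (h : K ≤ H) (hd : dim H = dim K + 1) :
    ∃ i, K i ≠ none ∧ H = upd K i none := by
  have : ∃ i, K i ≠ none ∧ H i = none := by
    by_contra! h0
    have : H ≤ K := by
      intro i
      by_cases h1 : K i = none
      · exact Or.inl h1
      · rcases h i with h2 | h2
        · exact absurd h2 (h0 i h1)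
        · exact Or.inr h2.symm
    have := dim_mono this
    omega
  obtain ⟨i, hi, hi'⟩ := this
  refine ⟨i, hi, (eq_of_le_dim ?_ ?_).symm⟩
  · intro j
    by_cases hj : j = i
    · exact Or.inl (hj ▸ hi')
    · rw [upd_ne _ _ hj]; exact h j
  · rw [hd, dim_upd_none hi]

open Classical in
lemma bdc_single {K H : CubeFace a} (h : K ≤ H) (hd : dim H = dim K + 1) :
    bdc (Pi.single H 1) K = 1 := by
  obtain ⟨i, hi, rfl⟩ := covers h hd
  unfold bdc
  rw [Finset.sum_eq_single i]
  · simp [hi]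
  · intro j _ hj
    split_ifs with h1
    · rfl
    · refine Pi.single_eq_of_ne ?_ _
      intro h2
      have := congrFun h2 j
      rw [upd_same, upd_ne _ _ hj] at this
      exact h1 this.symm
  · simp

lemma z2 (x : ZMod 2) (h : x ≠ 0) : x = 1 := by
  revert x; decide

lemma exA_mem {M : Set (CubeFace a)} {F : CubeFace a} {n : ℕ} {c : CubeFace a → ZMod 2}
    (hc : ∀ H, c H ≠ 0 → H ∈ M ∧ F ≤ H ∧ dim H = n) (hb : ∀ K, F ≤ K → bdc c K = 0) :
    exA c ∈ ZR M F (n + 1) := by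
  constructor
  · rintro (_ | H) hH
    · exact absurd rfl hH
    · obtain ⟨h1, h2, h3⟩ := hc H hH
      exact ⟨by rw [← h3]; rfl, H, h1, h2, le_refl _⟩
  · rintro (_ | K) hK
    · trivial
    · rw [cb_exA] at hK
      obtain ⟨H, h1, h2, -⟩ := bdc_supp hK
      exact ⟨⟨H, (hc H h1).1, (hc H h1).2.1, h2⟩, fun h3 => hK (hb K h3)⟩

lemma locV {M : Set (CubeFace a)} (hM : IsSubcomplex M) {d : ℕ}
    (hman : IsCompactManifold (CubeFace.real M) d) {F : CubeFace a} (hF : F ∈ M) (j : ℕ)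
    (hj : 1 ≤ j) (hjd : j ≠ d) (c : CubeFace a → ZMod 2)
    (hc : ∀ H, c H ≠ 0 → H ∈ M ∧ F ≤ H ∧ dim H = j) (hb : ∀ K, F ≤ K → bdc c K = 0) :
    ∃ e : CubeFace a → ZMod 2, (∀ H, e H ≠ 0 → H ∈ M) ∧ ∀ K, F ≤ K → bdc e K = c K := by
  classical
  obtain ⟨n, rfl⟩ : ∃ n, j = n + 1 := ⟨j - 1, by omega⟩
  obtain ⟨e, he1, he2⟩ := local_van hM hman hF n hjd (exA_mem hc hb)
  refine ⟨fun H => e (some H), fun H hH => ?_, fun K hK => ?_⟩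
  · obtain ⟨-, H', h1, -, h3⟩ := he1 _ hH
    exact hM.2 _ h1 _ h3
  · rw [← cb_bdc]
    by_contra h0
    refine (he2 (some K) (fun h1 => h0 ?_)).2 hK
    exact (eq_of_add_zero h1).symm

lemma locO {M : Set (CubeFace a)} (hM : IsSubcomplex M) {d : ℕ} (hd : HasDim M d) (hd0 : 0 < d)
    (hman : IsCompactManifold (CubeFace.real M) d) {F : CubeFace a} (hF : F ∈ M) :
    (∃ z : CubeFace a → ZMod 2, (∀ H, z H ≠ 0 → H ∈ M ∧ F ≤ H ∧ dim H = d) ∧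
      (∀ K, F ≤ K → bdc z K = 0) ∧ z ≠ 0) ∧
    ∀ c c' : CubeFace a → ZMod 2, (∀ H, c H ≠ 0 → H ∈ M ∧ F ≤ H ∧ dim H = d) →
      (∀ K, F ≤ K → bdc c K = 0) → c ≠ 0 →
      (∀ H, c' H ≠ 0 → H ∈ M ∧ F ≤ H ∧ dim H = d) →
      (∀ K, F ≤ K → bdc c' K = 0) → c' ≠ 0 → c = c' := by
  classical
  obtain ⟨n, rfl⟩ : ∃ n, d = n + 1 := ⟨d - 1, by omega⟩
  obtain ⟨⟨z0, hz, hzB⟩, huniq⟩ := local_one hM hman hF n rfl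
  have hBR : ∀ c : AF a → ZMod 2, c ∈ BR M F (n + 2) → ∀ H, F ≤ H → c (some H) = 0 := by
    rintro c ⟨e, he1, he2⟩ H hH
    have : e = 0 := by
      funext X
      by_contra h0
      obtain ⟨h1, h2⟩ := he1 X h0
      rcases X with _ | X
      · exact absurd h1 (by simp [rk])
      · obtain ⟨H', h3, -, h4⟩ := h2
        have := hd.1 _ (hM.2 _ h3 _ h4)
        have h5 : dim X + 1 = n + 2 + 1 := h1
        omega
    subst this
    by_contra h0
    refine (he2 (some H) ?_).2 hH
    rw [show cb (0 : AF a → ZMod 2) = 0 from map_zero _, add_zero]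
    exact h0
  refine ⟨⟨fun H => if F ≤ H then z0 (some H) else 0, ?_, ?_, ?_⟩, ?_⟩
  · intro H hH
    dsimp only at hH
    split_ifs at hH with h1
    · obtain ⟨h2, H', h3, -, h4⟩ := hz.1 _ hH
      exact ⟨hM.2 _ h3 _ h4, h1, by have h5 : dim H + 1 = n + 2 := h2; omega⟩
    · exact absurd rfl hH
  · intro K hK
    rw [bdc_congr (c' := fun H => z0 (some H)), ← cb_bdc]
    · by_contra h0
      exact (hz.2 _ h0).2 hK
    · intro H hH
      simp [hK.trans hH]
  · intro h0
    apply hzB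
    refine ⟨0, fun X hX => absurd rfl hX, fun X hX => ?_⟩
    rw [show cb (0 : AF a → ZMod 2) = 0 from map_zero _, add_zero] at hX
    rcases X with _ | X
    · trivial
    · refine ⟨(hz.1 _ hX).2, fun h1 => hX ?_⟩
      have := congrFun h0 X
      simpa [h1] using this
  · intro c c' hc hb hc0 hc' hb' hc0'
    have hnB : ∀ c : CubeFace a → ZMod 2, (∀ H, c H ≠ 0 → H ∈ M ∧ F ≤ H ∧ dim H = n + 1) →
        c ≠ 0 → exA c ∉ BR M F (n + 2) := by
      intro c hc hc0 hB
      apply hc0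
      funext H
      by_contra h0
      exact h0 (hBR _ hB H (hc H h0).2.1)
    have h := huniq _ (exA_mem hc hb) _ (exA_mem hc' hb') (hnB c hc hc0) (hnB c' hc' hc0')
    funext H
    by_cases hFH : F ≤ H
    · exact eq_of_add_zero (hBR _ h H hFH)
    · have h1 : c H = 0 := by
        by_contra h0; exact hFH (hc H h0).2.1
      have h2 : c' H = 0 := by
        by_contra h0; exact hFH (hc' H h0).2.1
      rw [h1, h2]

open Classical in
/-- The fundamental chain. -/
noncomputable def fund (M : Set (CubeFace a)) (d : ℕ) (H : CubeFace a) : ZMod 2 :=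
  if H ∈ M ∧ dim H = d then 1 else 0

lemma fund_cycle {M : Set (CubeFace a)} (hM : IsSubcomplex M) {d : ℕ} (hd : HasDim M d)
    (hd0 : 0 < d) (hman : IsCompactManifold (CubeFace.real M) d) (K : CubeFace a) :
    bdc (fund M d) K = 0 := by
  classical
  by_contra h0
  obtain ⟨H1, h1, h2, h3⟩ := bdc_supp h0
  have h4 : H1 ∈ M ∧ dim H1 = d := by
    by_contra h; exact h1 (by simp [fund, h])
  have hK : K ∈ M := hM.2 _ h4.1 _ h2
  have hKd : dim K + 1 = d := by omega
  obtain ⟨⟨z, hz1, hz2, hz3⟩, hu⟩ := locO hM hd hd0 hman hK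
  obtain ⟨H0, hH0⟩ : ∃ H, z H ≠ 0 := by
    by_contra! h; exact hz3 (funext h)
  obtain ⟨p1, p2, p3⟩ := hz1 _ hH0
  apply h0
  rw [bdc_congr (c' := z)]
  · exact hz2 K le_rfl
  intro H hH
  by_cases hHM : H ∈ M ∧ dim H = d
  · rw [fund, if_pos hHM]
    by_cases he : H = H0
    · rw [he]; exact (z2 _ hH0).symm
    have hs : ∀ X, (Pi.single H0 1 + Pi.single H 1 : CubeFace a → ZMod 2) X ≠ 0 →
        X ∈ M ∧ K ≤ X ∧ dim X = d := by
      intro X hX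
      rcases add_ne hX with h | h
      · have : X = H0 := by
          by_contra h'; exact h (Pi.single_eq_of_ne h' _)
        rw [this]; exact ⟨p1, p2, p3⟩
      · have : X = H := by
          by_contra h'; exact h (Pi.single_eq_of_ne h' _)
        rw [this]; exact ⟨hHM.1, hH, hHM.2⟩
    have hv : (Pi.single H0 1 + Pi.single H 1 : CubeFace a → ZMod 2) H = 1 := by
      simp [he]
    have := hu z _ hz1 hz2 hz3 hs ?_ ?_
    · rw [this, hv]
    · intro X hX
      by_cases hXK : X = K
      · rw [hXK, bdc_add, Pi.add_apply, bdc_single p2 (by omega), bdc_single hH (by omega)]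
        decide
      · by_contra hne
        obtain ⟨Y, hY1, hY2, hY3⟩ := bdc_supp hne
        have := (hs Y hY1).2.2
        exact hXK (eq_of_le_dim hX (by omega)).symm
    · intro h
      rw [h] at hv
      exact absurd hv (zero_ne_one (α := ZMod 2))
  · rw [fund, if_neg hHM]
    by_contra h
    obtain ⟨h1, h2, h3⟩ := hz1 H (Ne.symm h)
    exact hHM ⟨h1, h3⟩

theorem locM {M : Set (CubeFace a)} (hM : IsSubcomplex M) {d : ℕ} (hd : HasDim M d)
    (hd0 : 0 < d) (hman : IsCompactManifold (CubeFace.real M) d) : LocM M d := by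
  classical
  have hex : ∀ F ∈ M, ∃ H ∈ M, F ≤ H ∧ dim H = d := by
    intro F hF
    obtain ⟨⟨z, hz1, hz2, hz3⟩, hu⟩ := locO hM hd hd0 hman hF
    obtain ⟨H0, hH0⟩ : ∃ H, z H ≠ 0 := by
      by_contra! h; exact hz3 (funext h)
    exact ⟨H0, (hz1 _ hH0).1, (hz1 _ hH0).2⟩
  have hQ : ∀ F ∈ M, ∀ j, ∀ c : CubeFace a → ZMod 2,
      (∀ H, c H ≠ 0 → H ∈ M ∧ F ≤ H ∧ dim H = j) →
      (∀ H, (H ∈ M ∧ F ≤ H ∧ dim H + 1 = j) → bdc c H = 0) → ∀ K, F ≤ K → bdc c K = 0 := by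
    intro F hF j c hc hb K hK
    by_contra h0
    obtain ⟨H, h1, h2, h3⟩ := bdc_supp h0
    obtain ⟨h4, h5, h6⟩ := hc H h1
    exact h0 (hb K ⟨hM.2 _ h4 _ h2, hK, by omega⟩)
  have hP : ∀ F ∈ M, ∀ j, ∀ φ : CubeFace a → ZMod 2,
      (∀ H, φ H ≠ 0 → H ∈ M ∧ F ≤ H ∧ dim H = j) →
      (∃ ψ : CubeFace a → ZMod 2, (∀ H, ψ H ≠ 0 → H ∈ M ∧ F ≤ H ∧ dim H + 1 = j) ∧
        ∀ H, (H ∈ M ∧ F ≤ H ∧ dim H = j) → dl ψ H = φ H) →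
      (∃ ψ : CubeFace a → ZMod 2, (∀ H, ψ H ≠ 0 → H ∈ M ∧ F ≤ H ∧ dim H + 1 = j) ∧
        ∀ H ∈ M, dl ψ H = φ H) := by
    rintro F hF j φ hφ ⟨ψ, h1, h2⟩
    refine ⟨ψ, h1, fun H hH => ?_⟩
    by_cases h : F ≤ H ∧ dim H = j
    · exact h2 H ⟨hH, h⟩
    · have e1 : φ H = 0 := by
        by_contra h0; exact h (hφ H h0).2
      have e2 : dl ψ H = 0 := by
        by_contra h0
        obtain ⟨X, h3, h4, h5⟩ := dl_supp h0
        obtain ⟨h6, h7, h8⟩ := h1 X h3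
        exact h ⟨h7.trans h4, by omega⟩
      rw [e1, e2]
  refine ⟨hM.2, hd.1, hd0, hex, ?_, ?_, ?_⟩
  · intro F hF φ hφ hs
    refine hP F hF d φ hφ (core_dual _ _ φ hφ ?_)
    intro c hc hb
    by_cases hc0 : c = 0
    · simp [hc0]
    have hu := (locO hM hd hd0 hman hF).2 c (fun H => if F ≤ H then fund M d H else 0) hc
      (hQ F hF d c hc hb) hc0 ?_ ?_ ?_
    · rw [← hs]
      refine Finset.sum_congr rfl (fun H _ => ?_)
      by_cases h0 : φ H = 0
      · rw [h0, mul_zero]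
      · obtain ⟨h1, h2, h3⟩ := hφ H h0
        rw [hu]
        simp [h1, h2, h3, fund]
    · intro H hH
      split_ifs at hH with h1
      · by_cases h2 : H ∈ M ∧ dim H = d
        · exact ⟨h2.1, h1, h2.2⟩
        · exact absurd (by simp [fund, h2]) hH
      · exact absurd rfl hH
    · intro K hK
      rw [bdc_congr (c' := fund M d)]
      · exact fund_cycle hM hd hd0 hman K
      · intro H hH
        simp [hK.trans hH]
    · intro h
      obtain ⟨H, h1, h2, h3⟩ := hex F hF
      have := congrFun h H
      simp [h1, h2, h3, fund] at this
  · intro F hF j hj φ hφ hδ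
    rcases Nat.eq_zero_or_pos j with rfl | hj0
    · refine ⟨0, fun H hH => absurd rfl hH, fun H hH => ?_⟩
      have h0 : φ F = 0 := by
        by_contra h0
        obtain ⟨H, h1, h2, h3⟩ := hex F hF
        have hF0 := (hφ F h0).2.2
        obtain ⟨i, hi⟩ := exists_free (F := H) (by omega)
        have hi' : F i ≠ none := by
          intro h
          have := dim_upd_some h true
          omega
        have hE : upd F i none ∈ M := by
          refine hM.2 H h1 _ (fun j => ?_)
          by_cases hj : j = i
          · exact Or.inl (hj ▸ hi)
          · rw [upd_ne _ _ hj]; exact h2 j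
        have h4 := adj (Pi.single (upd F i none) 1) φ
        rw [Finset.sum_eq_single F, Finset.sum_eq_single (upd F i none)] at h4
        · rw [bdc_single (le_upd_none _ _) (dim_upd_none hi'), hδ _ hE, mul_zero, one_mul] at h4
          exact h0 h4
        · intro X _ hX
          simp [hX]
        · simp
        · intro X _ hX
          by_cases h5 : φ X = 0
          · rw [h5, mul_zero]
          · obtain ⟨-, h6, h7⟩ := hφ X h5
            exact absurd (eq_of_le_dim h6 (by omega)).symm hX
        · simp
      have h1 : φ = 0 := by
        funext X
        by_contra h5
        obtain ⟨-, h6, h7⟩ := hφ X h5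
        have hX : F = X := eq_of_le_dim h6 (by omega)
        exact h5 (hX ▸ h0)
      rw [h1]
      exact congrFun (map_zero (dlL (a := a))) H
    · refine hP F hF j φ hφ (core_dual _ _ φ hφ ?_)
      intro c hc hb
      obtain ⟨e, he1, he2⟩ := locV hM hman hF j hj0 (by omega) c hc (hQ F hF j c hc hb)
      have : ∑ H, c H * φ H = ∑ H, bdc e H * φ H := by
        refine Finset.sum_congr rfl (fun H _ => ?_)
        by_cases h0 : φ H = 0
        · rw [h0, mul_zero, mul_zero]
        · rw [he2 H (hφ H h0).2.1]
      rw [this, adj]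
      refine Finset.sum_eq_zero (fun H _ => ?_)
      by_cases h0 : e H = 0
      · rw [h0, zero_mul]
      · rw [hδ H (he1 H h0), mul_zero]
  · intro φ c hc
    have : c = fund M d := by
      funext H
      by_cases h : H ∈ M ∧ dim H = d
      · rw [(hc H).2 h, fund, if_pos h]
      · rw [fund, if_neg h]
        by_contra h0
        exact h ((hc H).1 (z2 _ h0))
    rw [this, ← adj]
    refine Finset.sum_eq_zero (fun H _ => ?_)
    rw [fund_cycle hM hd hd0 hman, zero_mul]

end

end CubMan

/-! ## Poincare–Alexander duality for faces -/

namespace CubMan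

open CubeFace

section
variable {a : ℕ}

/-- Indexing types of the dual complex. -/
def DuB (a : ℕ) : ℕ → Type
  | 0 => Unit
  | _ + 1 => CubeFace a

open Classical in
/-- Restriction to a set of faces. -/
noncomputable def resM (M : Set (CubeFace a)) : (CubeFace a → ZMod 2) →ₗ[ZMod 2] (CubeFace a → ZMod 2) where
  toFun f F := if F ∈ M then f F else 0
  map_add' := by intro f g; funext F; simp only [Pi.add_apply]; split_ifs <;> simp
  map_smul' := by intro r f; funext F; simp

lemma resM_mem {M : Set (CubeFace a)} {f : CubeFace a → ZMod 2} {F : CubeFace a} (h : F ∈ M) :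
    resM M f F = f F := by simp [resM, h]

lemma resM_not {M : Set (CubeFace a)} {f : CubeFace a → ZMod 2} {F : CubeFace a} (h : F ∉ M) :
    resM M f F = 0 := by simp [resM, h]

/-- The differential of the dual complex. -/
noncomputable def DuD (M : Set (CubeFace a)) (d : ℕ) :
    ∀ q, (DuB a (q + 1) →₀ ZMod 2) →ₗ[ZMod 2] (DuB a q →₀ ZMod 2)
  | 0 => (Finsupp.lsingle () : ZMod 2 →ₗ[ZMod 2] (Unit →₀ ZMod 2)) ∘ₗ
      (Finsupp.linearCombination (ZMod 2) (fund M d) : (CubeFace a →₀ ZMod 2) →ₗ[ZMod 2] ZMod 2)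
  | _ + 1 => (Finsupp.linearEquivFunOnFinite (ZMod 2) (ZMod 2) (CubeFace a)).symm.toLinearMap ∘ₗ
      resM M ∘ₗ dlL ∘ₗ (Finsupp.linearEquivFunOnFinite (ZMod 2) (ZMod 2) (CubeFace a)).toLinearMap

lemma DD_zero (M : Set (CubeFace a)) (d : ℕ) (x : CubeFace a →₀ ZMod 2) :
    DuD M d 0 x = Finsupp.single () (∑ H, fund M d H * x H) := by
  change Finsupp.single () (Finsupp.linearCombination (ZMod 2) (fund M d) x) = _
  congr 1
  rw [Finsupp.linearCombination_apply, Finsupp.sum_fintype]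
  · refine Finset.sum_congr rfl (fun H _ => ?_)
    rw [smul_eq_mul, mul_comm]
  · simp

lemma DuD_succ (M : Set (CubeFace a)) (d q : ℕ) (x : CubeFace a →₀ ZMod 2) (H : CubeFace a) :
    (show CubeFace a →₀ ZMod 2 from DuD M d (q + 1) x) H = resM M (dl x) H := rfl

/-- The local conditions of the dual complex. -/
def DuL (M : Set (CubeFace a)) (d : ℕ) (F : CubeFace a) : ∀ q, AF a → DuB a q → Prop
  | 0, none, _ => True
  | 0, some G, _ => G ≤ F ∧ G ∈ M
  | q + 1, none, H => (H : CubeFace a) ∈ M ∧ dim (H : CubeFace a) + q = d ∧ ∃ G ≤ F, G ≤ (H : CubeFace a)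
  | q + 1, some G, H => (H : CubeFace a) ∈ M ∧ dim (H : CubeFace a) + q = d ∧ G ≤ F ∧ G ≤ (H : CubeFace a)

lemma dl_congr {c c' : CubeFace a → ZMod 2} {K : CubeFace a} (h : ∀ H, H ≤ K → c H = c' H) :
    dl c K = dl c' K := by
  refine Finset.sum_congr rfl (fun i _ => ?_)
  split_ifs with h1
  · refine Finset.sum_congr rfl (fun b _ => ?_)
    rw [h _ (upd_le h1 _)]
  · rfl

lemma mem_spp {β : Type} {P : β → Prop} {x : β →₀ ZMod 2} : x ∈ spp P ↔ ∀ H, x H ≠ 0 → P H := by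
  rw [Finsupp.mem_supported]
  constructor
  · intro h H hH
    exact h (Finsupp.mem_support_iff.mpr hH)
  · intro h H hH
    exact h H (Finsupp.mem_support_iff.mp hH)

lemma fund_iff (M : Set (CubeFace a)) (d : ℕ) (H : CubeFace a) : fund M d H = 1 ↔ H ∈ M ∧ dim H = d := by
  unfold fund
  split_ifs with h <;> simp [h]

lemma dual_XH {M : Set (CubeFace a)} {d : ℕ} (h : LocM M d) (F : CubeFace a) :
    XH (DuB a) (DuD M d) (DuL M d F) where
  bb := by
    intro q x
    rcases q with _ | q
    · have := DD_zero M d (DuD M d 1 x)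
      rw [this]
      have h1 : ∑ H, fund M d H * (show CubeFace a →₀ ZMod 2 from DuD M d 1 x) H =
          ∑ H, fund M d H * dl (show CubeFace a →₀ ZMod 2 from x) H := by
        refine Finset.sum_congr rfl (fun H _ => ?_)
        by_cases h0 : fund M d H = 0
        · rw [h0, zero_mul, zero_mul]
        · exact congrArg (fun t => fund M d H * t) (resM_mem ((fund_iff M d H).1 (z2 _ h0)).1)
      have h2 := h.even (show CubeFace a →₀ ZMod 2 from x) (fund M d) (fund_iff M d)
      exact (congrArg (Finsupp.single ()) (h1.trans h2)).trans (Finsupp.single_zero ())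
    · refine Finsupp.ext (fun H => ?_)
      refine (DuD_succ M d q _ H).trans ?_
      by_cases hH : H ∈ M
      · rw [resM_mem hH]
        refine Eq.trans ?_ (dl_dl (show CubeFace a →₀ ZMod 2 from x) H)
        refine dl_congr (fun K hK => ?_)
        exact (DuD_succ M d (q + 1) x K).trans (resM_mem (h.down _ hH _ hK))
      · exact resM_not hH
  mono := by
    intro q G G' β hG hle
    rcases q with _ | q
    · exact ⟨hle.trans hG.1, h.down _ hG.2 _ hle⟩
    · exact ⟨hG.1, hG.2.1, hle.trans hG.2.2.1, hle.trans hG.2.2.2⟩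
  mono0 := by
    intro q G β hG
    rcases q with _ | q
    · trivial
    · exact ⟨hG.1, hG.2.1, G, hG.2.2⟩
  memB := by
    intro q G x hx
    rw [mem_spp] at hx ⊢
    intro H hH
    rcases q with _ | q
    · rcases G with _ | G
      · trivial
      · have hx0 : x ≠ 0 := by
          rintro rfl
          exact hH (by rw [map_zero]; rfl)
        obtain ⟨K, hK⟩ : ∃ K, x K ≠ 0 := by
          by_contra! h0
          exact hx0 (Finsupp.ext h0)
        obtain ⟨h1, h2, h3, h4⟩ := hx K hK
        exact ⟨h3, h.down _ h1 _ h4⟩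
    · have h1 : resM M (dl (show CubeFace a →₀ ZMod 2 from x)) H ≠ 0 := hH
      by_cases hHM : (H : CubeFace a) ∈ M
      · rw [resM_mem hHM] at h1
        obtain ⟨K, hK, hKH, hd⟩ := dl_supp h1
        have h2 := hx K hK
        rcases G with _ | G
        · obtain ⟨h3, h4, G, h5, h6⟩ := h2
          exact ⟨hHM, by omega, G, h5, h6.trans hKH⟩
        · obtain ⟨h3, h4, h5, h6⟩ := h2
          exact ⟨hHM, by omega, h5, h6.trans hKH⟩
      · exact absurd (resM_not hHM) h1
  rowZ := by
    intro G x hx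
    rw [mem_spp] at hx
    by_cases hG : G ≤ F ∧ G ∈ M
    · obtain ⟨H, h1, h2, h3⟩ := h.ex G hG.2
      refine ⟨(Finsupp.single H (x ()) : CubeFace a →₀ ZMod 2), ?_, ?_⟩
      · exact Finsupp.single_mem_supported _ _ ⟨h1, by omega, hG.1, h2⟩
      · refine (DD_zero M d _).trans ?_
        rw [Finset.sum_eq_single H]
        · rw [Finsupp.single_eq_same, (fund_iff M d H).2 ⟨h1, h3⟩, one_mul]
          exact Finsupp.ext (fun u => by cases u; exact Finsupp.single_eq_same)
        · intro K _ hK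
          rw [Finsupp.single_eq_of_ne hK, mul_zero]
        · simp
    · refine ⟨0, Submodule.zero_mem _, ?_⟩
      rw [map_zero]
      refine Finsupp.ext (fun u => ?_)
      by_contra h0
      exact hG (hx u (Ne.symm h0))
  row := by
    intro q G x hx hd
    rw [mem_spp] at hx
    by_cases hx0 : x = 0
    · exact ⟨0, Submodule.zero_mem _, by rw [hx0, map_zero]⟩
    obtain ⟨K, hK⟩ : ∃ K, x K ≠ 0 := by
      by_contra! h0
      exact hx0 (Finsupp.ext h0)
    obtain ⟨k1, k2, k3, k4⟩ := hx K hK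
    have hGM : G ∈ M := h.down _ k1 _ k4
    let x' : CubeFace a →₀ ZMod 2 := x
    have key : ∃ ψ : CubeFace a → ZMod 2,
        (∀ H, ψ H ≠ 0 → H ∈ M ∧ G ≤ H ∧ dim H + 1 = d - q) ∧ ∀ H ∈ M, dl ψ H = x' H := by
      rcases q with _ | q
      · refine h.row0 G hGM x' (fun H hH => ?_) ?_
        · obtain ⟨h1, h2, h3, h4⟩ := hx H hH
          exact ⟨h1, h4, by omega⟩
        · have h1 := (DD_zero M d x').symm.trans hd
          have h1 := Finsupp.single_eq_zero.mp h1
          rw [← h1]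
          refine Finset.sum_congr rfl (fun H _ => ?_)
          by_cases h0 : x' H = 0
          · rw [h0, mul_zero]
          · obtain ⟨h1, h2, h3, h4⟩ := hx H h0
            rw [(fund_iff M d H).2 ⟨h1, by omega⟩, one_mul]
      · refine h.row G hGM (d - (q + 1)) (by omega) x' (fun H hH => ?_) (fun H hH => ?_)
        · obtain ⟨h1, h2, h3, h4⟩ := hx H hH
          exact ⟨h1, h4, by omega⟩
        · have h1 := DuD_succ M d q x' H
          rw [resM_mem hH] at h1
          rw [← h1]
          exact DFunLike.congr_fun hd H
    obtain ⟨ψ, h1, h2⟩ := key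
    refine ⟨(Finsupp.linearEquivFunOnFinite (ZMod 2) (ZMod 2) (CubeFace a)).symm ψ, ?_, ?_⟩
    · refine mem_spp.mpr ?_
      intro H hH
      obtain ⟨p1, p2, p3⟩ := h1 H hH
      exact ⟨p1, by omega, k3, p2⟩
    · refine Finsupp.ext (fun H => ?_)
      refine (DuD_succ M d q _ H).trans ?_
      by_cases hH : H ∈ M
      · exact (resM_mem hH).trans (h2 H hH)
      · rw [resM_not hH]
        by_contra h0
        exact hH (hx H (Ne.symm h0)).1
  col := by
    rintro q H ⟨h1, h2, G0, h3, h4⟩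
    obtain ⟨m, hm⟩ := inf_lemma {F, (H : CubeFace a)} G0 (by
      rintro K (rfl | rfl)
      · exact h3
      · exact h4)
    refine ⟨m, fun G => ?_⟩
    rcases G with _ | G
    · exact ⟨fun _ => trivial, fun _ => ⟨h1, h2, G0, h3, h4⟩⟩
    · refine ⟨fun hG => (hm G).mpr ?_, fun hG => ?_⟩
      · rintro K (rfl | rfl)
        · exact hG.2.2.1
        · exact hG.2.2.2
      · have := (hm G).mp hG
        exact ⟨h1, h2, this F (Or.inl rfl), this H (Or.inr rfl)⟩

/-- Exactness of the cochain complex supported near a face. -/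
def ExactAt (M : Set (CubeFace a)) (F : CubeFace a) (j : ℕ) : Prop :=
  ∀ x : CubeFace a → ZMod 2, (∀ H, x H ≠ 0 → H ∈ M ∧ dim H = j ∧ ∃ G ≤ F, G ≤ H) →
    (∀ H ∈ M, dl x H = 0) →
    ∃ y : CubeFace a → ZMod 2, (∀ H, y H ≠ 0 → H ∈ M ∧ dim H + 1 = j ∧ ∃ G ≤ F, G ≤ H) ∧
      ∀ H ∈ M, dl y H = x H

lemma dual_main {M : Set (CubeFace a)} {d : ℕ} (h : LocM M d) (F : CubeFace a) (n j : ℕ)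
    (hj : j + (n + 1) = d) :
    HEquiv {x | x ∈ spp (DuL M d F (n + 2) none) ∧ DuD M d (n + 1) x = 0}
      {x | ∃ y ∈ spp (DuL M d F (n + 3) none), DuD M d (n + 2) y = x}
      (CZ {G | G ≤ F ∧ G ∈ M} (n + 2)) (CB {G | G ≤ F ∧ G ∈ M} (n + 2)) := by
  refine theoremX (dual_XH h F) {G | G ≤ F ∧ G ∈ M} () (fun _ => rfl) (fun G => ?_) (n + 1)
  rcases G with _ | G <;> exact Iff.rfl

lemma exactAt_iff {M : Set (CubeFace a)} {d : ℕ} (F : CubeFace a) (n j : ℕ)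
    (hj : j + (n + 1) = d) : ExactAt M F j ↔
      {x | x ∈ spp (DuL M d F (n + 2) none) ∧ DuD M d (n + 1) x = 0} ⊆
      {x | ∃ y ∈ spp (DuL M d F (n + 3) none), DuD M d (n + 2) y = x} := by
  constructor
  · rintro h x ⟨hx, hd⟩
    rw [mem_spp] at hx
    obtain ⟨y, hy1, hy2⟩ := h (show CubeFace a →₀ ZMod 2 from x) (fun H hH => by
      obtain ⟨h1, h2, h3⟩ := hx H hH
      exact ⟨h1, by omega, h3⟩) (fun H hH => by
      have h1 := DuD_succ M d n x H
      rw [resM_mem hH] at h1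
      rw [← h1]
      exact DFunLike.congr_fun hd H)
    refine ⟨(Finsupp.linearEquivFunOnFinite (ZMod 2) (ZMod 2) (CubeFace a)).symm y, ?_, ?_⟩
    · refine mem_spp.mpr ?_
      intro H hH
      obtain ⟨p1, p2, p3⟩ := hy1 H hH
      exact ⟨p1, by omega, p3⟩
    · refine Finsupp.ext (fun H => ?_)
      refine (DuD_succ M d (n + 1) _ H).trans ?_
      by_cases hH : H ∈ M
      · exact (resM_mem hH).trans (hy2 H hH)
      · rw [resM_not hH]
        by_contra h0
        exact hH (hx H (Ne.symm h0)).1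
  · intro h x hx hd
    obtain ⟨y, hy1, hy2⟩ := @h ((Finsupp.linearEquivFunOnFinite (ZMod 2) (ZMod 2) (CubeFace a)).symm x) ⟨by
      refine mem_spp.mpr ?_
      intro H hH
      obtain ⟨p1, p2, p3⟩ := hx H hH
      exact ⟨p1, by omega, p3⟩, Finsupp.ext (fun H => by
      refine (DuD_succ M d n _ H).trans ?_
      by_cases hH : H ∈ M
      · exact (resM_mem hH).trans (hd H hH)
      · exact resM_not hH)⟩
    rw [mem_spp] at hy1
    refine ⟨(show CubeFace a →₀ ZMod 2 from y), fun H hH => ?_, fun H hH => ?_⟩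
    · obtain ⟨p1, p2, p3⟩ := hy1 H hH
      exact ⟨p1, by omega, p3⟩
    · have h1 := DuD_succ M d (n + 1) y H
      rw [resM_mem hH] at h1
      rw [← h1]
      exact DFunLike.congr_fun hy2 H

lemma dual_exact {M : Set (CubeFace a)} {d : ℕ} (h : LocM M d) {F : CubeFace a} (hF : F ∈ M)
    (j : ℕ) (hj : dim F + j = d + 1) (h2 : 2 ≤ dim F) : ExactAt M F j := by
  obtain ⟨n, hn⟩ : ∃ n, dim F = n + 2 := ⟨dim F - 2, by omega⟩
  rw [exactAt_iff (d := d) F n j (by omega)]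
  refine (dual_main h F n j (by omega)).symm.van ?_
  rintro c ⟨h1, h2⟩
  obtain ⟨e, he1, he2⟩ := face_acyclic F c (fun G hG => by
    rcases G with _ | G
    · trivial
    · exact (h1 _ hG).2.1) h2
  refine ⟨rkr (n + 3) e, fun G hG => ?_, ?_⟩
  · unfold rkr at hG
    split_ifs at hG with h3
    · refine ⟨h3, ?_⟩
      have := he1 G hG
      rcases G with _ | G
      · trivial
      · exact ⟨this, h.down _ hF _ this⟩
    · exact absurd rfl hG
  · rw [cb_rkr, he2]
    funext G
    unfold rkr
    split_ifs with h3
    · rfl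
    · by_contra h0
      exact h3 (h1 G (Ne.symm h0)).1

lemma dual_not {M : Set (CubeFace a)} {d : ℕ} (h : LocM M d) {F : CubeFace a} (hF : F ∉ M)
    (hp : ∀ G, G ≤ F → G ≠ F → G ∈ M)
    (j : ℕ) (hj : dim F + j = d + 1) (h2 : 2 ≤ dim F) : ¬ ExactAt M F j := by
  classical
  obtain ⟨n, hn⟩ : ∃ n, dim F = n + 2 := ⟨dim F - 2, by omega⟩
  rw [exactAt_iff (d := d) F n j (by omega)]
  intro hE
  have hv := (dual_main h F n j (by omega)).van hE
  have hs : ∀ G : AF a, (Pi.single (some F) 1 : AF a → ZMod 2) G ≠ 0 → G = some F := by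
    intro G hG
    by_contra h0
    exact hG (Pi.single_eq_of_ne h0 _)
  have hc : cb (Pi.single (some F) 1 : AF a → ZMod 2) ∈ CZ {G | G ≤ F ∧ G ∈ M} (n + 2) := by
    refine ⟨fun G hG => ⟨cb_rank (p := n + 2) (fun G hG => ?_) G hG, ?_⟩, cb_cb _⟩
    · rw [hs G hG]
      change dim F + 1 = _
      omega
    · rcases G with _ | G
      · trivial
      · rw [cb_bdc] at hG
        obtain ⟨H, h1, h3, h4⟩ := bdc_supp hG
        have := hs _ h1
        simp only [Option.some.injEq] at this
        subst this
        refine ⟨h3, hp G h3 ?_⟩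
        rintro rfl
        omega
  obtain ⟨e, he1, he2⟩ := hv hc
  have he : e = 0 := by
    funext G
    by_contra h0
    obtain ⟨h1, h3⟩ := he1 G h0
    rcases G with _ | G
    · exact absurd h1 (by simp [rk])
    · have h4 : dim G + 1 = n + 2 + 1 := h1
      exact hF (eq_of_le_dim h3.1 (by omega) ▸ h3.2)
  rw [he, show cb (0 : AF a → ZMod 2) = 0 from map_zero _] at he2
  obtain ⟨i, hi⟩ := exists_free (F := F) (by omega)
  have h5 := congrFun he2 (some (upd F i (some true)))
  rw [cb_bdc] at h5
  have h6 : bdc (fun G => (Pi.single (some F) 1 : AF a → ZMod 2) (some G)) (upd F i (some true)) =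
      bdc (Pi.single F 1) (upd F i (some true)) := by
    refine bdc_congr (fun G _ => ?_)
    by_cases hG : G = F
    · rw [hG, Pi.single_eq_same, Pi.single_eq_same]
    · rw [Pi.single_eq_of_ne hG, Pi.single_eq_of_ne (fun h => hG (Option.some.inj h))]
  rw [h6] at h5
  have h7 := bdc_single (upd_le hi (some true)) (dim_upd_some hi true).symm
  exact absurd (h5.trans h7) (zero_ne_one (α := ZMod 2))

end

end CubMan

/-! ## Middle cohomology vanishing -/

namespace CubMan

open CubeFace

section
variable {a : ℕ}

/-- Vanishing of cellular cohomology in degree `r`. -/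
def Coh (M : Set (CubeFace a)) (r : ℕ) : Prop :=
  ∀ φ : CubeFace a → ZMod 2, (∀ H, φ H ≠ 0 → H ∈ M ∧ dim H = r) → (∀ H ∈ M, dl φ H = 0) →
    ∃ ψ : CubeFace a → ZMod 2, (∀ H, ψ H ≠ 0 → H ∈ M ∧ dim H + 1 = r) ∧ ∀ H ∈ M, dl ψ H = φ H

theorem coh {M : Set (CubeFace a)} (hM : IsSubcomplex M) {r : ℕ} (hr : 0 < r)
    (hs : ∀ c : Ch (r + 1) (CubeFace.real M), bd c = 0 → ∃ e : Ch (r + 2) (CubeFace.real M), bd e = c) :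
    Coh M r := by
  intro φ hφ hδ
  have hv := (carrier_thm (real_carrier hM.2) r).van hs
  have key := core_dual (fun H => H ∈ M ∧ dim H = r) (fun H => H ∈ M ∧ dim H + 1 = r) φ hφ ?_
  · obtain ⟨ψ, h1, h2⟩ := key
    refine ⟨ψ, h1, fun H hH => ?_⟩
    by_cases h : dim H = r
    · exact h2 H ⟨hH, h⟩
    · have e1 : φ H = 0 := by
        by_contra h0; exact h (hφ H h0).2
      have e2 : dl ψ H = 0 := by
        by_contra h0
        obtain ⟨X, h3, h4, h5⟩ := dl_supp h0
        obtain ⟨h6, h7⟩ := h1 X h3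
        exact h (by omega)
      rw [e1, e2]
  · intro c hc hb
    have hrk : ∀ G : AF a, exA c G ≠ 0 → rk G = r + 1 ∧ inK M G := by
      rintro (_ | G) hG
      · exact absurd rfl hG
      · have h1 := hc G hG
        exact ⟨by rw [← h1.2]; rfl, h1.1⟩
    have hcz : exA c ∈ CZ M (r + 1) := by
      refine ⟨hrk, ?_⟩
      funext G
      by_contra h0
      have h1 := cb_rank (fun G hG => (hrk G hG).1) G h0
      rcases G with _ | G
      · have h2 : 0 = r := h1
        omega
      · have h2 : dim G + 1 = r := h1
        rw [cb_exA] at h0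
        obtain ⟨H, h3, h4, -⟩ := bdc_supp h0
        exact h0 (hb G ⟨hM.2 _ (hc H h3).1 _ h4, h2⟩)
    obtain ⟨e, he1, he2⟩ := hv hcz
    have : ∑ H, c H * φ H = ∑ H, bdc (fun H => e (some H)) H * φ H := by
      refine Finset.sum_congr rfl (fun H _ => ?_)
      rw [← cb_bdc, he2]; rfl
    rw [this, adj]
    refine Finset.sum_eq_zero (fun H _ => ?_)
    by_cases h0 : e (some H) = 0
    · rw [h0, zero_mul]
    · rw [hδ H (he1 _ h0).2, mul_zero]

end

end CubMan

/-! ## Link with singular homology as defined categorically -/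

namespace CubMan

open CubeFace

section
open CategoryTheory Opposite Simplicial

variable (X : Type) [TopologicalSpace X]

/-- The singular chain complex. -/
noncomputable abbrev SC : ChainComplex (ModuleCat (ZMod 2)) ℕ :=
  (AlgebraicTopology.alternatingFaceMapComplex (ModuleCat (ZMod 2))).obj
    (((SimplicialObject.whiskering _ _).obj (ModuleCat.free (ZMod 2))).obj
      (TopCat.toSSet.obj (TopCat.of X)))

/-- Comparison of simplices. -/
noncomputable def sxE (n : ℕ) : Sx (n + 1) X ≃ (TopCat.toSSet.obj (TopCat.of X)).obj (op ⦋n⦌) :=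
  (TopCat.toSSetObjEquiv (TopCat.of X) (op ⦋n⦌)).symm

/-- Comparison of chains. -/
noncomputable def chE (n : ℕ) : Ch (n + 1) X ≃ₗ[ZMod 2] (SC X).X n :=
  Finsupp.domLCongr (sxE X n)

lemma chE_single (n : ℕ) (σ : Sx (n + 1) X) :
    chE X n (Finsupp.single σ 1) = ModuleCat.freeMk (R := ZMod 2) (sxE X n σ) :=
  Finsupp.domLCongr_single _ _ _

lemma sxE_face (n : ℕ) (σ : Sx (n + 2) X) (i : Fin (n + 2)) :
    (TopCat.toSSet.obj (TopCat.of X)).map (SimplexCategory.δ i).op (sxE X (n + 1) σ) =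
      sxE X n (σ.comp (fc i)) := by
  rfl

lemma chE_d (n : ℕ) (c : Ch (n + 2) X) :
    (SC X).d (n + 1) n (chE X (n + 1) c) = chE X n (bd c) := by
  have key : ((SC X).d (n + 1) n).hom ∘ₗ (chE X (n + 1)).toLinearMap =
      (chE X n).toLinearMap ∘ₗ bd := by
    refine lin_ext (fun σ => ?_)
    simp only [LinearMap.comp_apply, LinearEquiv.coe_coe, chE_single, bd_single, map_sum]
    rw [AlgebraicTopology.alternatingFaceMapComplex_obj_d, AlgebraicTopology.AlternatingFaceMapComplex.objD]
    rw [ModuleCat.hom_sum]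
    refine (LinearMap.sum_apply _ _ _).trans ?_
    refine Finset.sum_congr rfl (fun i _ => ?_)
    have h1 : ∀ x : (SC X).X n, ((-1 : ℤ) ^ (i : ℕ)) • x = x := by
      intro x
      rcases neg_one_pow_eq_or ℤ (i : ℕ) with h | h
      · rw [h, one_smul]
      · rw [h, neg_smul, one_smul, neg_eq_iff_add_eq_zero]
        exact two_smul_zero x
    refine (h1 _).trans ?_
    refine (ModuleCat.free_map_apply _ _).trans ?_
    rw [← sxE_face]
  exact LinearMap.congr_fun key c

theorem sing_van (r : ℕ) (h : Subsingleton (sHomology (ZMod 2) X (r + 1))) (c : Ch (r + 2) X)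
    (hc : bd c = 0) : ∃ e : Ch (r + 3) X, bd e = c := by
  have hz : Limits.IsZero ((SC X).homology (r + 1)) :=
    ModuleCat.isZero_of_subsingleton (sHomology (ZMod 2) X (r + 1))
  rw [← HomologicalComplex.exactAt_iff_isZero_homology,
    HomologicalComplex.exactAt_iff' _ (r + 2) (r + 1) r (by simp) (by simp),
    ShortComplex.moduleCat_exact_iff] at hz
  obtain ⟨e, he⟩ := hz (chE X (r + 1) c) 
    ((chE_d X r c).trans ((congrArg _ hc).trans (map_zero (chE X r))))
  obtain ⟨e', he'⟩ := (chE X (r + 2)).surjective e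
  refine ⟨e', (chE X (r + 1)).injective ?_⟩
  rw [← he'] at he
  exact (chE_d X (r + 1) e').symm.trans he

end

end CubMan

/-! ## Vertex combinatorics -/

namespace CubMan

open CubeFace

section
variable {a b : ℕ}

/-- Flip a coordinate of a vertex. -/
def fl (i : Fin a) (v : Fin a → Bool) : Fin a → Bool := Function.update v i (!v i)

@[simp] lemma fl_same (i : Fin a) (v : Fin a → Bool) : fl i v i = !v i := by simp [fl]

lemma fl_ne {i j : Fin a} (v : Fin a → Bool) (h : j ≠ i) : fl i v j = v j := by simp [fl, h]

@[simp] lemma fl_fl (i : Fin a) (v : Fin a → Bool) : fl i (fl i v) = v := by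
  funext j
  by_cases h : j = i
  · subst h; simp
  · rw [fl_ne _ h, fl_ne _ h]

lemma fl_comm (i j : Fin a) (v : Fin a → Bool) : fl i (fl j v) = fl j (fl i v) := by
  funext k
  by_cases h : k = i <;> by_cases h' : k = j
  · subst h; subst h'; rfl
  · subst h; rw [fl_same, fl_ne _ h', fl_ne _ h', fl_same]
  · subst h'; rw [fl_same, fl_ne _ h, fl_ne _ h, fl_same]
  · rw [fl_ne _ h, fl_ne _ h', fl_ne _ h', fl_ne _ h]

lemma fl_self_ne (i : Fin a) (v : Fin a → Bool) : fl i v ≠ v := by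
  intro h
  have := congrFun h i
  simp at this

lemma mem_verts {F : CubeFace a} {v : Fin a → Bool} :
    v ∈ verts F ↔ ∀ i, F i = none ∨ some (v i) = F i := Iff.rfl

/-- A canonical vertex. -/
def vv (F : CubeFace a) (t : Bool) (i : Fin a) : Bool := (F i).getD t

lemma vv_mem (F : CubeFace a) (t : Bool) : vv F t ∈ verts F := by
  intro i
  rcases opt_cases (F i) with h | h | h <;> simp [h, vv, toFace]

lemma verts_sub {F G : CubeFace a} : verts F ⊆ verts G ↔ F ≤ G := by
  constructor
  · intro h i
    by_cases hG : G i = none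
    · exact Or.inl hG
    · right
      have h1 := (mem_verts.1 (h (vv_mem F true)) i).resolve_left hG
      have h2 := (mem_verts.1 (h (vv_mem F false)) i).resolve_left hG
      rcases opt_cases (F i) with h3 | h3 | h3
      · rw [← h2] at h1
        simp [vv, h3] at h1
      · rw [← h1]; simp [vv, h3]
      · rw [← h1]; simp [vv, h3]
  · intro h v hv
    exact le_trans (show toFace v ≤ F from hv) h

lemma verts_inj {F G : CubeFace a} (h : verts F = verts G) : F = G :=
  le_antisymm (verts_sub.1 h.le) (verts_sub.1 h.ge)

lemma verts_card (F : CubeFace a) : (verts F).ncard = 2 ^ dim F := by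
  classical
  have e : verts F ≃ ({i // F i = none} → Bool) :=
    { toFun := fun v i => v.1 i
      invFun := fun h => ⟨fun i => if hi : F i = none then h ⟨i, hi⟩ else (F i).getD true, by
        rw [mem_verts]
        intro i
        by_cases hi : F i = none
        · exact Or.inl hi
        · right
          rcases opt_cases (F i) with h | h | h
          · exact absurd h hi
          · simp [h]
          · simp [h]⟩
      left_inv := by
        rintro ⟨v, hv⟩
        ext i
        dsimp only
        split_ifs with hi
        · rfl
        · have := (mem_verts.1 hv i).resolve_left hi
          rw [← this]; rfl
      right_inv := by
        intro h
        funext i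
        simp [i.2] }
  rw [← Nat.card_coe_set_eq, Nat.card_congr e, Nat.card_eq_fintype_card, Fintype.card_fun,
    Fintype.card_bool, dim_eq, Fintype.card_subtype]

lemma dim_of_image {F : CubeFace a} {G : CubeFace b} {f : (Fin a → Bool) → (Fin b → Bool)}
    (hf : Set.InjOn f (verts F)) (h : verts G = f '' verts F) : dim G = dim F := by
  have := Set.ncard_image_of_injOn hf
  rw [← h, verts_card, verts_card] at this
  exact Nat.pow_right_injective (le_refl 2) this

lemma mem_upd_none {F : CubeFace a} {i : Fin a} {v : Fin a → Bool} (h : F i ≠ none) :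
    v ∈ verts (upd F i none) ↔ v ∈ verts F ∨ fl i v ∈ verts F := by
  simp only [mem_verts]
  constructor
  · intro hv
    by_cases h0 : some (v i) = F i
    · left
      intro j
      by_cases hj : j = i
      · subst hj; exact Or.inr h0
      · have := hv j
        rwa [upd_ne _ _ hj] at this
    · right
      intro j
      by_cases hj : j = i
      · subst hj
        right
        rw [fl_same]
        rcases opt_cases (F j) with h1 | h1 | h1
        · exact absurd h1 h
        · rw [h1] at h0 ⊢
          simpa using h0
        · rw [h1] at h0 ⊢
          simpa using h0
      · have := hv j
        rw [upd_ne _ _ hj] at this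
        rwa [fl_ne _ hj]
  · rintro (hv | hv) j
    · by_cases hj : j = i
      · subst hj; left; simp
      · rw [upd_ne _ _ hj]; exact hv j
    · by_cases hj : j = i
      · subst hj; left; simp
      · rw [upd_ne _ _ hj]
        have := hv j
        rwa [fl_ne _ hj] at this

lemma fl_mem {F : CubeFace a} {i : Fin a} {v : Fin a → Bool} (h : F i = none) (hv : v ∈ verts F) :
    fl i v ∈ verts F := by
  intro j
  by_cases hj : j = i
  · subst hj; exact Or.inl h
  · have := hv j
    simpa [toFace, fl_ne _ hj] using this

lemma fl_not_mem {F : CubeFace a} {i : Fin a} {v : Fin a → Bool} (h : F i ≠ none) (hv : v ∈ verts F) :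
    fl i v ∉ verts F := by
  intro h1
  have h2 := (mem_verts.1 hv i).resolve_left h
  have h3 := (mem_verts.1 h1 i).resolve_left h
  rw [← h2] at h3
  simp at h3

/-- The free coordinates in terms of vertices. -/
lemma free_of_mem {F : CubeFace a} {i : Fin a} {v : Fin a → Bool} (hv : v ∈ verts F)
    (hv' : fl i v ∈ verts F) : F i = none := by
  by_contra h
  exact fl_not_mem h hv hv'

lemma agree {F : CubeFace a} {i : Fin a} {v w : Fin a → Bool} (hv : v ∈ verts F)
    (hw : w ∈ verts F) (h : F i ≠ none) : v i = w i := by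
  have h2 := (mem_verts.1 hv i).resolve_left h
  have h3 := (mem_verts.1 hw i).resolve_left h
  exact Option.some.inj (h2.trans h3.symm)

lemma edge_lemma {F : CubeFace a} (hd : dim F = 1) {v w : Fin a → Bool} (hv : v ∈ verts F)
    (hw : w ∈ verts F) (hne : w ≠ v) : ∃ c, w = fl c v := by
  obtain ⟨c, hc⟩ := exists_free (F := F) (by omega)
  have huniq : ∀ i, i ≠ c → F i ≠ none := by
    intro i hi h
    have h1 := dim_upd_some hc true
    have h2 := dim_upd_some (F := upd F c (some true)) (i := i) (by rw [upd_ne _ _ hi, h]) true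
    omega
  refine ⟨c, ?_⟩
  have hag : ∀ i, i ≠ c → w i = v i := fun i hi => agree hw hv (huniq i hi)
  funext i
  by_cases hi : i = c
  · subst hi
    rw [fl_same]
    by_contra h
    apply hne
    funext j
    by_cases hj : j = i
    · subst hj
      revert h
      cases w j <;> cases v j <;> simp
    · exact hag j hj
  · rw [fl_ne _ hi, hag i hi]

lemma square_lemma {F : CubeFace a} (hd : dim F = 2) {x y : Fin a → Bool} {c e : Fin a}
    (hx : x ∈ verts F) (hc : fl c x ∈ verts F) (he : fl e x ∈ verts F) (hy : y ∈ verts F)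
    (hce : fl c x ≠ fl e x) (h1 : y ≠ x) (h2 : y ≠ fl c x) (h3 : y ≠ fl e x) :
    y = fl c (fl e x) := by
  have hne : c ≠ e := fun h => hce (by rw [h])
  have fc := free_of_mem hx hc
  have fe := free_of_mem hx he
  have huniq : ∀ i, i ≠ c → i ≠ e → F i ≠ none := by
    intro i hi hi' h
    have p1 := dim_upd_some fc true
    have p2 := dim_upd_some (F := upd F c (some true)) (i := e) (by rw [upd_ne _ _ hne.symm, fe]) true
    have p3 := dim_upd_some (F := upd (upd F c (some true)) e (some true)) (i := i)
      (by rw [upd_ne _ _ hi', upd_ne _ _ hi, h]) true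
    omega
  have hag : ∀ i, i ≠ c → i ≠ e → y i = x i := fun i hi hi' => agree hy hx (huniq i hi hi')
  have key : ∀ z : Fin a → Bool, z c = y c → z e = y e → (∀ i, i ≠ c → i ≠ e → z i = x i) → y = z := by
    intro z hz1 hz2 hz3
    funext i
    by_cases hi : i = c
    · rw [hi, hz1]
    · by_cases hi' : i = e
      · rw [hi', hz2]
      · rw [hz3 i hi hi', hag i hi hi']
  by_cases q1 : y c = x c
  · exfalso
    by_cases q2 : y e = x e
    · exact h1 (key x q1.symm q2.symm (fun _ _ _ => rfl))
    · refine h3 (key _ ?_ ?_ ?_)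
      · rw [fl_ne _ hne, q1]
      · rw [fl_same]; revert q2; cases y e <;> cases x e <;> simp
      · intro i hi hi'; rw [fl_ne _ hi']
  · by_cases q2 : y e = x e
    · exfalso
      refine h2 (key _ ?_ ?_ ?_)
      · rw [fl_same]; revert q1; cases y c <;> cases x c <;> simp
      · rw [fl_ne _ hne.symm, q2]
      · intro i hi hi'; rw [fl_ne _ hi]
    · refine key _ ?_ ?_ ?_
      · rw [fl_same, fl_ne _ hne]; revert q1; cases y c <;> cases x c <;> simp
      · rw [fl_ne _ hne.symm, fl_same]; revert q2; cases y e <;> cases x e <;> simp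
      · intro i hi hi'; rw [fl_ne _ hi, fl_ne _ hi']

end

end CubMan

/-! ## Images of faces -/

namespace CubMan

open CubeFace

section
variable {a b : ℕ}

lemma upd_none_le {K F : CubeFace a} {i : Fin a} (h : K ≤ F) (hi : F i = none) : upd K i none ≤ F := by
  intro j
  by_cases hj : j = i
  · subst hj; exact Or.inl hi
  · rw [upd_ne _ _ hj]; exact h j

open Classical in
/-- The facets of a face. -/
noncomputable def fac (F : CubeFace a) : Finset (CubeFace a) :=
  Finset.univ.filter (fun K => K ≤ F ∧ dim K + 1 = dim F)

lemma mem_fac {F K : CubeFace a} : K ∈ fac F ↔ K ≤ F ∧ dim K + 1 = dim F := by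
  simp [fac]

open Classical in
lemma sum_fac {R : Type} [AddCommMonoid R] (φ : CubeFace a → R) (F : CubeFace a) :
    ∑ p ∈ (Finset.univ.filter (fun i => F i = none)) ×ˢ (Finset.univ : Finset Bool),
      φ (upd F p.1 (some p.2)) = ∑ K ∈ fac F, φ K := by
  refine Finset.sum_bij (fun p _ => upd F p.1 (some p.2)) ?_ ?_ ?_ ?_
  · rintro ⟨i, t⟩ hp
    simp only [Finset.mem_product, Finset.mem_filter, Finset.mem_univ, true_and, and_true] at hp
    exact mem_fac.2 ⟨upd_le hp _, dim_upd_some hp t⟩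
  · rintro ⟨i, t⟩ hp ⟨j, s⟩ hq h
    simp only [Finset.mem_product, Finset.mem_filter, Finset.mem_univ, true_and, and_true] at hp hq h
    have h1 := congrFun h i
    by_cases hij : i = j
    · subst hij
      simp at h1
      rw [h1]
    · rw [upd_same, upd_ne _ _ hij, hp] at h1
      cases h1
  · intro K hK
    obtain ⟨h1, h2⟩ := mem_fac.1 hK
    obtain ⟨i, hi, hF⟩ := covers h1 h2.symm
    obtain ⟨t, ht⟩ := Option.ne_none_iff_exists'.1 hi
    refine ⟨(i, t), ?_, ?_⟩
    · simp [hF]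
    · simp only
      rw [hF, upd_upd, upd_eq_self _ _ ht]
  · intros; rfl

lemma card_fac (F : CubeFace a) : (fac F).card = dim F * 2 := by
  classical
  have h := sum_fac (fun _ => (1 : ℕ)) F
  simp only [Finset.sum_const, smul_eq_mul, mul_one] at h
  rw [← h, Finset.card_product, dim_eq]
  simp

lemma dl_fac (φ : CubeFace a → ZMod 2) (F : CubeFace a) : dl φ F = ∑ K ∈ fac F, φ K := by
  classical
  rw [← sum_fac, Finset.sum_product, Finset.sum_filter]
  unfold dl
  refine Finset.sum_congr rfl (fun i _ => ?_)
  by_cases h : F i = none <;> simp [h]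

lemma under_facet {G G' : CubeFace a} (h : G' ≤ G) (hne : G' ≠ G) : ∃ K ∈ fac G, G' ≤ K := by
  have : ∃ i, G' i ≠ G i := by
    by_contra hc
    push Not at hc
    exact hne (funext hc)
  obtain ⟨i, hi⟩ := this
  have hG : G i = none := (h i).resolve_right hi
  rw [hG] at hi
  obtain ⟨t, ht⟩ := Option.ne_none_iff_exists'.1 hi
  refine ⟨upd G i (some t), mem_fac.2 ⟨upd_le hG _, dim_upd_some hG t⟩, ?_⟩
  intro j
  by_cases hj : j = i
  · subst hj; right; rw [upd_same, ht]
  · rw [upd_ne _ _ hj]; exact h j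

lemma fl_inj {c e : Fin a} {x : Fin a → Bool} (h : fl c x = fl e x) : c = e := by
  by_contra hne
  have := congrFun h c
  rw [fl_same, fl_ne _ hne] at this
  simp at this

lemma image_face {N : Set (CubeFace b)} {F : CubeFace a} {f : (Fin a → Bool) → (Fin b → Bool)}
    (hinj : Set.InjOn f (verts F)) (h3 : 3 ≤ dim F)
    (ih : ∀ F', F' ≤ F → F' ≠ F → ∃ G ∈ N, dim G = dim F' ∧ verts G = f '' verts F') :
    ∃ G : CubeFace b, dim G = dim F ∧ verts G = f '' verts F := by
  classical
  obtain ⟨i, hi⟩ := exists_free (F := F) (by omega)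
  have ih' : ∀ F', F' ≤ F → dim F' < dim F → ∃ G ∈ N, dim G = dim F' ∧ verts G = f '' verts F' :=
    fun F' h1 h2 => ih F' h1 (fun h => by rw [h] at h2; omega)
  obtain ⟨F0, hF0⟩ : ∃ F0, F0 = upd F i (some false) := ⟨_, rfl⟩
  have hle : F0 ≤ F := hF0 ▸ upd_le hi _
  have hdim : dim F0 + 1 = dim F := hF0 ▸ dim_upd_some hi false
  have hFi : F0 i ≠ none := by rw [hF0, upd_same]; simp
  have hF : F = upd F0 i none := by rw [hF0, upd_upd, upd_eq_self _ _ hi]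
  have hsub : verts F0 ⊆ verts F := verts_sub.2 hle
  obtain ⟨G0, hG0N, hG0d, hG0⟩ := ih' F0 hle (by omega)
  -- edges
  have edge : ∀ u ∈ verts F, ∀ j, F j = none → ∃ c, f (fl j u) = fl c (f u) := by
    intro u hu j hj
    obtain ⟨G, -, hGd, hG⟩ := ih' (upd (toFace u) j none) (upd_none_le hu hj) (by
      rw [dim_upd_none (by simp [toFace]), dim_toFace]; omega)
    have hu1 : u ∈ verts (upd (toFace u) j none) := le_upd_none _ _
    have hu2 : fl j u ∈ verts (upd (toFace u) j none) := fl_mem (by simp) hu1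
    refine edge_lemma (F := G) ?_ ?_ ?_ ?_
    · rw [hGd, dim_upd_none (by simp [toFace]), dim_toFace]
    · rw [hG]; exact ⟨u, hu1, rfl⟩
    · rw [hG]; exact ⟨_, hu2, rfl⟩
    · intro h
      exact fl_self_ne j u (hinj (fl_mem hj hu) hu h)
  obtain ⟨u0, hu0⟩ : ∃ u0, u0 ∈ verts F0 := ⟨_, vv_mem F0 true⟩
  obtain ⟨c, hc⟩ := edge u0 (hsub hu0) i hi
  have step : ∀ u ∈ verts F0, ∀ j, F0 j = none → f (fl i u) = fl c (f u) →
      f (fl i (fl j u)) = fl c (f (fl j u)) := by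
    intro u hu j hj hcu
    have hij : j ≠ i := fun h => hFi (h ▸ hj)
    have hFj : F j = none := by rw [hF, upd_ne _ _ hij, hj]
    have huF := hsub hu
    obtain ⟨e, he⟩ := edge u huF j hFj
    obtain ⟨Q, hQ⟩ : ∃ Q, Q = upd (upd (toFace u) i none) j none := ⟨_, rfl⟩
    have hQd : dim Q = 2 := by
      rw [hQ, dim_upd_none (by rw [upd_ne _ _ hij]; simp [toFace]),
        dim_upd_none (by simp [toFace]), dim_toFace]
    have hQle : Q ≤ F := hQ ▸ upd_none_le (upd_none_le huF hi) hFj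
    have hQi : Q i = none := by rw [hQ, upd_ne _ _ hij.symm, upd_same]
    have hQj : Q j = none := by rw [hQ, upd_same]
    have hQu : u ∈ verts Q := by
      rw [hQ]
      exact le_trans (le_upd_none (toFace u) i) (le_upd_none _ _)
    obtain ⟨G, -, hGd, hG⟩ := ih' Q hQle (by omega)
    have hQF : verts Q ⊆ verts F := verts_sub.2 hQle
    have m1 : f u ∈ verts G := by rw [hG]; exact ⟨_, hQu, rfl⟩
    have m2 : f (fl i u) ∈ verts G := by rw [hG]; exact ⟨_, fl_mem hQi hQu, rfl⟩
    have m3 : f (fl j u) ∈ verts G := by rw [hG]; exact ⟨_, fl_mem hQj hQu, rfl⟩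
    have m4 : f (fl i (fl j u)) ∈ verts G := by
      rw [hG]; exact ⟨_, fl_mem hQi (fl_mem hQj hQu), rfl⟩
    have n1 : ∀ x ∈ verts Q, ∀ y ∈ verts Q, f x = f y → x = y := fun x hx y hy h =>
      hinj (hQF hx) (hQF hy) h
    have := square_lemma (F := G) (by omega) (x := f u) (y := f (fl i (fl j u))) (c := c) (e := e)
      m1 (hcu ▸ m2) (he ▸ m3) m4 ?_ ?_ ?_ ?_
    · rw [this, he]
    · rw [← hcu, ← he]
      intro h
      exact hij (fl_inj (n1 _ (fl_mem hQi hQu) _ (fl_mem hQj hQu) h)).symm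
    · intro h
      have h := n1 _ (fl_mem hQi (fl_mem hQj hQu)) _ hQu h
      have h' := congrFun h i
      rw [fl_same, fl_ne _ hij.symm] at h'
      simp at h'
    · rw [← hcu]
      intro h
      have h := n1 _ (fl_mem hQi (fl_mem hQj hQu)) _ (fl_mem hQi hQu) h
      have h' := congrFun h j
      rw [fl_ne _ hij, fl_ne _ hij, fl_same] at h'
      simp at h'
    · rw [← he]
      intro h
      have h := n1 _ (fl_mem hQi (fl_mem hQj hQu)) _ (fl_mem hQj hQu) h
      exact fl_self_ne _ _ h
  have const : ∀ n, ∀ u ∈ verts F0, (Finset.univ.filter (fun j => u j ≠ u0 j)).card = n →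
      f (fl i u) = fl c (f u) := by
    intro n
    induction n with
    | zero =>
      intro u hu h
      have : u = u0 := by
        funext j
        by_contra hj
        have : j ∈ Finset.univ.filter (fun j => u j ≠ u0 j) := by simp [hj]
        rw [Finset.card_eq_zero.1 h] at this
        simp at this
      rw [this, hc]
    | succ n IH =>
      intro u hu h
      obtain ⟨j, hj⟩ := Finset.card_pos.1 (show 0 < (Finset.univ.filter (fun j => u j ≠ u0 j)).card by omega)
      have hj' : u j ≠ u0 j := by simpa using hj
      have hFj : F0 j = none := by
        by_contra hh
        exact hj' (agree hu hu0 hh)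
      have he : Finset.univ.filter (fun k => fl j u k ≠ u0 k) =
          (Finset.univ.filter (fun j => u j ≠ u0 j)).erase j := by
        ext k
        simp only [Finset.mem_filter, Finset.mem_univ, true_and, Finset.mem_erase]
        by_cases hk : k = j
        · subst hk
          rw [fl_same]
          revert hj'
          cases u k <;> cases u0 k <;> simp
        · rw [fl_ne _ hk]; simp [hk]
      have h1 := IH (fl j u) (fl_mem hFj hu) (by rw [he, Finset.card_erase_of_mem hj, h]; rfl)
      have h2 := step (fl j u) (fl_mem hFj hu) j hFj h1
      rwa [fl_fl] at h2
  have hcc : ∀ u ∈ verts F0, f (fl i u) = fl c (f u) := fun u hu => const _ u hu rfl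
  have hG0c : G0 c ≠ none := by
    intro h
    have h1 : fl c (f u0) ∈ verts G0 := fl_mem h (by rw [hG0]; exact ⟨_, hu0, rfl⟩)
    rw [hG0, ← hc] at h1
    obtain ⟨w, hw, hwe⟩ := h1
    have := hinj (hsub hw) (fl_mem hi (hsub hu0)) hwe
    exact fl_not_mem hFi hu0 (this ▸ hw)
  refine ⟨upd G0 c none, by rw [dim_upd_none hG0c]; omega, ?_⟩
  ext v
  rw [mem_upd_none hG0c, hG0]
  constructor
  · rintro (⟨w, hw, rfl⟩ | ⟨w, hw, hwe⟩)
    · exact ⟨w, hsub hw, rfl⟩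
    · refine ⟨fl i w, fl_mem hi (hsub hw), ?_⟩
      rw [hcc w hw, hwe, fl_fl]
  · rintro ⟨w, hw, rfl⟩
    rw [hF, mem_upd_none hFi] at hw
    rcases hw with hw | hw
    · exact Or.inl ⟨w, hw, rfl⟩
    · right
      refine ⟨_, hw, ?_⟩
      have := hcc _ hw
      rw [fl_fl] at this
      rw [this, fl_fl]

lemma image_proper {N : Set (CubeFace b)} (hN : ∀ F ∈ N, ∀ G, G ≤ F → G ∈ N) {F : CubeFace a}
    {G : CubeFace b} {f : (Fin a → Bool) → (Fin b → Bool)}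
    (hinj : Set.InjOn f (verts F)) (hd : dim G = dim F) (hG : verts G = f '' verts F)
    (ih : ∀ F', F' ≤ F → F' ≠ F → ∃ G ∈ N, dim G = dim F' ∧ verts G = f '' verts F') :
    ∀ G', G' ≤ G → G' ≠ G → G' ∈ N := by
  classical
  have ih' : ∀ K, K ∈ fac F → ∃ L ∈ N, dim L = dim K ∧ verts L = f '' verts K := by
    intro K hK
    obtain ⟨h1, h2⟩ := mem_fac.1 hK
    exact ih K h1 (fun h => by rw [h] at h2; omega)
  haveI : Nonempty (CubeFace b) := ⟨G⟩
  choose! s hsN hsd hsv using ih'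
  have hsub : (fac F).image s ⊆ fac G := by
    intro L hL
    obtain ⟨K, hK, rfl⟩ := Finset.mem_image.1 hL
    obtain ⟨h1, h2⟩ := mem_fac.1 hK
    refine mem_fac.2 ⟨?_, by rw [hsd K hK, h2, hd]⟩
    rw [← verts_sub, hsv K hK, hG]
    exact Set.image_mono (verts_sub.2 h1)
  have hcard : ((fac F).image s).card = (fac F).card := by
    apply Finset.card_image_of_injOn
    intro K hK K' hK' h
    have h1 := (mem_fac.1 hK).1
    have h2 := (mem_fac.1 hK').1
    have h3 : f '' verts K = f '' verts K' := by rw [← hsv K hK, ← hsv K' hK', h]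
    exact verts_inj ((hinj.image_eq_image_iff (verts_sub.2 h1) (verts_sub.2 h2)).1 h3)
  have heq := Finset.eq_of_subset_of_card_le hsub (by rw [hcard, card_fac, card_fac, hd])
  intro G' h1 h2
  obtain ⟨K, hK, hle⟩ := under_facet h1 h2
  rw [← heq] at hK
  obtain ⟨L, hL, rfl⟩ := Finset.mem_image.1 hK
  exact hN _ (hsN L hL) _ hle

end

end CubMan

/-! ## Transfer along an isomorphism of skeleta -/

namespace CubMan

open CubeFace

section
variable {a b : ℕ}

/-- Mutually inverse isomorphisms of `r`-skeleta. -/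
structure SI (M : Set (CubeFace a)) (N : Set (CubeFace b)) (r : ℕ)
    (f : (Fin a → Bool) → (Fin b → Bool)) (g : (Fin b → Bool) → (Fin a → Bool)) : Prop where
  mf : ∀ v ∈ cvert M, f v ∈ cvert N
  mg : ∀ v ∈ cvert N, g v ∈ cvert M
  gf : ∀ v ∈ cvert M, g (f v) = v
  fg : ∀ v ∈ cvert N, f (g v) = v
  fw : ∀ F ∈ M, dim F ≤ r → ∃ G ∈ N, dim G = dim F ∧ verts G = f '' verts F
  bw : ∀ G ∈ N, dim G ≤ r → ∃ F ∈ M, dim F = dim G ∧ verts F = g '' verts G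

lemma SI.symm {M : Set (CubeFace a)} {N : Set (CubeFace b)} {r : ℕ}
    {f : (Fin a → Bool) → (Fin b → Bool)} {g : (Fin b → Bool) → (Fin a → Bool)}
    (h : SI M N r f g) : SI N M r g f :=
  ⟨h.mg, h.mf, h.fg, h.gf, h.bw, h.fw⟩

lemma vsub {M : Set (CubeFace a)} (hM : ∀ F ∈ M, ∀ G, G ≤ F → G ∈ M) {F : CubeFace a} (hF : F ∈ M) :
    verts F ⊆ cvert M := fun _ hv => hM F hF _ hv

lemma SI.inj {M : Set (CubeFace a)} {N : Set (CubeFace b)} {r : ℕ}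
    {f : (Fin a → Bool) → (Fin b → Bool)} {g : (Fin b → Bool) → (Fin a → Bool)}
    (h : SI M N r f g) : Set.InjOn f (cvert M) := by
  intro x hx y hy hxy
  rw [← h.gf x hx, ← h.gf y hy, hxy]

lemma SI.gfim {M : Set (CubeFace a)} {N : Set (CubeFace b)} {r : ℕ}
    {f : (Fin a → Bool) → (Fin b → Bool)} {g : (Fin b → Bool) → (Fin a → Bool)}
    (h : SI M N r f g) {W : Set (Fin a → Bool)} (hW : W ⊆ cvert M) : g '' (f '' W) = W := by
  rw [Set.image_image]
  ext x
  constructor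
  · rintro ⟨y, hy, rfl⟩
    dsimp only
    rwa [h.gf y (hW hy)]
  · intro hx
    exact ⟨x, hx, h.gf x (hW hx)⟩

/-- From image under `f` to image under `g`. -/
lemma SI.flip {M : Set (CubeFace a)} {N : Set (CubeFace b)} {r : ℕ}
    {f : (Fin a → Bool) → (Fin b → Bool)} {g : (Fin b → Bool) → (Fin a → Bool)}
    (h : SI M N r f g) (hM : ∀ F ∈ M, ∀ G, G ≤ F → G ∈ M) {F : CubeFace a} {G : CubeFace b}
    (hF : F ∈ M) (hv : verts G = f '' verts F) : verts F = g '' verts G := by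
  rw [hv, h.gfim (vsub hM hF)]

open Classical in
/-- Pull back cochains of dimension at most `r`. -/
noncomputable def pl (M : Set (CubeFace a)) (N : Set (CubeFace b)) (r : ℕ)
    (f : (Fin a → Bool) → (Fin b → Bool)) (φ : CubeFace b → ZMod 2) (F : CubeFace a) : ZMod 2 :=
  if h : F ∈ M ∧ dim F ≤ r ∧ ∃ G ∈ N, verts G = f '' verts F then φ h.2.2.choose else 0

lemma pl_eq {M : Set (CubeFace a)} {N : Set (CubeFace b)} {r : ℕ}
    {f : (Fin a → Bool) → (Fin b → Bool)} (φ : CubeFace b → ZMod 2) {F : CubeFace a} {G : CubeFace b}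
    (hF : F ∈ M) (hd : dim F ≤ r) (hG : G ∈ N) (hv : verts G = f '' verts F) :
    pl M N r f φ F = φ G := by
  have h : F ∈ M ∧ dim F ≤ r ∧ ∃ G ∈ N, verts G = f '' verts F := ⟨hF, hd, G, hG, hv⟩
  rw [pl, dif_pos h]
  congr 1
  exact verts_inj (h.2.2.choose_spec.2.trans hv.symm)

lemma pl_ne {M : Set (CubeFace a)} {N : Set (CubeFace b)} {r : ℕ}
    {f : (Fin a → Bool) → (Fin b → Bool)} {φ : CubeFace b → ZMod 2} {F : CubeFace a}
    (h : pl M N r f φ F ≠ 0) :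
    F ∈ M ∧ dim F ≤ r ∧ ∃ G ∈ N, verts G = f '' verts F ∧ φ G ≠ 0 := by
  rw [pl] at h
  split_ifs at h with hh
  · exact ⟨hh.1, hh.2.1, _, hh.2.2.choose_spec.1, hh.2.2.choose_spec.2, h⟩
  · exact absurd rfl h

lemma pl_dl {M : Set (CubeFace a)} {N : Set (CubeFace b)} {r : ℕ}
    {f : (Fin a → Bool) → (Fin b → Bool)} {g : (Fin b → Bool) → (Fin a → Bool)}
    (h : SI M N r f g) (hM : ∀ F ∈ M, ∀ G, G ≤ F → G ∈ M) (hN : ∀ F ∈ N, ∀ G, G ≤ F → G ∈ N)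
    (φ : CubeFace b → ZMod 2) {F : CubeFace a} {G : CubeFace b}
    (hF : F ∈ M) (hd : dim F ≤ r) (hG : G ∈ N) (hv : verts G = f '' verts F) :
    dl (pl M N r f φ) F = dl φ G := by
  have hinj := h.inj
  have hGd : dim G = dim F := dim_of_image (hinj.mono (vsub hM hF)) hv
  rw [dl_fac, dl_fac]
  haveI : Nonempty (CubeFace b) := ⟨G⟩
  have fw := h.fw
  choose! s hsN hsd hsv using fw
  have hK : ∀ K, K ∈ fac F → K ∈ M ∧ dim K ≤ r := by
    intro K hK
    obtain ⟨h1, h2⟩ := mem_fac.1 hK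
    exact ⟨hM _ hF _ h1, by omega⟩
  refine Finset.sum_bij (fun K _ => s K) ?_ ?_ ?_ ?_
  · intro K hKF
    obtain ⟨h1, h2⟩ := mem_fac.1 hKF
    obtain ⟨h3, h4⟩ := hK K hKF
    refine mem_fac.2 ⟨?_, by rw [hsd K h3 h4]; omega⟩
    rw [← verts_sub, hsv K h3 h4, hv]
    exact Set.image_mono (verts_sub.2 h1)
  · intro K hKF K' hKF' he
    obtain ⟨h3, h4⟩ := hK K hKF
    obtain ⟨h3', h4'⟩ := hK K' hKF'
    have h5 : f '' verts K = f '' verts K' := by rw [← hsv K h3 h4, ← hsv K' h3' h4']; simp only [he]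
    exact verts_inj ((hinj.image_eq_image_iff (vsub hM h3) (vsub hM h3')).1 h5)
  · intro L hL
    obtain ⟨h1, h2⟩ := mem_fac.1 hL
    have hLN := hN _ hG _ h1
    obtain ⟨K, hKM, hKd, hKv⟩ := h.bw L hLN (by omega)
    refine ⟨K, mem_fac.2 ⟨?_, by omega⟩, ?_⟩
    · rw [← verts_sub, hKv, h.flip hM hF hv]
      exact Set.image_mono (verts_sub.2 h1)
    · apply verts_inj
      rw [hsv K hKM (by omega), hKv, h.symm.gfim (vsub hN hLN)]
  · intro K hKF
    obtain ⟨h3, h4⟩ := hK K hKF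
    exact pl_eq φ h3 h4 (hsN K h3 h4) (hsv K h3 h4)

lemma transfer {M : Set (CubeFace a)} {N : Set (CubeFace b)} {r : ℕ}
    {f : (Fin a → Bool) → (Fin b → Bool)} {g : (Fin b → Bool) → (Fin a → Bool)}
    (h : SI M N r f g) (hM : ∀ F ∈ M, ∀ G, G ≤ F → G ∈ M) (hN : ∀ F ∈ N, ∀ G, G ≤ F → G ∈ N)
    (hc : Coh N r) {F : CubeFace a} {G : CubeFace b} (hF : F ∈ M) (hv : verts G = f '' verts F)
    {j : ℕ} (hj : j ≤ r) (hE : ExactAt M F j) : ExactAt N G j := by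
  intro x hx hdx
  obtain ⟨x', hx'⟩ : ∃ x', x' = pl M N r f x := ⟨_, rfl⟩
  have hsx' : ∀ H, x' H ≠ 0 → H ∈ M ∧ dim H = j ∧ ∃ G1, G1 ≤ F ∧ G1 ≤ H := by
    intro H hH
    rw [hx'] at hH
    obtain ⟨h1, h2, L, h3, h4, h5⟩ := pl_ne hH
    obtain ⟨h6, h7, G1, h8, h9⟩ := hx L h5
    refine ⟨h1, by rw [← h7]; exact (dim_of_image (h.inj.mono (vsub hM h1)) h4).symm, ?_⟩
    have m1 : vv G1 true ∈ verts G := verts_sub.2 h8 (vv_mem _ _)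
    have m2 : vv G1 true ∈ verts L := verts_sub.2 h9 (vv_mem _ _)
    rw [hv] at m1
    rw [h4] at m2
    obtain ⟨v, hv1, hv2⟩ := m1
    obtain ⟨w, hw1, hw2⟩ := m2
    have : v = w := h.inj (vsub hM hF hv1) (vsub hM h1 hw1) (hv2.trans hw2.symm)
    subst this
    exact ⟨toFace v, hv1, hw1⟩
  have hdx' : ∀ H ∈ M, dl x' H = 0 := by
    intro H hH
    by_contra hne
    obtain ⟨K, hK1, hK2, hK3⟩ := dl_supp hne
    have hKj := (hsx' K hK1).2.1
    by_cases hjr : j + 1 ≤ r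
    · obtain ⟨L, hL1, hL2, hL3⟩ := h.fw H hH (by omega)
      rw [hx', pl_dl h hM hN x hH (by omega) hL1 hL3, hdx L hL1] at hne
      exact hne rfl
    · have hjr : j = r := by omega
      obtain ⟨ψ, hψ1, hψ2⟩ := hc x (fun H hH => ⟨(hx H hH).1, by rw [(hx H hH).2.1, hjr]⟩) hdx
      apply hne
      have e : dl x' H = dl (dl (pl M N r f ψ)) H := by
        rw [dl_fac, dl_fac]
        refine Finset.sum_congr rfl (fun K' hK' => ?_)
        obtain ⟨p1, p2⟩ := mem_fac.1 hK'
        have p3 := hM _ hH _ p1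
        have p4 : dim K' ≤ r := by omega
        obtain ⟨L, hL1, hL2, hL3⟩ := h.fw K' p3 p4
        rw [hx', pl_eq x p3 p4 hL1 hL3, pl_dl h hM hN ψ p3 p4 hL1 hL3, hψ2 L hL1]
      rw [e, dl_dl]
  obtain ⟨y', hy1, hy2⟩ := hE x' hsx' hdx'
  have hvF := h.flip hM hF hv
  refine ⟨pl N M r g y', ?_, ?_⟩
  · intro H hH
    obtain ⟨h1, h2, K, h3, h4, h5⟩ := pl_ne hH
    obtain ⟨h6, h7, G1, h8, h9⟩ := hy1 K h5
    have hd : dim K = dim H := dim_of_image (h.symm.inj.mono (vsub hN h1)) h4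
    refine ⟨h1, by omega, ?_⟩
    refine ⟨toFace (f (vv G1 true)), ?_, ?_⟩
    · change f (vv G1 true) ∈ verts G
      rw [hv]
      exact ⟨_, verts_sub.2 h8 (vv_mem _ _), rfl⟩
    · change f (vv G1 true) ∈ verts H
      rw [h.symm.flip hN h1 h4]
      exact ⟨_, verts_sub.2 h9 (vv_mem _ _), rfl⟩
  · intro H hH
    by_cases hHj : dim H = j
    · obtain ⟨K, hK1, hK2, hK3⟩ := h.bw H hH (by omega)
      rw [pl_dl h.symm hN hM y' hH (by omega) hK1 hK3, hy2 K hK1, hx']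
      exact pl_eq x hK1 (by omega) hH (h.symm.flip hN hH hK3)
    · have h1 : x H = 0 := by
        by_contra hne
        exact hHj (hx H hne).2.1
      rw [h1]
      by_contra hne
      obtain ⟨K, hK1, hK2, hK3⟩ := dl_supp hne
      obtain ⟨q1, q2, L, q3, q4, q5⟩ := pl_ne hK1
      have hd : dim L = dim K := dim_of_image (h.symm.inj.mono (vsub hN q1)) q4
      have := (hy1 L q5).2.1
      omega

lemma main_claim {M : Set (CubeFace a)} {N : Set (CubeFace b)} {r : ℕ} (hr : 2 ≤ r)
    {f : (Fin a → Bool) → (Fin b → Bool)} {g : (Fin b → Bool) → (Fin a → Bool)}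
    (h : SI M N r f g) (hM : LocM M (2 * r)) (hN : LocM N (2 * r)) (hc : Coh N r) :
    ∀ k, ∀ F ∈ M, dim F = k → ∃ G ∈ N, dim G = dim F ∧ verts G = f '' verts F := by
  intro k
  induction k using Nat.strong_induction_on with
  | _ k ih =>
    intro F hF hk
    by_cases hkr : k ≤ r
    · exact h.fw F hF (by omega)
    have ih' : ∀ F', F' ≤ F → F' ≠ F → ∃ G ∈ N, dim G = dim F' ∧ verts G = f '' verts F' := by
      intro F' h1 h2
      refine ih (dim F') ?_ F' (hM.down _ hF _ h1) rfl
      by_contra hlt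
      exact h2 (eq_of_le_dim h1 (by omega))
    have hinj := h.inj.mono (vsub hM.down hF)
    obtain ⟨G, hGd, hGv⟩ := image_face hinj (by omega) ih'
    have hp := image_proper hN.down hinj hGd hGv ih'
    refine ⟨G, ?_, hGd, hGv⟩
    by_contra hG
    have hle := hM.dimle F hF
    obtain ⟨j, hj⟩ : ∃ j, dim F + j = 2 * r + 1 := ⟨2 * r + 1 - dim F, by omega⟩
    exact dual_not hN hG hp j (by omega) (by omega)
      (transfer h hM.down hN.down hc hF hGv (by omega) (dual_exact hM hF j hj (by omega)))

lemma cvert_skel (M : Set (CubeFace a)) (r : ℕ) : cvert (skel r M) = cvert M := by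
  ext v
  change (toFace v ∈ M ∧ dim (toFace v) ≤ r) ↔ toFace v ∈ M
  rw [dim_toFace]
  simp

lemma exists_SI {M : Set (CubeFace a)} {N : Set (CubeFace b)} {r : ℕ}
    (hM : ∀ F ∈ M, ∀ G, G ≤ F → G ∈ M) (hN : ∀ F ∈ N, ∀ G, G ≤ F → G ∈ N)
    (h : Iso (skel r M) (skel r N)) : ∃ f g, SI M N r f g := by
  obtain ⟨f, hb, hf⟩ := h
  rw [cvert_skel, cvert_skel] at hb
  rw [cvert_skel] at hf
  have hgm : ∀ v ∈ cvert N, Function.invFunOn f (cvert M) v ∈ cvert M ∧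
      f (Function.invFunOn f (cvert M) v) = v := fun v hv =>
    ⟨Function.invFunOn_mem (hb.surjOn hv), Function.invFunOn_eq (hb.surjOn hv)⟩
  refine ⟨f, Function.invFunOn f (cvert M), fun v hv => hb.mapsTo hv, fun v hv => (hgm v hv).1, ?_,
    fun v hv => (hgm v hv).2, ?_, ?_⟩
  · intro v hv
    have := hgm _ (hb.mapsTo hv)
    exact hb.injOn this.1 hv this.2
  · intro F hF hd
    obtain ⟨G, hG, hGv⟩ := (hf (verts F) (vsub hM hF)).1 ⟨F, ⟨hF, hd⟩, rfl⟩
    exact ⟨G, hG.1, dim_of_image (hb.injOn.mono (vsub hM hF)) hGv, hGv⟩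
  · intro G hG hd
    have hsub : Function.invFunOn f (cvert M) '' verts G ⊆ cvert M := by
      rintro _ ⟨w, hw, rfl⟩
      exact (hgm w (vsub hN hG hw)).1
    have him : f '' (Function.invFunOn f (cvert M) '' verts G) = verts G := by
      rw [Set.image_image]
      ext x
      constructor
      · rintro ⟨y, hy, rfl⟩
        dsimp only
        rwa [(hgm y (vsub hN hG hy)).2]
      · intro hx
        exact ⟨x, hx, (hgm x (vsub hN hG hx)).2⟩
    obtain ⟨F, hF, hFv⟩ := (hf _ hsub).2 ⟨G, ⟨hG, hd⟩, him.symm⟩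
    refine ⟨F, hF.1, ?_, hFv⟩
    refine dim_of_image (f := Function.invFunOn f (cvert M)) ?_ hFv
    intro x hx y hy hxy
    rw [← (hgm x (vsub hN hG hx)).2, ← (hgm y (vsub hN hG hy)).2, hxy]

lemma iso_of {M : Set (CubeFace a)} {N : Set (CubeFace b)} {r : ℕ}
    {f : (Fin a → Bool) → (Fin b → Bool)} {g : (Fin b → Bool) → (Fin a → Bool)}
    (h : SI M N r f g)
    (h1 : ∀ F ∈ M, ∃ G ∈ N, dim G = dim F ∧ verts G = f '' verts F)
    (h2 : ∀ G ∈ N, ∃ F ∈ M, dim F = dim G ∧ verts F = g '' verts G) : Iso M N := by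
  refine ⟨f, ⟨fun v hv => h.mf v hv, h.inj, fun v hv => ⟨g v, h.mg v hv, h.fg v hv⟩⟩, ?_⟩
  intro W hW
  constructor
  · rintro ⟨F, hF, rfl⟩
    obtain ⟨G, hG, -, hv⟩ := h1 F hF
    exact ⟨G, hG, hv⟩
  · rintro ⟨G, hG, hv⟩
    obtain ⟨F, hF, -, hFv⟩ := h2 G hG
    exact ⟨F, hF, by rw [hFv, hv, h.gfim hW]⟩

lemma coh_of {M : Set (CubeFace a)} (hM : IsSubcomplex M) {r : ℕ} (hr : 2 ≤ r)
    (hmid : Subsingleton (sHomology (ZMod 2) (↥(real M)) r)) : Coh M r := by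
  obtain ⟨s, rfl⟩ : ∃ s, r = s + 1 := ⟨r - 1, by omega⟩
  exact coh hM (by omega) (fun c hc => sing_van _ s hmid c hc)

end

end CubMan

open CubeFace in
/-- cubical manifolds of dimension `d = 2r` (`r ≥ 2`) embedded in cubes
with vanishing middle `ℤ/2`-homology are determined by their `r`-skeletons. -/
theorem cubical_manifold_determined_by_middle_skeleton
    {a b r : ℕ} (hr : 2 ≤ r)
    (M : Set (CubeFace a)) (hM : IsSubcomplex M) (hMd : HasDim M (2 * r))
    (hmanM : IsCompactManifold (↥(real M)) (2 * r))
    (hmidM : Subsingleton (sHomology (ZMod 2) (↥(real M)) r))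
    (N : Set (CubeFace b)) (hN : IsSubcomplex N) (hNd : HasDim N (2 * r))
    (hmanN : IsCompactManifold (↥(real N)) (2 * r))
    (hmidN : Subsingleton (sHomology (ZMod 2) (↥(real N)) r))
    (hskel : Iso (skel r M) (skel r N)) :
    Iso M N := by
  have h1 := CubMan.locM hM hMd (by omega) hmanM
  have h2 := CubMan.locM hN hNd (by omega) hmanN
  have c1 := CubMan.coh_of hM hr hmidM
  have c2 := CubMan.coh_of hN hr hmidN
  obtain ⟨f, g, h⟩ := CubMan.exists_SI h1.down h2.down hskel
  exact CubMan.iso_of h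
    (fun F hF => CubMan.main_claim hr h h1 h2 c2 _ F hF rfl)
    (fun G hG => CubMan.main_claim hr h.symm h2 h1 c1 _ G hG rfl)
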